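/- arXiv:0802.2734 — 5 statements merged into one kernel-verified Lean document; each statement's English description precedes it below -/
import Mathlib

section
/- Every Λ ⊆ ℤ with d̄(Λ) > 0 contains two elements x, y satisfying y − x = [√2·n² + log n] for some n ∈ ℕ with [√2·n² + log n] ≠ 0. -/
open Filter

/-- The upper density of a set of integers. -/
noncomputable def upperDensity (Λ : Set ℤ) : ℝ :=
  Filter.limsup
    (fun N : ℕ => (Nat.card ↥(Λ ∩ Set.Icc (-(N : ℤ)) (N : ℤ)) : ℝ) / (2 * N + 1))
    Filter.atTop

namespace Rec
open Topology ComplexConjugate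

lemma shift_bound (u : ℕ → ℂ) (hu : ∀ n, ‖u n‖ ≤ 1) (h N : ℕ) :
    ‖∑ n ∈ Finset.range N, u (n + h) - ∑ n ∈ Finset.range N, u n‖ ≤ 2 * h := by
  have h1 : ∑ n ∈ Finset.range N, u (n + h) - ∑ n ∈ Finset.range N, u n
      = ∑ n ∈ Finset.range h, u (N + n) - ∑ n ∈ Finset.range h, u n := by
    have a1 := Finset.sum_range_add u N h
    have a2 := Finset.sum_range_add u h N
    rw [add_comm h N] at a2
    simp only [add_comm h] at a2
    linear_combination a1 - a2
  rw [h1]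
  have b1 : ‖∑ n ∈ Finset.range h, u (N + n)‖ ≤ h := by
    refine (norm_sum_le_of_le _ (fun i _ => hu _)).trans (by simp)
  have b2 : ‖∑ n ∈ Finset.range h, u n‖ ≤ h := by
    refine (norm_sum_le_of_le _ (fun i _ => hu _)).trans (by simp)
  exact (norm_sub_le _ _).trans (by linarith)

lemma tendsto_div_of_bdd (u v : ℕ → ℂ) (C : ℝ) (h : ∀ N, ‖u N - v N‖ ≤ C)
    (w : ℕ → ℂ) (hw : Tendsto (fun N => ‖w N‖) atTop atTop)
    (hv : Tendsto (fun N => v N / w N) atTop (𝓝 0)) :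
    Tendsto (fun N => u N / w N) atTop (𝓝 0) := by
  have h1 : Tendsto (fun N => (u N - v N) / w N) atTop (𝓝 0) := by
    refine squeeze_zero_norm (a := fun N => C / ‖w N‖) (fun N => ?_) ?_
    · rw [norm_div]; gcongr; exact h N
    · exact hw.const_div_atTop C
  have h2 := h1.add hv
  simp only [add_zero] at h2
  refine h2.congr (fun N => ?_)
  rw [← add_div]; simp

lemma corr_lt (u : ℕ → ℂ) (hu : ∀ n, ‖u n‖ ≤ 1)
    (h : ∀ h : ℕ, 1 ≤ h → Tendsto (fun N : ℕ =>
      (∑ n ∈ Finset.range N, u (n + h) * conj (u n)) / (N : ℂ)) atTop (𝓝 0)) (i j : ℕ) (hij : j < i) :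
    Tendsto (fun N : ℕ => (∑ n ∈ Finset.range N, u (n + i) * conj (u (n + j))) / (N : ℂ)) atTop (𝓝 0) := by
  have := h (i - j) (by omega)
  refine tendsto_div_of_bdd _ _ (2 * j) (fun N => ?_) _ ?_ this
  · have := shift_bound (fun n => u (n + (i - j)) * conj (u n)) (fun n => ?_) j N
    · convert this using 6 with n
      omega
    · rw [norm_mul, RCLike.norm_conj]
      exact mul_le_one₀ (hu _) (norm_nonneg _) (hu _)
  · simpa using tendsto_natCast_atTop_atTop (R := ℝ)

lemma corr_ne (u : ℕ → ℂ) (hu : ∀ n, ‖u n‖ ≤ 1)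
    (h : ∀ h : ℕ, 1 ≤ h → Tendsto (fun N : ℕ =>
      (∑ n ∈ Finset.range N, u (n + h) * conj (u n)) / (N : ℂ)) atTop (𝓝 0)) (i j : ℕ) (hij : i ≠ j) :
    Tendsto (fun N : ℕ => (∑ n ∈ Finset.range N, u (n + i) * conj (u (n + j))) / (N : ℂ)) atTop (𝓝 0) := by
  rcases lt_or_gt_of_ne hij with h1 | h1
  · have := (Complex.continuous_conj.tendsto 0).comp (corr_lt u hu h j i h1)
    simp only [map_zero] at this
    refine this.congr (fun N => ?_)
    simp only [Function.comp, map_div₀, map_sum, map_mul, Complex.conj_conj, Complex.conj_natCast]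
    congr 1
    exact Finset.sum_congr rfl (fun n _ => mul_comm _ _)
  · exact corr_lt u hu h i j h1

lemma vdc_ineq (u : ℕ → ℂ) (hu : ∀ n, ‖u n‖ ≤ 1) (H N : ℕ) :
    H * ‖∑ n ∈ Finset.range N, u n‖ ≤ 2 * H ^ 2 + Real.sqrt (N *
      ‖∑ i ∈ Finset.range H, ∑ j ∈ Finset.range H,
        ∑ n ∈ Finset.range N, u (n + i) * conj (u (n + j))‖) := by
  have h1 : ‖(H : ℂ) * ∑ n ∈ Finset.range N, u n‖ ≤
      2 * H ^ 2 + ‖∑ n ∈ Finset.range N, ∑ i ∈ Finset.range H, u (n + i)‖ := by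
    have : (H : ℂ) * ∑ n ∈ Finset.range N, u n =
       - (∑ i ∈ Finset.range H, (∑ n ∈ Finset.range N, u (n + i) - ∑ n ∈ Finset.range N, u n))
       + ∑ n ∈ Finset.range N, ∑ i ∈ Finset.range H, u (n + i) := by
      rw [Finset.sum_comm (s := Finset.range N)]
      simp
    rw [this]
    refine (norm_add_le _ _).trans ?_
    gcongr
    rw [norm_neg]
    have b : ∀ i ∈ Finset.range H, ‖∑ n ∈ Finset.range N, u (n + i) - ∑ n ∈ Finset.range N, u n‖ ≤ 2 * (H:ℝ) := by
      intro i hi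
      have := shift_bound u hu i N
      have h2 : (i : ℝ) ≤ H := by exact_mod_cast (Finset.mem_range.mp hi).le
      linarith
    refine (norm_sum_le_of_le _ b).trans ?_
    simp; nlinarith
  rw [norm_mul, Complex.norm_natCast] at h1
  refine h1.trans ?_
  gcongr
  apply Real.le_sqrt_of_sq_le
  have e : ∑ i ∈ Finset.range H, ∑ j ∈ Finset.range H,
        ∑ n ∈ Finset.range N, u (n + i) * conj (u (n + j))
      = ((∑ n ∈ Finset.range N, ‖∑ i ∈ Finset.range H, u (n + i)‖ ^ 2 : ℝ) : ℂ) := by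
    push_cast
    simp_rw [← Complex.mul_conj', map_sum, Finset.sum_mul_sum]
    rw [Finset.sum_comm (s := Finset.range N)]
    refine Finset.sum_congr rfl (fun i _ => ?_)
    rw [Finset.sum_comm]
  rw [e, Complex.norm_real, Real.norm_of_nonneg (by positivity)]
  calc ‖∑ n ∈ Finset.range N, ∑ i ∈ Finset.range H, u (n + i)‖ ^ 2
      ≤ (∑ n ∈ Finset.range N, ‖∑ i ∈ Finset.range H, u (n + i)‖) ^ 2 := by
        gcongr; exact norm_sum_le _ _
    _ ≤ _ := by
        have := sq_sum_le_card_mul_sum_sq (s := Finset.range N) (f := fun n => ‖∑ i ∈ Finset.range H, u (n + i)‖)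
        simpa using this

lemma vdc (u : ℕ → ℂ) (hu : ∀ n, ‖u n‖ ≤ 1)
    (h : ∀ h : ℕ, 1 ≤ h → Tendsto (fun N : ℕ =>
      (∑ n ∈ Finset.range N, u (n + h) * conj (u n)) / (N : ℂ)) atTop (𝓝 0)) :
    Tendsto (fun N : ℕ => (∑ n ∈ Finset.range N, u n) / (N : ℂ)) atTop (𝓝 0) := by
  have key : ∀ H : ℕ, ∀ᶠ N : ℕ in atTop,
      ‖∑ i ∈ Finset.range H, ∑ j ∈ Finset.range H,
        ∑ n ∈ Finset.range N, u (n + i) * conj (u (n + j))‖ ≤ (H + 1) * N := by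
    intro H
    have t : ∀ i ∈ Finset.range H, ∀ j ∈ Finset.range H, Tendsto (fun N : ℕ =>
        if i = j then (0:ℝ) else ‖(∑ n ∈ Finset.range N, u (n + i) * conj (u (n + j))) / (N : ℂ)‖) atTop (𝓝 0) := by
      intro i _ j _
      split_ifs with hij
      · exact tendsto_const_nhds
      · exact tendsto_zero_iff_norm_tendsto_zero.mp (corr_ne u hu h i j hij)
    have t2 := tendsto_finsetSum (Finset.range H) (fun i hi => tendsto_finsetSum (Finset.range H) (t i hi))
    simp only [Finset.sum_const_zero] at t2
    filter_upwards [t2.eventually (gt_mem_nhds zero_lt_one), eventually_gt_atTop 0] with N hN hN0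
    have hN0' : (0:ℝ) < N := by exact_mod_cast hN0
    have b : ∀ i ∈ Finset.range H, ∀ j ∈ Finset.range H,
        ‖∑ n ∈ Finset.range N, u (n + i) * conj (u (n + j))‖ ≤ (if i = j then (N:ℝ) else 0) + 
         N * (if i = j then (0:ℝ) else ‖(∑ n ∈ Finset.range N, u (n + i) * conj (u (n + j))) / (N : ℂ)‖) := by
      intro i _ j _
      split_ifs with hij
      · have : ∀ n ∈ Finset.range N, ‖u (n + i) * conj (u (n + j))‖ ≤ 1 := by
          intro n _
          rw [norm_mul, RCLike.norm_conj]
          exact mul_le_one₀ (hu _) (norm_nonneg _) (hu _)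
        refine (norm_sum_le_of_le _ this).trans (by simp)
      · rw [norm_div, Complex.norm_natCast]
        field_simp; simp
    refine (norm_sum_le_of_le _ (fun i hi => norm_sum_le_of_le _ (b i hi))).trans ?_
    simp_rw [Finset.sum_add_distrib, ← Finset.mul_sum]
    have : ∑ i ∈ Finset.range H, ∑ j ∈ Finset.range H, (if i = j then (N:ℝ) else 0) = H * N := by
      rw [Finset.sum_congr rfl (g := fun _ => (N:ℝ))]
      · simp
      · intro i hi
        rw [Finset.sum_ite_eq]; simp only [hi, if_true]
    rw [this]
    nlinarith
  rw [tendsto_zero_iff_norm_tendsto_zero, Metric.tendsto_atTop']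
  intro ε hε
  -- choose H
  obtain ⟨H, hH⟩ : ∃ H : ℕ, 16 / ε ^ 2 + 1 < H := exists_nat_gt _
  have hHpos : (1:ℝ) < H := lt_of_le_of_lt (by have : 0 ≤ 16 / ε^2 := by positivity
                                               linarith) hH
  have hev : ∀ᶠ N : ℕ in atTop, 4 * (H:ℝ) / ε < N :=
    (tendsto_natCast_atTop_atTop (R := ℝ)).eventually_gt_atTop _
  obtain ⟨N0, hN0⟩ := eventually_atTop.mp ((key H).and (hev.and (eventually_gt_atTop 0)))
  refine ⟨N0, fun N hN => ?_⟩
  obtain ⟨k1, k2, k3⟩ := hN0 N hN.le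
  have hNp : (0:ℝ) < N := by exact_mod_cast k3
  have := vdc_ineq u hu H N
  have s1 : Real.sqrt (N * ‖∑ i ∈ Finset.range H, ∑ j ∈ Finset.range H,
        ∑ n ∈ Finset.range N, u (n + i) * conj (u (n + j))‖) ≤ N * (H * ε / 2) := by
    apply Real.sqrt_le_iff.mpr ⟨by positivity, ?_⟩
    have : (H + 1 : ℝ) ≤ (H * ε / 2)^2 := by
      have : 16 < H * ε ^ 2 := by
        have : 16 / ε ^ 2 < H := by linarith
        rwa [div_lt_iff₀ (by positivity)] at this
      nlinarith
    calc _ ≤ (N:ℝ) * ((H + 1) * N) := by gcongr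
      _ = N ^ 2 * (H + 1) := by ring
      _ ≤ N ^ 2 * (H * ε / 2)^2 := by gcongr
      _ = _ := by ring
  rw [Real.dist_eq, sub_zero, abs_norm, norm_div, Complex.norm_natCast, div_lt_iff₀ hNp]
  rw [div_lt_iff₀ hε] at k2
  have : H * ‖∑ n ∈ Finset.range N, u n‖ < H * (ε * N) := by nlinarith
  exact lt_of_mul_lt_mul_left this (by positivity)

end Rec

namespace Rec
open Topology ComplexConjugate

/-- the character `e(x) = exp(2πix)` -/
noncomputable def ee (x : ℝ) : ℂ := Complex.exp ((2 * Real.pi * x : ℝ) * Complex.I)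

lemma ee_add (x y : ℝ) : ee (x + y) = ee x * ee y := by
  unfold ee; rw [← Complex.exp_add]; congr 1; push_cast; ring

lemma ee_norm (x : ℝ) : ‖ee x‖ = 1 := Complex.norm_exp_ofReal_mul_I _

lemma ee_int (k : ℤ) : ee k = 1 := by
  unfold ee
  rw [Complex.exp_eq_one_iff]
  exact ⟨k, by push_cast; ring⟩

lemma ee_conj (x : ℝ) : conj (ee x) = ee (-x) := by
  unfold ee; rw [← Complex.exp_conj, map_mul, Complex.conj_ofReal, Complex.conj_I]; congr 1; push_cast; ring

lemma ee_eq_one {x : ℝ} (h : ee x = 1) : ∃ k : ℤ, x = k := by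
  unfold ee at h
  rw [Complex.exp_eq_one_iff] at h
  obtain ⟨k, hk⟩ := h
  refine ⟨k, ?_⟩
  have h2 : (2 * Real.pi * Complex.I) ≠ 0 := Complex.two_pi_I_ne_zero
  have : (x : ℂ) = k := by
    apply mul_left_cancel₀ h2
    rw [mul_comm _ (k : ℂ), ← hk]; push_cast; ring
  exact_mod_cast this

lemma ee_nat_mul (n : ℕ) (x : ℝ) : ee (n * x) = ee x ^ n := by
  unfold ee; rw [← Complex.exp_nat_mul]; congr 1; push_cast; ring

lemma ee_cont : Continuous ee := by unfold ee; fun_prop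

/-- the sequence, shifted by one. -/
noncomputable def aa (n : ℕ) : ℝ := Real.sqrt 2 * ((n + 1 : ℕ) : ℝ) ^ 2 + Real.log ((n + 1 : ℕ) : ℝ)

/-- harmonic sums -/
noncomputable def HH (N : ℕ) : ℝ := ∑ n ∈ Finset.range N, 1 / ((n : ℝ) + 1)

/-- logarithmic averages -/
noncomputable def lav (u : ℕ → ℂ) (N : ℕ) : ℂ :=
  (∑ n ∈ Finset.range N, u n / ((n : ℂ) + 1)) / (HH N : ℂ)

lemma HH_tendsto : Tendsto HH atTop atTop :=
  Real.tendsto_sum_range_one_div_nat_succ_atTop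

lemma HH_nonneg (N : ℕ) : 0 ≤ HH N := by unfold HH; positivity

lemma aa_diff (n h : ℕ) : aa (n + h) - aa n =
    Real.sqrt 2 * (2 * h * n + (2 * h + h ^ 2)) + Real.log (1 + h * ((n : ℝ) + 1)⁻¹) := by
  unfold aa
  have h1 : (1 + h * ((n : ℝ) + 1)⁻¹) = ((n + h + 1 : ℕ) : ℝ) / ((n + 1 : ℕ) : ℝ) := by
    push_cast; field_simp; ring
  rw [h1, Real.log_div (by positivity) (by positivity)]
  push_cast; ring

lemma inv_tendsto : Tendsto (fun n : ℕ => ((n : ℝ) + 1)⁻¹) atTop (𝓝 0) := by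
  simpa using tendsto_one_div_add_atTop_nhds_zero_nat (𝕜 := ℝ)

lemma geom_avg (z : ℂ) (hz : z ≠ 1) (hz1 : ‖z‖ = 1) :
    Tendsto (fun N : ℕ => (∑ n ∈ Finset.range N, z ^ n) / (N : ℂ)) atTop (𝓝 0) := by
  refine tendsto_div_of_bdd _ (fun _ => 0) (2 / ‖z - 1‖) (fun N => ?_) _ ?_ (by simp)
  · rw [geom_sum_eq hz, sub_zero, norm_div]
    gcongr
    refine (norm_sub_le _ _).trans ?_
    rw [norm_pow, hz1]; norm_num
  · simpa using tendsto_natCast_atTop_atTop (R := ℝ)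

lemma corr_avg (β : ℝ) (h : ℕ) (hβ : ee (β * (Real.sqrt 2 * (2 * h))) ≠ 1) :
    Tendsto (fun N : ℕ => (∑ n ∈ Finset.range N, ee (β * aa (n + h)) * conj (ee (β * aa n))) / (N : ℂ))
      atTop (𝓝 0) := by
  set z := ee (β * (Real.sqrt 2 * (2 * h))) with hz
  set c := ee (β * (Real.sqrt 2 * (2 * h + h ^ 2))) with hc
  have e1 : ∀ n : ℕ, ee (β * aa (n + h)) * conj (ee (β * aa n)) =
      c * z ^ n + c * z ^ n * (ee (β * Real.log (1 + h * ((n : ℝ) + 1)⁻¹)) - 1) := by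
    intro n
    rw [ee_conj, ← ee_add, hz, ← ee_nat_mul, hc, ← ee_add]
    have : β * aa (n + h) + -(β * aa n) = β * (aa (n + h) - aa n) := by ring
    rw [this, aa_diff]
    have : β * (Real.sqrt 2 * (2 * h * n + (2 * h + h ^ 2)) + Real.log (1 + h * ((n : ℝ) + 1)⁻¹))
      = (β * (Real.sqrt 2 * (2 * h + h ^ 2)) + n * (β * (Real.sqrt 2 * (2 * h)))) + β * Real.log (1 + h * ((n : ℝ) + 1)⁻¹) := by ring
    rw [this, ee_add _ (β * Real.log _)]
    ring
  have t1 := (geom_avg z hβ (ee_norm _)).const_mul c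
  have lim : Tendsto (fun n : ℕ => ee (β * Real.log (1 + h * ((n : ℝ) + 1)⁻¹)) - 1) atTop (𝓝 0) := by
    have a1 : Tendsto (fun n : ℕ => 1 + h * ((n : ℝ) + 1)⁻¹) atTop (𝓝 1) := by
      simpa using (inv_tendsto.const_mul (h:ℝ)).const_add 1
    have a2 := (Real.continuousAt_log one_ne_zero).tendsto.comp a1
    have a3 := (ee_cont.tendsto _).comp (a2.const_mul β)
    have a4 := a3.sub_const 1
    have : ee (β * Real.log 1) - 1 = 0 := by
      have := ee_int 0
      simp at this ⊢; rw [this]; simp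
    rw [this] at a4
    exact a4
  have t2 : Tendsto (fun n : ℕ => c * z ^ n * (ee (β * Real.log (1 + h * ((n : ℝ) + 1)⁻¹)) - 1)) atTop (𝓝 0) := by
    rw [tendsto_zero_iff_norm_tendsto_zero] at lim ⊢
    refine lim.congr (fun n => ?_)
    rw [norm_mul, norm_mul, norm_pow, hc, hz, ee_norm, ee_norm]; simp
  have t3 := t2.cesaro_smul
  have t4 := t1.add t3
  simp only [mul_zero, add_zero] at t4
  refine t4.congr (fun N => ?_)
  simp_rw [e1, Finset.sum_add_distrib, ← Finset.mul_sum]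
  rw [add_div, mul_div_assoc]
  congr 1
  rw [Complex.real_smul, div_eq_inv_mul]; push_cast; rfl

lemma ces_of_irr (β : ℝ) (hβ : ∀ h : ℕ, 1 ≤ h → ee (β * (Real.sqrt 2 * (2 * h))) ≠ 1) :
    Tendsto (fun N : ℕ => (∑ n ∈ Finset.range N, ee (β * aa n)) / (N : ℂ)) atTop (𝓝 0) :=
  vdc (fun n => ee (β * aa n)) (fun n => (ee_norm _).le) (fun h hh => corr_avg β h (hβ h hh))

lemma littleO_sum (f : ℕ → ℂ) (hf : Tendsto f atTop (𝓝 0)) :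
    Tendsto (lav f) atTop (𝓝 0) := by
  have h1 : (fun n : ℕ => f n / ((n : ℂ) + 1)) =o[atTop] (fun n : ℕ => 1 / ((n : ℝ) + 1)) := by
    rw [Asymptotics.isLittleO_iff]
    intro c hc
    have := (tendsto_zero_iff_norm_tendsto_zero.mp hf).eventually (gt_mem_nhds hc)
    filter_upwards [this] with n hn
    have : ‖(n : ℂ) + 1‖ = (n : ℝ) + 1 := by
      have := Complex.norm_natCast (n + 1); push_cast at this; exact this
    rw [norm_div, this, norm_div, norm_one, Real.norm_of_nonneg (by positivity), mul_one_div]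
    gcongr
  have h2 := h1.sum_range (fun n => by positivity) HH_tendsto
  have h3 : (fun N => ∑ n ∈ Finset.range N, f n / ((n : ℂ) + 1)) =o[atTop] (fun N => (HH N : ℂ)) := by
    rw [← Asymptotics.isLittleO_norm_right]
    simp only [Complex.norm_real]
    exact h2.norm_right
  exact h3.tendsto_div_nhds_zero

lemma log_of_ces (u : ℕ → ℂ) 
    (h : Tendsto (fun N : ℕ => (∑ n ∈ Finset.range N, u n) / (N : ℂ)) atTop (𝓝 0)) :
    Tendsto (lav u) atTop (𝓝 0) := by
  set c : ℕ → ℂ := fun N => (∑ n ∈ Finset.range N, u n) / (N : ℂ) with hc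
  have e : ∀ N : ℕ, ∑ n ∈ Finset.range N, u n / ((n : ℂ) + 1) = c N + ∑ n ∈ Finset.range N, c n / ((n : ℂ) + 1) := by
    intro N
    induction N with
    | zero => simp [hc]
    | succ N ih =>
      rw [Finset.sum_range_succ, ih, Finset.sum_range_succ]
      simp only [hc, Finset.sum_range_succ]
      have : (N : ℂ) + 1 ≠ 0 := by exact_mod_cast Nat.succ_ne_zero N
      rcases Nat.eq_zero_or_pos N with h0 | h0
      · subst h0; simp
      · have : (N : ℂ) ≠ 0 := by exact_mod_cast h0.ne'
        push_cast; field_simp; ring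
  have h1 := littleO_sum c h
  have h2 : Tendsto (fun N => c N / (HH N : ℂ)) atTop (𝓝 0) := by
    rw [tendsto_zero_iff_norm_tendsto_zero] at h ⊢
    have := h.div_atTop HH_tendsto
    refine this.congr (fun N => ?_)
    rw [norm_div (c N), Complex.norm_real, Real.norm_of_nonneg (HH_nonneg N)]
  have h3 := h2.add h1
  simp only [add_zero] at h3
  refine h3.congr (fun N => ?_)
  unfold lav
  rw [e, add_div]

lemma log_of_rat (β : ℝ) (hb : β ≠ 0) (q : ℕ) (hq : 1 ≤ q) (hβ : ∃ k : ℤ, β * Real.sqrt 2 * q = k) :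
    Tendsto (lav (fun n => ee (β * aa n))) atTop (𝓝 0) := by
  obtain ⟨k, hk⟩ := hβ
  set u : ℕ → ℂ := fun n => ee (β * aa n) with hu
  set D : ℂ := (2 * Real.pi * β * q : ℝ) * Complex.I with hD
  have hD0 : D ≠ 0 := by
    rw [hD]
    apply mul_ne_zero _ Complex.I_ne_zero
    have : (q : ℝ) ≠ 0 := by positivity
    exact_mod_cast mul_ne_zero (mul_ne_zero (by positivity) hb) this
  -- ratio
  have r : ∀ n, u (n + q) = u n * ee (β * Real.log (1 + q * ((n : ℝ) + 1)⁻¹)) := by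
    intro n
    have : β * aa (n + q) = β * aa n + (((k * (2 * n + 2 + q) : ℤ) : ℝ) + β * Real.log (1 + q * ((n : ℝ) + 1)⁻¹)) := by
      have := aa_diff n q
      push_cast
      rw [← hk]
      linear_combination β * this
    simp only [hu]
    rw [this, ee_add, ee_add, ee_int, one_mul]
  have hd : HasDerivAt (fun x : ℝ => ee (β * Real.log (1 + q * x))) D 0 := by
    have a1 : HasDerivAt (fun x : ℝ => 1 + q * x) (q * 1 : ℝ) 0 := ((hasDerivAt_id (0:ℝ)).const_mul (q:ℝ)).const_add 1
    have a2 := (a1.log (by simp)).const_mul (2 * Real.pi * β)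
    have a3 := (a2.ofReal_comp.mul_const Complex.I).cexp
    have e1 : (fun x : ℝ => ee (β * Real.log (1 + q * x))) = fun x : ℝ => Complex.exp (((2 * Real.pi * β * Real.log (1 + q * x) : ℝ) : ℂ) * Complex.I) := by
      funext x; unfold ee; congr 3; ring
    rw [e1]
    convert a3 using 1
    rw [hD]; simp
  have hs := hd.tendsto_slope_zero
  have t : Tendsto (fun n : ℕ => ((n : ℝ) + 1)⁻¹) atTop (𝓝[≠] 0) :=
    tendsto_nhdsWithin_iff.mpr ⟨inv_tendsto, Eventually.of_forall (fun n => by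
      simp only [Set.mem_compl_iff, Set.mem_singleton_iff]; positivity)⟩
  have hs2 := hs.comp t
  have hs3 : Tendsto (fun n : ℕ => ((n:ℂ) + 1) * (u (n + q) - u n) - D * u n) atTop (𝓝 0) := by
    have := hs2.sub_const D
    rw [sub_self, tendsto_zero_iff_norm_tendsto_zero] at this
    rw [tendsto_zero_iff_norm_tendsto_zero]
    refine this.congr (fun n => ?_)
    have e0 : ee (β * Real.log (1 + q * 0)) = 1 := by
      have := ee_int 0
      simp at this ⊢; rw [this]
    simp only [Function.comp, zero_add, e0, inv_inv]
    have : ((n:ℂ) + 1) * (u (n + q) - u n) - D * u n = u n * (((n : ℝ) + 1) • (ee (β * Real.log (1 + q * ((n : ℝ) + 1)⁻¹)) - 1) - D) := by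
      rw [r, Complex.real_smul]; push_cast; ring
    rw [this, norm_mul]
    simp only [hu]
    rw [ee_norm, one_mul]
  have hs4 := littleO_sum _ hs3
  have hs5 : Tendsto (fun N => (∑ n ∈ Finset.range N, u (n + q) - ∑ n ∈ Finset.range N, u n) / (HH N : ℂ)) atTop (𝓝 0) := by
    refine tendsto_div_of_bdd _ (fun _ => 0) (2 * q) (fun N => ?_) _ ?_ (by simp)
    · rw [sub_zero]; exact shift_bound u (fun n => (ee_norm _).le) q N
    · refine HH_tendsto.congr (fun N => ?_)
      rw [Complex.norm_real, Real.norm_of_nonneg (HH_nonneg N)]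
  have h6 := (hs5.sub hs4).const_mul D⁻¹
  simp only [sub_zero, mul_zero] at h6
  refine h6.congr (fun N => ?_)
  unfold lav
  rw [← sub_div, ← mul_div_assoc, ← Finset.sum_sub_distrib, ← Finset.sum_sub_distrib, Finset.mul_sum]
  congr 1
  refine Finset.sum_congr rfl (fun n _ => ?_)
  have : (n : ℂ) + 1 ≠ 0 := by exact_mod_cast Nat.succ_ne_zero n
  field_simp
  ring

lemma lav_ee (β : ℝ) (hb : β ≠ 0) : Tendsto (lav (fun n => ee (β * aa n))) atTop (𝓝 0) := by
  by_cases h : ∃ h : ℕ, 1 ≤ h ∧ ee (β * (Real.sqrt 2 * (2 * h))) = 1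
  · obtain ⟨h, h1, h2⟩ := h
    obtain ⟨k, hk⟩ := ee_eq_one h2
    exact log_of_rat β hb (2 * h) (by omega) ⟨k, by rw [← hk]; push_cast; ring⟩
  · push Not at h
    exact log_of_ces _ (ces_of_irr β h)

end Rec

namespace Rec
open Topology ComplexConjugate

lemma lav_add (u v : ℕ → ℂ) (N : ℕ) : lav (fun n => u n + v n) N = lav u N + lav v N := by
  unfold lav; simp_rw [add_div, Finset.sum_add_distrib, add_div]

lemma lav_smul (c : ℂ) (u : ℕ → ℂ) (N : ℕ) : lav (fun n => c * u n) N = c * lav u N := by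
  unfold lav; simp_rw [mul_div_assoc, ← Finset.mul_sum]; rw [mul_div_assoc]

lemma lav_bound (u : ℕ → ℂ) (C : ℝ) (hC : 0 ≤ C) (hu : ∀ n, ‖u n‖ ≤ C) (N : ℕ) : ‖lav u N‖ ≤ C := by
  unfold lav
  rw [norm_div, Complex.norm_real, Real.norm_of_nonneg (HH_nonneg N)]
  refine div_le_of_le_mul₀ (HH_nonneg N) hC ?_
  unfold HH
  rw [Finset.mul_sum]
  refine norm_sum_le_of_le _ (fun n _ => ?_)
  have : ‖(n : ℂ) + 1‖ = (n : ℝ) + 1 := by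
    have := Complex.norm_natCast (n + 1); push_cast at this; exact this
  rw [norm_div, this, mul_one_div]
  gcongr
  exact hu n

lemma lav_one : Tendsto (lav (fun _ => 1)) atTop (𝓝 1) := by
  refine tendsto_const_nhds.congr' ?_
  filter_upwards [HH_tendsto.eventually_gt_atTop 0] with N hN
  unfold lav
  have : (HH N : ℂ) = ∑ n ∈ Finset.range N, 1 / ((n : ℂ) + 1) := by
    unfold HH; push_cast; rfl
  rw [← this, div_self]
  exact_mod_cast hN.ne'

lemma fourier_ee (k : ℤ) (x : ℝ) : fourier k (x : UnitAddCircle) = ee (k * x) := by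
  rw [fourier_coe_apply]; unfold ee; congr 1; push_cast; ring

lemma lav_cont (θ : ℝ) (hθ : ∀ k : ℤ, θ ≠ k) (G : C(UnitAddCircle, ℂ)) :
    Tendsto (lav (fun n => ee (θ * aa n) * G ((aa n : ℝ) : UnitAddCircle))) atTop (𝓝 0) := by
  have hspan : ∀ g ∈ Submodule.span ℂ (Set.range (@fourier (1:ℝ))),
      Tendsto (lav (fun n => ee (θ * aa n) * g ((aa n : ℝ) : UnitAddCircle))) atTop (𝓝 0) := by
    intro g hg
    induction hg using Submodule.span_induction with
    | mem x hx =>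
      obtain ⟨k, rfl⟩ := hx
      have := lav_ee (θ + k) (fun h => hθ (-k) (by push_cast; linarith))
      refine this.congr (fun N => ?_)
      congr 1
      funext n
      rw [fourier_ee, ← ee_add]; congr 1; ring
    | zero =>
      have : lav (fun _ => (0:ℂ)) = fun _ => 0 := by funext N; simp [lav]
      simp [this]
    | add x y _ _ hx hy =>
      have := hx.add hy
      rw [add_zero] at this
      refine this.congr (fun N => ?_)
      rw [← lav_add]
      congr 1; funext n; simp; ring
    | smul c x _ hx =>
      have := hx.const_mul c
      rw [mul_zero] at this
      refine this.congr (fun N => ?_)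
      rw [← lav_smul]
      congr 1; funext n; simp; ring
  have hG : G ∈ closure (Submodule.span ℂ (Set.range (@fourier (1:ℝ))) : Set C(UnitAddCircle, ℂ)) := by
    have : G ∈ (Submodule.span ℂ (Set.range (@fourier (1:ℝ)))).topologicalClosure := by
      rw [span_fourier_closure_eq_top]; trivial
    exact this
  rw [Metric.tendsto_atTop]
  intro ε hε
  obtain ⟨g, hg, hgd⟩ := Metric.mem_closure_iff.mp hG (ε / 2) (by positivity)
  obtain ⟨N0, hN0⟩ := Metric.tendsto_atTop.mp (hspan g hg) (ε / 2) (by positivity)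
  refine ⟨N0, fun N hN => ?_⟩
  have h1 := hN0 N hN
  rw [dist_zero_right] at h1 ⊢
  have e : lav (fun n => ee (θ * aa n) * G ((aa n : ℝ) : UnitAddCircle)) N =
     lav (fun n => ee (θ * aa n) * (G - g) ((aa n : ℝ) : UnitAddCircle)) N + lav (fun n => ee (θ * aa n) * g ((aa n : ℝ) : UnitAddCircle)) N := by
    rw [← lav_add]; congr 1; funext n; simp; ring
  rw [e]
  have b : ‖lav (fun n => ee (θ * aa n) * (G - g) ((aa n : ℝ) : UnitAddCircle)) N‖ ≤ ‖G - g‖ := by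
    apply lav_bound _ _ (norm_nonneg _)
    intro n
    rw [norm_mul, ee_norm, one_mul]
    exact ContinuousMap.norm_coe_le_norm _ _
  rw [dist_eq_norm] at hgd
  refine (norm_add_le _ _).trans_lt ?_
  linarith

/-- smooth weight vanishing at integers -/
noncomputable def chi (x : ℝ) : ℝ := Real.sin (Real.pi * x) ^ 2

lemma chi_ee (x : ℝ) : (chi x : ℂ) = 1 / 2 + (-1/4) * ee (1 * x) + (-1/4) * ee ((-1) * x) := by
  have h : chi x = 1 / 2 - Real.cos (2 * Real.pi * x) / 2 := by
    unfold chi; rw [Real.sin_sq_eq_half_sub]; congr 3; ring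
  rw [h]
  unfold ee
  push_cast
  rw [Complex.cos]
  have e1 : 2 * (Real.pi : ℂ) * (1 * x) * Complex.I = 2 * Real.pi * x * Complex.I := by ring
  have e2 : 2 * (Real.pi : ℂ) * (-1 * x) * Complex.I = -(2 * Real.pi * x) * Complex.I := by ring
  rw [e1, e2]; ring

lemma chi_fract (x : ℝ) : chi (Int.fract x) = chi x := by
  unfold chi Int.fract
  rw [mul_sub, mul_comm _ (⌊x⌋ : ℝ), Real.sin_sub_int_mul_pi, mul_pow]
  have : (((-1 : ℝ) ^ ⌊x⌋)) ^ 2 = 1 := by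
    rw [← zpow_natCast, ← zpow_mul, mul_comm, zpow_mul]; norm_num
  rw [this, one_mul]

/-- the relevant circle function -/
noncomputable def VV (N : ℕ) (θ : ℝ) : ℂ := lav (fun n => (chi (aa n) : ℂ) * ee (⌊aa n⌋ * θ)) N

lemma VV_int (k : ℤ) : Tendsto (fun N => VV N k) atTop (𝓝 (1 / 2)) := by
  have h := ((lav_one.const_mul (1/2)).add ((lav_ee 1 one_ne_zero).const_mul (-1/4))).add
    ((lav_ee (-1) (by norm_num)).const_mul (-1/4))
  simp only [mul_zero, add_zero, mul_one] at h
  refine h.congr (fun N => ?_)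
  unfold VV
  rw [← lav_smul, ← lav_smul, ← lav_smul, ← lav_add, ← lav_add]
  congr 1; funext n
  rw [chi_ee]
  have : ee (⌊aa n⌋ * k) = 1 := by exact_mod_cast ee_int (⌊aa n⌋ * k)
  rw [this]; ring

lemma VV_nonint (θ : ℝ) (hθ : ∀ k : ℤ, θ ≠ k) : Tendsto (fun N => VV N θ) atTop (𝓝 0) := by
  set f : ℝ → ℂ := fun x => (chi x : ℂ) * ee (-(θ * x)) with hf
  have hc : Continuous (AddCircle.liftIco (1:ℝ) 0 f) := by
    apply AddCircle.liftIco_continuous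
    · simp [hf, chi]
    · apply Continuous.continuousOn
      have := ee_cont
      have : Continuous chi := by unfold chi; fun_prop
      fun_prop
  have h := lav_cont θ hθ ⟨_, hc⟩
  refine h.congr (fun N => ?_)
  unfold VV
  congr 1; funext n
  have e1 : ((aa n : ℝ) : UnitAddCircle) = ((Int.fract (aa n) : ℝ) : UnitAddCircle) := by
    unfold Int.fract
    rw [AddCircle.coe_sub]
    have : ((⌊aa n⌋ : ℝ) : UnitAddCircle) = 0 := by
      rw [AddCircle.coe_eq_zero_iff]
      exact ⟨⌊aa n⌋, by simp⟩
    rw [this, sub_zero]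
  rw [e1, ContinuousMap.coe_mk, AddCircle.liftIco_coe_apply ⟨Int.fract_nonneg _, by simpa using Int.fract_lt_one (aa n)⟩]
  simp only [hf]
  rw [chi_fract, mul_left_comm, ← ee_add]
  congr 2
  unfold Int.fract; ring

end Rec

namespace Rec
open Topology ComplexConjugate MeasureTheory
open scoped Pointwise

lemma int_cont (μ : Measure UnitAddCircle) [IsFiniteMeasure μ] (f : UnitAddCircle → ℂ) (hf : Continuous f) :
    Integrable f μ :=
  (BoundedContinuousFunction.mkOfCompact ⟨f, hf⟩).integrable μ

lemma int_fourier (k : ℤ) : ∫ x : UnitAddCircle, fourier k x ∂AddCircle.haarAddCircle = if k = 0 then 1 else 0 := by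
  split_ifs with h
  · subst h; simp
  · exact integral_eq_zero_of_add_right_eq_neg (μ := AddCircle.haarAddCircle)
      (fourier_add_half_inv_index h one_pos)

lemma normsq_poly (A : Finset ℤ) (x : UnitAddCircle) :
    ((‖∑ a ∈ A, fourier a x‖ ^ 2 : ℝ) : ℂ) = ∑ p ∈ A ×ˢ A, fourier (p.1 - p.2) x := by
  push_cast
  rw [← Complex.mul_conj', map_sum, Finset.sum_mul_sum, ← Finset.sum_product']
  refine Finset.sum_congr rfl (fun p _ => ?_)
  rw [← fourier_neg, ← fourier_add, sub_eq_add_neg]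

lemma exists_meas (A : Finset ℤ) (hA : A.Nonempty) :
    ∃ ν : ProbabilityMeasure UnitAddCircle, ∀ r : ℤ, ∫ x, fourier r x ∂(ν : Measure UnitAddCircle)
      = ((A ×ˢ A).filter (fun p => r + (p.1 - p.2) = 0)).card / (A.card : ℂ) := by
  set d : UnitAddCircle → NNReal := fun x => Real.toNNReal (‖∑ a ∈ A, fourier a x‖ ^ 2 / A.card) with hd
  have hdc : Continuous d := by
    have : Continuous (fun x : UnitAddCircle => ∑ a ∈ A, fourier a x) :=
      continuous_finsetSum _ (fun a _ => (fourier a).continuous)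
    exact continuous_real_toNNReal.comp ((this.norm.pow 2).div_const _)
  set μ : Measure UnitAddCircle := AddCircle.haarAddCircle.withDensity (fun x => d x) with hμ
  have key : ∀ r : ℤ, ∫ x, fourier r x ∂μ
      = ((A ×ˢ A).filter (fun p => r + (p.1 - p.2) = 0)).card / (A.card : ℂ) := by
    intro r
    rw [hμ, integral_withDensity_eq_integral_smul hdc.measurable]
    have e : ∀ x : UnitAddCircle, d x • fourier r x = (∑ p ∈ A ×ˢ A, fourier (r + (p.1 - p.2)) x) / (A.card : ℂ) := by
      intro x
      rw [NNReal.smul_def, hd, Real.coe_toNNReal _ (by positivity), Complex.real_smul, Complex.ofReal_div,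
        normsq_poly, div_mul_eq_mul_div, Finset.sum_mul]
      congr 1
      refine Finset.sum_congr rfl (fun p _ => ?_)
      rw [← fourier_add, add_comm]
    simp_rw [e]
    rw [integral_div, integral_finsetSum _ (fun p _ => int_cont _ _ (fourier _).continuous)]
    simp_rw [int_fourier]
    simp
  have hp : IsProbabilityMeasure μ := by
    have h0 := key 0
    have hc : (A.card : ℂ) ≠ 0 := by exact_mod_cast hA.card_ne_zero
    have hcard : ((A ×ˢ A).filter (fun p => 0 + (p.1 - p.2) = 0)).card = A.card := by
      rw [← Finset.diag_card A]
      congr 1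
      ext ⟨a, b⟩
      simp [Finset.mem_diag, sub_eq_zero]
      grind
    rw [hcard, div_self hc] at h0
    simp only [fourier_zero, integral_const, Complex.real_smul, mul_one] at h0
    have h1 : μ.real Set.univ = 1 := by exact_mod_cast h0
    exact ⟨(ENNReal.toReal_eq_one_iff _).mp h1⟩
  exact ⟨⟨μ, hp⟩, key⟩

lemma energy_bound (A : Finset ℤ) (hA : A.Nonempty) (M K : ℕ) (hAM : A ⊆ Finset.Icc (-(M:ℤ)) M) 
    (ν : ProbabilityMeasure UnitAddCircle) (hν : ∀ r : ℤ, ∫ x, fourier r x ∂(ν : Measure UnitAddCircle)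
      = ((A ×ˢ A).filter (fun p => r + (p.1 - p.2) = 0)).card / (A.card : ℂ)) :
    (A.card : ℝ) * K ^ 2 / (2 * M + 1 + K) ≤
      (∑ p ∈ (Finset.Ico (0:ℤ) K) ×ˢ (Finset.Ico (0:ℤ) K), ∫ x, fourier (p.1 - p.2) x ∂(ν : Measure UnitAddCircle)).re := by
  set t := Finset.Ico (0:ℤ) K with ht
  have h1 := Finset.le_card_add_mul_addEnergy A t
  have e : (Finset.addEnergy A t : ℂ) = A.card * ∑ p ∈ t ×ˢ t, ∫ x, fourier (p.1 - p.2) x ∂(ν : Measure UnitAddCircle) := by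
    simp_rw [hν, ← Finset.sum_div]
    have hc : (A.card : ℂ) ≠ 0 := by exact_mod_cast hA.card_ne_zero
    rw [mul_div_cancel₀ _ hc]
    unfold Finset.addEnergy
    simp_rw [Finset.card_filter]
    rw [Finset.sum_product_right (s := A ×ˢ A)]
    push_cast
    refine Finset.sum_congr rfl (fun p _ => Finset.sum_congr rfl (fun q _ => ?_))
    congr 1
    apply propext
    constructor <;> intro h <;> linarith
  have e2 : (Finset.addEnergy A t : ℝ) = A.card * (∑ p ∈ t ×ˢ t, ∫ x, fourier (p.1 - p.2) x ∂(ν : Measure UnitAddCircle)).re := by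
    have := congrArg Complex.re e
    rw [← Complex.ofReal_natCast A.card, Complex.re_ofReal_mul] at this
    simpa using this
  have h2 : (A + t).card ≤ 2 * M + 1 + K := by
    have : A + t ⊆ Finset.Icc (-(M:ℤ)) (M + K) := by
      intro x hx
      obtain ⟨a, ha, b, hb, rfl⟩ := Finset.mem_add.mp hx
      have := Finset.mem_Icc.mp (hAM ha)
      have := Finset.mem_Ico.mp hb
      simp only [Finset.mem_Icc]; omega
    refine (Finset.card_le_card this).trans ?_
    simp; omega
  have h3 : t.card = K := by simp [ht]
  rw [h3] at h1
  have h4 : (A.card : ℝ) ^ 2 * K ^ 2 ≤ (2 * M + 1 + K) * Finset.addEnergy A t := by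
    have : A.card ^ 2 * K ^ 2 ≤ (2 * M + 1 + K) * Finset.addEnergy A t := h1.trans (by gcongr)
    exact_mod_cast this
  rw [e2] at h4
  have hc : (0:ℝ) < A.card := by exact_mod_cast hA.card_pos
  rw [div_le_iff₀ (by positivity)]
  apply le_of_mul_le_mul_left _ hc
  linarith

lemma fourier_eq_one (x : UnitAddCircle) (h : fourier 1 x = 1) : x = 0 := by
  induction x using QuotientAddGroup.induction_on with
  | H y =>
    have := fourier_ee 1 y
    rw [show ((QuotientAddGroup.mk y : UnitAddCircle)) = ((y : ℝ) : UnitAddCircle) from rfl] at h ⊢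
    rw [h] at this
    obtain ⟨k, hk⟩ := ee_eq_one this.symm
    rw [AddCircle.coe_eq_zero_iff]
    exact ⟨k, by simp at hk ⊢; exact hk.symm⟩

lemma fejer_eq (K : ℕ) (x : UnitAddCircle) :
    ∑ p ∈ (Finset.Ico (0:ℤ) K) ×ˢ (Finset.Ico (0:ℤ) K), fourier (p.1 - p.2) x
      = ((‖∑ k ∈ Finset.range K, fourier 1 x ^ k‖ ^ 2 : ℝ) : ℂ) := by
  rw [← normsq_poly]
  suffices hs : ∑ a ∈ Finset.Ico (0:ℤ) K, fourier a x = ∑ k ∈ Finset.range K, fourier 1 x ^ k by rw [hs]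
  rw [show Finset.Ico (0:ℤ) K = (Finset.range K).image (fun n : ℕ => (n : ℤ)) by
    ext a; simp only [Finset.mem_Ico, Finset.mem_image, Finset.mem_range]
    constructor
    · intro h; exact ⟨a.toNat, by omega, by omega⟩
    · rintro ⟨n, hn, rfl⟩; omega]
  rw [Finset.sum_image (by intro a _ b _ h; exact Int.ofNat.inj h)]
  refine Finset.sum_congr rfl (fun k hk => ?_)
  clear hk
  induction k with
  | zero => simp
  | succ k ih => rw [pow_succ, ← ih, ← fourier_add]; push_cast; rfl

lemma mass_zero (ν : ProbabilityMeasure UnitAddCircle) (δ : ℝ)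
    (h : ∀ K : ℕ, δ * K ^ 2 ≤ (∑ p ∈ (Finset.Ico (0:ℤ) K) ×ˢ (Finset.Ico (0:ℤ) K),
      ∫ x, fourier (p.1 - p.2) x ∂(ν : Measure UnitAddCircle)).re) :
    δ ≤ (ν : Measure UnitAddCircle).real {0} := by
  set g : ℕ → UnitAddCircle → ℝ := fun K x => ‖(∑ k ∈ Finset.range K, fourier 1 x ^ k) / (K : ℂ)‖ ^ 2 with hg
  have hgc : ∀ K, Continuous (g K) := by
    intro K
    have : Continuous (fun x : UnitAddCircle => ∑ k ∈ Finset.range K, fourier 1 x ^ k) :=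
      continuous_finsetSum _ (fun a _ => (fourier 1).continuous.pow _)
    exact (this.div_const _).norm.pow 2
  have n1 : ∀ x : UnitAddCircle, ‖fourier 1 x‖ = 1 := fun x => Circle.norm_coe _
  have hgb : ∀ K x, ‖g K x‖ ≤ 1 := by
    intro K x
    rw [hg, Real.norm_of_nonneg (by positivity)]
    apply pow_le_one₀ (norm_nonneg _)
    rw [norm_div, Complex.norm_natCast]
    apply div_le_of_le_mul₀ (by positivity) zero_le_one
    refine (norm_sum_le_of_le _ (n := fun _ => 1) (fun k _ => ?_)).trans (by simp)
    rw [norm_pow, n1, one_pow]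
  have lim : ∀ x, Tendsto (fun K => g K x) atTop (𝓝 (Set.indicator {0} (fun _ => (1:ℝ)) x)) := by
    intro x
    by_cases hx : x = 0
    · subst hx
      refine tendsto_const_nhds.congr' ?_
      filter_upwards [eventually_gt_atTop 0] with K hK
      have : (K:ℝ) ≠ 0 := by exact_mod_cast hK.ne'
      simp [hg, div_self this]
    · have h1 : fourier 1 x ≠ 1 := fun h => hx (fourier_eq_one x h)
      have := ((geom_avg _ h1 (n1 x)).norm.pow 2)
      simpa [hx, hg] using this
  have t := tendsto_integral_of_dominated_convergence (μ := (ν : Measure UnitAddCircle)) (F := g) (fun _ => (1:ℝ))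
    (fun K => (hgc K).aestronglyMeasurable) (integrable_const _) (fun K => Eventually.of_forall (hgb K))
    (Eventually.of_forall lim)
  rw [integral_indicator_const _ (measurableSet_singleton 0), smul_eq_mul, mul_one] at t
  refine ge_of_tendsto t ?_
  filter_upwards [eventually_gt_atTop 0] with K hK
  have hK0 : (0:ℝ) < K := by exact_mod_cast hK
  have hh := h K
  rw [← integral_finsetSum _ (fun p _ => int_cont _ _ (fourier _).continuous)] at hh
  simp_rw [fejer_eq] at hh
  rw [integral_complex_ofReal, Complex.ofReal_re] at hh
  have : ∀ x, g K x = ‖∑ k ∈ Finset.range K, fourier 1 x ^ k‖ ^ 2 / (K:ℝ)^2 := by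
    intro x; simp only [hg]; rw [norm_div, Complex.norm_natCast, div_pow]
  simp_rw [this]
  rw [integral_div, le_div_iff₀ (by positivity)]
  exact hh

lemma mass_zero_eq (ν : ProbabilityMeasure UnitAddCircle)
    (h : ∀ n, ∫ x, fourier ⌊aa n⌋ x ∂(ν : Measure UnitAddCircle) = 0) :
    (ν : Measure UnitAddCircle).real {0} = 0 := by
  set g : ℕ → UnitAddCircle → ℂ := fun N x => lav (fun n => (chi (aa n) : ℂ) * fourier ⌊aa n⌋ x) N with hg
  have hVV : ∀ N (y : ℝ), g N (y : UnitAddCircle) = VV N y := by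
    intro N y
    simp only [hg, VV]
    congr 1; funext n; rw [fourier_ee]
  have hgc : ∀ N, Continuous (g N) := by
    intro N
    simp only [hg, lav]
    refine (continuous_finsetSum _ (fun n _ => ?_)).div_const _
    exact (continuous_const.mul (fourier _).continuous).div_const _
  have hgb : ∀ N x, ‖g N x‖ ≤ 1 := by
    intro N x
    apply lav_bound _ _ zero_le_one
    intro n
    have h1 : ‖fourier ⌊aa n⌋ x‖ = 1 := Circle.norm_coe _
    rw [norm_mul, h1, mul_one, Complex.norm_real]
    unfold chi
    rw [Real.norm_of_nonneg (by positivity)]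
    exact Real.sin_sq_le_one _
  have lim : ∀ x, Tendsto (fun N => g N x) atTop (𝓝 (Set.indicator {0} (fun _ => (1/2:ℂ)) x)) := by
    intro x
    induction x using QuotientAddGroup.induction_on with
    | H y =>
    rw [show ((QuotientAddGroup.mk y : UnitAddCircle)) = ((y : ℝ) : UnitAddCircle) from rfl]
    simp_rw [hVV]
    by_cases hy : ∃ k : ℤ, y = k
    · obtain ⟨k, rfl⟩ := hy
      have : ((k : ℝ) : UnitAddCircle) = 0 := by
        rw [AddCircle.coe_eq_zero_iff]; exact ⟨k, by simp⟩
      rw [this]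
      simpa using VV_int k
    · have : ((y : ℝ) : UnitAddCircle) ≠ 0 := by
        intro h0
        rw [AddCircle.coe_eq_zero_iff] at h0
        obtain ⟨k, hk⟩ := h0
        exact hy ⟨k, by simp at hk; exact hk.symm⟩
      push Not at hy
      simpa [this] using VV_nonint y hy
  have t := tendsto_integral_of_dominated_convergence (μ := (ν : Measure UnitAddCircle)) (F := g) (fun _ => (1:ℝ))
    (fun K => (hgc K).aestronglyMeasurable) (integrable_const _) (fun K => Eventually.of_forall (hgb K))
    (Eventually.of_forall lim)
  rw [integral_indicator_const _ (measurableSet_singleton 0)] at t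
  have z : ∀ N, ∫ x, g N x ∂(ν : Measure UnitAddCircle) = 0 := by
    intro N
    simp only [hg, lav]
    rw [integral_div, integral_finsetSum]
    · simp_rw [integral_div, integral_const_mul, h]; simp
    · intro n _
      exact int_cont _ _ ((continuous_const.mul (fourier _).continuous).div_const _)
  simp_rw [z] at t
  have := tendsto_nhds_unique t tendsto_const_nhds
  simpa using this

end Rec
namespace Rec
open Topology ComplexConjugate MeasureTheory

lemma aa_ge_one (n : ℕ) : 1 ≤ aa n := by
  unfold aa
  have h1 : (1:ℝ) ≤ ((n + 1 : ℕ) : ℝ) := by push_cast; linarith [Nat.cast_nonneg (α := ℝ) n]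
  have h2 := Real.log_nonneg h1
  have h3 : (1:ℝ) ≤ Real.sqrt 2 := Real.one_le_sqrt.mpr (by norm_num)
  have h4 : (1:ℝ) ≤ ((n + 1 : ℕ) : ℝ) ^ 2 := one_le_pow₀ h1
  nlinarith

lemma exists_diff (Λ : Set ℤ) (hΛ : 0 < upperDensity Λ) :
    ∃ n, ∃ x ∈ Λ, ∃ y ∈ Λ, y - x = ⌊aa n⌋ := by
  classical
  by_contra hcon
  push Not at hcon
  set A : ℕ → Finset ℤ := fun M => (Finset.Icc (-(M:ℤ)) M).filter (· ∈ Λ) with hA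
  have hcard : ∀ M : ℕ, Nat.card ↥(Λ ∩ Set.Icc (-(M : ℤ)) (M : ℤ)) = (A M).card := by
    intro M
    have : Λ ∩ Set.Icc (-(M : ℤ)) (M : ℤ) = ((A M : Finset ℤ) : Set ℤ) := by
      ext x; simp only [hA, Finset.coe_filter, Finset.mem_Icc, Set.mem_inter_iff, Set.mem_Icc, Set.mem_ofPred_eq]; tauto
    rw [this, Nat.card_coe_set_eq, Set.ncard_coe_finset]
  set δ := upperDensity Λ / 2 with hδ
  have hδ0 : 0 < δ := by positivity
  have hfreq : ∃ᶠ M : ℕ in atTop, δ < ((A M).card : ℝ) / (2 * M + 1) := by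
    have : δ < upperDensity Λ := by rw [hδ]; linarith
    unfold upperDensity at this
    have := frequently_lt_of_lt_limsup (IsBoundedUnder.isCoboundedUnder_le ⟨0, ?_⟩) this
    · simpa only [hcard] using this
    · simp only [eventually_map]
      exact Eventually.of_forall (fun N => by positivity)
  have hex : ∀ M : ℕ, ∃ ν : ProbabilityMeasure UnitAddCircle, (A M).Nonempty → ∀ r : ℤ,
      ∫ x, fourier r x ∂(ν : Measure UnitAddCircle)
      = ((A M ×ˢ A M).filter (fun p => r + (p.1 - p.2) = 0)).card / ((A M).card : ℂ) := by
    intro M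
    by_cases h : (A M).Nonempty
    · obtain ⟨ν, hν⟩ := exists_meas (A M) h
      exact ⟨ν, fun _ => hν⟩
    · exact ⟨⟨AddCircle.haarAddCircle, inferInstance⟩, fun hh => absurd hh h⟩
  choose ν hν using hex
  have hne : NeBot (atTop ⊓ 𝓟 {M : ℕ | δ < ((A M).card : ℝ) / (2 * M + 1)}) :=
    frequently_mem_iff_neBot.mp hfreq
  set F : Ultrafilter ℕ := Ultrafilter.of (atTop ⊓ 𝓟 {M : ℕ | δ < ((A M).card : ℝ) / (2 * M + 1)}) with hF
  have hF1 : (F : Filter ℕ) ≤ atTop ⊓ 𝓟 {M : ℕ | δ < ((A M).card : ℝ) / (2 * M + 1)} := Ultrafilter.of_le _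
  have hFt : (F : Filter ℕ) ≤ atTop := hF1.trans inf_le_left
  have hFe : ∀ᶠ M in (F : Filter ℕ), δ < ((A M).card : ℝ) / (2 * M + 1) :=
    le_principal_iff.mp (hF1.trans inf_le_right)
  have hnonempty : ∀ M, δ < ((A M).card : ℝ) / (2 * M + 1) → (A M).Nonempty := by
    intro M hM
    by_contra h
    rw [Finset.not_nonempty_iff_eq_empty] at h
    rw [h] at hM; simp at hM; linarith
  set μ := (F.map ν).lim with hμ
  have hlim : Tendsto ν F (𝓝 μ) := Ultrafilter.le_nhds_lim (F.map ν)
  have hfour : ∀ r : ℤ, Tendsto (fun M => ∫ x, fourier r x ∂(ν M : Measure UnitAddCircle)) F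
      (𝓝 (∫ x, fourier r x ∂(μ : Measure UnitAddCircle))) := by
    intro r
    exact (ProbabilityMeasure.tendsto_iff_forall_integral_rclike_tendsto ℂ).mp hlim
      (BoundedContinuousFunction.mkOfCompact (fourier r))
  have h1 : δ ≤ (μ : Measure UnitAddCircle).real {0} := by
    apply mass_zero
    intro K
    have t1 := (Complex.continuous_re.tendsto _).comp (tendsto_finsetSum ((Finset.Ico (0:ℤ) K) ×ˢ (Finset.Ico (0:ℤ) K))
      (fun p _ => hfour (p.1 - p.2)))
    have t2 : Tendsto (fun M : ℕ => δ * K ^ 2 * ((2 * M + 1) / (2 * M + 1 + K) : ℝ)) F (𝓝 (δ * K ^ 2 * 1)) := by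
      apply Tendsto.const_mul
      apply Tendsto.mono_left _ hFt
      have a : Tendsto (fun M : ℕ => 1 - (K:ℝ) / (2 * M + 1 + K)) atTop (𝓝 (1 - 0)) := by
        apply Tendsto.const_sub
        apply Tendsto.const_div_atTop
        refine tendsto_atTop_mono (fun M => ?_) (tendsto_natCast_atTop_atTop (R := ℝ))
        have : (0:ℝ) ≤ M := by positivity
        have : (0:ℝ) ≤ K := by positivity
        linarith
      rw [sub_zero] at a
      refine a.congr (fun M => ?_)
      have : (0:ℝ) < 2 * M + 1 + K := by positivity
      field_simp; ring
    rw [mul_one] at t2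
    refine le_of_tendsto_of_tendsto t2 t1 ?_
    filter_upwards [hFe] with M hM
    have := energy_bound (A M) (hnonempty M hM) M K (Finset.filter_subset _ _) (ν M) (hν M (hnonempty M hM))
    refine le_trans ?_ this
    rw [lt_div_iff₀ (by positivity)] at hM
    rw [← mul_div_assoc]
    refine div_le_div_of_nonneg_right ?_ (by positivity)
    nlinarith [sq_nonneg (K:ℝ)]
  have h2 : (μ : Measure UnitAddCircle).real {0} = 0 := by
    apply mass_zero_eq
    intro n
    refine tendsto_nhds_unique (hfour ⌊aa n⌋) (tendsto_const_nhds.congr' ?_)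
    filter_upwards [hFe] with M hM
    rw [hν M (hnonempty M hM)]
    have : ((A M ×ˢ A M).filter (fun p => ⌊aa n⌋ + (p.1 - p.2) = 0)) = ∅ := by
      apply Finset.filter_eq_empty_iff.mpr
      rintro ⟨x, y⟩ hxy h0
      simp only [hA, Finset.mem_product, Finset.mem_filter] at hxy
      exact hcon n x hxy.1.2 y hxy.2.2 (by simp only at h0; linarith)
    rw [this]; simp
  linarith

end Rec

/-- The instance `a(x) = √2·x² + log x` of the paper's single recurrence theorem
(Theorem C). -/
theorem stmt_6 (Λ : Set ℤ) (hΛ : 0 < upperDensity Λ) :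
    ∃ x ∈ Λ, ∃ y ∈ Λ, ∃ n : ℕ, 1 ≤ n ∧
      ⌊Real.sqrt 2 * (n : ℝ) ^ 2 + Real.log n⌋ ≠ 0 ∧
      y - x = ⌊Real.sqrt 2 * (n : ℝ) ^ 2 + Real.log n⌋ := by
  obtain ⟨n, x, hx, y, hy, h⟩ := Rec.exists_diff Λ hΛ
  refine ⟨x, hx, y, hy, n + 1, by omega, ?_, h⟩
  have h1 : (1:ℤ) ≤ ⌊Rec.aa n⌋ := Int.le_floor.mpr (by exact_mod_cast Rec.aa_ge_one n)
  have h2 : ⌊Rec.aa n⌋ ≠ 0 := by omega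
  exact h2
end

section
/- Let p be a non-constant polynomial with integer coefficients, let c be a nonzero real number, and let b : ℕ → ℝ be eventually nondecreasing with b(n) → ∞ and b(n+1) − b(n) → 0 as n → ∞. Then S = {[c·p(n) + b(n)] : n ∈ ℕ} is a set of 1-recurrence: for every system (X, ℬ, μ, T) and every A ∈ ℬ with μ(A) > 0 there exists n ∈ ℕ with s = [c·p(n) + b(n)] ≠ 0 and μ(A ∩ T⁻ˢA) > 0. -/
open Filter MeasureTheory Polynomial

noncomputable section

/-- `e t = exp (2 π i t)`. -/
def ee (t : ℝ) : ℂ := Complex.exp (2 * Real.pi * Complex.I * t)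

lemma ee_add (s t : ℝ) : ee (s + t) = ee s * ee t := by
  unfold ee; rw [← Complex.exp_add]; congr 1; push_cast; ring

lemma ee_norm (t : ℝ) : ‖ee t‖ = 1 := by
  unfold ee
  have : (2 * Real.pi * Complex.I * t : ℂ) = ((2 * Real.pi * t : ℝ) : ℂ) * Complex.I := by
    push_cast; ring
  rw [this]; exact Complex.norm_exp_ofReal_mul_I _

lemma ee_zero : ee 0 = 1 := by simp [ee]

lemma ee_int (n : ℤ) : ee n = 1 := by
  unfold ee
  have : (2 * Real.pi * Complex.I * ((n : ℝ) : ℂ) : ℂ) = n * (2 * Real.pi * Complex.I) := by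
    push_cast; ring
  rw [this]; exact Complex.exp_int_mul_two_pi_mul_I n

lemma ee_conj (t : ℝ) : (starRingEnd ℂ) (ee t) = ee (-t) := by
  unfold ee
  rw [← Complex.exp_conj]; congr 1; simp [map_ofNat (starRingEnd ℂ) 2]

lemma ee_eq_one {t : ℝ} (h : ee t = 1) : ∃ n : ℤ, t = n := by
  unfold ee at h
  rw [Complex.exp_eq_one_iff] at h
  obtain ⟨n, hn⟩ := h
  refine ⟨n, ?_⟩
  have h2 : (2 * Real.pi * Complex.I : ℂ) ≠ 0 := Complex.two_pi_I_ne_zero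
  have : (t : ℂ) = (n : ℂ) := by
    apply mul_left_cancel₀ h2; rw [hn]; ring
  exact_mod_cast this

lemma ee_nat_mul (a : ℝ) (n : ℕ) : ee (a * n) = ee a ^ n := by
  induction n with
  | zero => simp [ee_zero]
  | succ k ih => rw [pow_succ, ← ih, ← ee_add]; congr 1; push_cast; ring

/-- window averages -/
def av (u : ℕ → ℂ) (N L : ℕ) : ℂ := (L : ℂ)⁻¹ * ∑ i ∈ Finset.range L, u (N + i)

/-- the filter: `L → ∞` uniformly in `N`. -/
def FF : Filter (ℕ × ℕ) := atTop ×ˢ ⊤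

instance : FF.NeBot := by unfold FF; infer_instance

/-- uniform Cesaro convergence -/
def UC (u : ℕ → ℂ) (l : ℂ) : Prop := Tendsto (fun q : ℕ × ℕ => av u q.2 q.1) FF (nhds l)

lemma FF_eventually {P : ℕ × ℕ → Prop} :
    (∀ᶠ q in FF, P q) ↔ ∃ L0, ∀ L ≥ L0, ∀ N, P (L, N) := by
  unfold FF
  rw [prod_top, eventually_comap, eventually_atTop]
  constructor
  · rintro ⟨a, h⟩; exact ⟨a, fun L hL N => h L hL (L, N) rfl⟩
  · rintro ⟨a, h⟩; exact ⟨a, fun L hL q hq => by subst hq; exact h _ hL q.2⟩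

lemma FF_tendsto_fst : Tendsto (fun q : ℕ × ℕ => q.1) FF atTop := tendsto_fst

lemma FF_shift (h : ℕ) : Tendsto (fun q : ℕ × ℕ => (q.1, q.2 + h)) FF FF := by
  intro s hs
  obtain ⟨L0, h0⟩ := FF_eventually.1 hs
  exact FF_eventually.2 ⟨L0, fun L hL N => h0 L hL _⟩

lemma UC.add {u v : ℕ → ℂ} {l m : ℂ} (hu : UC u l) (hv : UC v m) :
    UC (fun n => u n + v n) (l + m) := by
  refine (Tendsto.add hu hv).congr fun q => ?_
  simp [av, Finset.sum_add_distrib, mul_add]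

lemma UC.const_mul {u : ℕ → ℂ} {l : ℂ} (c : ℂ) (hu : UC u l) :
    UC (fun n => c * u n) (c * l) := by
  refine (Tendsto.const_mul c hu).congr fun q => ?_
  simp only [av, ← Finset.mul_sum]; ring

lemma UC_const (c : ℂ) : UC (fun _ => c) c := by
  refine (tendsto_const_nhds (x := c)).congr' ?_
  refine FF_eventually.2 ⟨1, fun L hL N => ?_⟩
  have : (L : ℂ) ≠ 0 := by exact_mod_cast (by omega : L ≠ 0)
  simp [av]; field_simp

lemma av_norm_le {u : ℕ → ℂ} {C : ℝ} (hC : 0 ≤ C) (h : ∀ n, ‖u n‖ ≤ C) (N L : ℕ) :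
    ‖av u N L‖ ≤ C := by
  unfold av
  rw [norm_mul, norm_inv, Complex.norm_natCast]
  rcases Nat.eq_zero_or_pos L with rfl | hL
  · simpa using hC
  have hL' : (0 : ℝ) < L := by exact_mod_cast hL
  rw [inv_mul_le_iff₀ hL']
  calc _ ≤ ∑ i ∈ Finset.range L, ‖u (N + i)‖ := norm_sum_le _ _
    _ ≤ ∑ i ∈ Finset.range L, C := Finset.sum_le_sum fun i _ => h _
    _ = L * C := by simp

lemma UC_of_approx {u : ℕ → ℂ}
    (h : ∀ ε > 0, ∃ v l, UC v l ∧ ∀ n, ‖u n - v n‖ ≤ ε) : ∃ l, UC u l := by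
  have hc : Cauchy (map (fun q : ℕ × ℕ => av u q.2 q.1) FF) := by
    rw [Metric.cauchy_iff]
    refine ⟨inferInstance, fun ε hε => ?_⟩
    obtain ⟨v, l, hv, huv⟩ := h (ε / 8) (by positivity)
    refine ⟨Metric.ball l (ε / 4), ?_, ?_⟩
    · rw [mem_map]
      have := (Metric.tendsto_nhds.1 hv) (ε / 8) (by positivity)
      filter_upwards [this] with q hq
      have h1 : av u q.2 q.1 - av v q.2 q.1 = av (fun n => u n - v n) q.2 q.1 := by
        simp [av, Finset.sum_sub_distrib, mul_sub]
      have h2 : dist (av u q.2 q.1) (av v q.2 q.1) ≤ ε / 8 := by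
        rw [dist_eq_norm, h1]; exact av_norm_le (by positivity) huv _ _
      have := dist_triangle (av u q.2 q.1) (av v q.2 q.1) l
      simp only [Set.mem_preimage, Metric.mem_ball]
      linarith
    · intro x hx y hy
      have := dist_triangle_right x y l
      simp only [Metric.mem_ball] at hx hy
      linarith
  obtain ⟨l, hl⟩ := CompleteSpace.complete hc
  exact ⟨l, hl⟩

lemma UC_zero_of_bdd {u : ℕ → ℂ} {C : ℝ} (h : ∀ n, ‖∑ i ∈ Finset.range n, u i‖ ≤ C) :
    UC u 0 := by
  have h1 : Tendsto (fun q : ℕ × ℕ => (q.1 : ℝ)⁻¹ * (2 * C)) FF (nhds 0) := by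
    have : Tendsto (fun n : ℕ => (n : ℝ)⁻¹ * (2 * C)) atTop (nhds (0 * (2 * C))) :=
      (tendsto_inv_atTop_nhds_zero_nat (𝕜 := ℝ)).mul_const _
    rw [zero_mul] at this
    exact this.comp FF_tendsto_fst
  refine squeeze_zero_norm (fun q => ?_) h1
  unfold av
  rw [norm_mul, norm_inv, Complex.norm_natCast]
  refine mul_le_mul_of_nonneg_left ?_ (by positivity)
  have : ∑ i ∈ Finset.range q.1, u (q.2 + i) =
      ∑ i ∈ Finset.range (q.2 + q.1), u i - ∑ i ∈ Finset.range q.2, u i := by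
    rw [Finset.sum_range_add]; ring
  rw [this]
  refine (norm_sub_le _ _).trans ?_
  linarith [h (q.2 + q.1), h q.2]

lemma UC_geom {a : ℝ} (ha : ee a ≠ 1) : UC (fun n : ℕ => ee (a * n)) 0 := by
  have hpos : 0 < ‖ee a - 1‖ := norm_pos_iff.2 (sub_ne_zero.2 ha)
  refine UC_zero_of_bdd (C := 2 / ‖ee a - 1‖) fun n => ?_
  simp_rw [ee_nat_mul]
  rw [geom_sum_eq ha, norm_div]
  gcongr
  refine (norm_sub_le _ _).trans ?_
  rw [norm_pow, ee_norm]; norm_num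

lemma UC_periodic {u : ℕ → ℂ} {q : ℕ} (hq : 0 < q) (h : ∀ n, u (n + q) = u n) :
    ∃ l, UC u l := by
  set S := ∑ i ∈ Finset.range q, u i with hS
  set V : ℕ → ℂ := fun n => ∑ i ∈ Finset.range n, (u i - S / q) with hV
  have hq' : (q : ℂ) ≠ 0 := by exact_mod_cast hq.ne'
  have hper : Function.Periodic V q := by
    intro n
    simp only [hV]
    rw [add_comm n q, Finset.sum_range_add]
    have h1 : ∑ i ∈ Finset.range q, (u i - S / q) = 0 := by
      rw [Finset.sum_sub_distrib, ← hS]; simp; field_simp; ring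
    rw [h1, zero_add]
    refine Finset.sum_congr rfl fun i _ => ?_
    rw [add_comm q i, h]
  have h0 : UC (fun n => u n - S / q) 0 := by
    refine UC_zero_of_bdd (C := ∑ i ∈ Finset.range q, ‖V i‖) fun n => ?_
    change ‖V n‖ ≤ _
    rw [← hper.map_mod_nat n]
    exact Finset.single_le_sum (f := fun i => ‖V i‖) (fun _ _ => norm_nonneg _)
      (Finset.mem_range.2 (Nat.mod_lt _ hq))
  refine ⟨0 + S / q, ?_⟩
  simpa using h0.add (UC_const (S / q))

end

noncomputable section

lemma UC.shift {u : ℕ → ℂ} {l : ℂ} (hu : UC u l) (k : ℕ) : UC (fun n => u (n + k)) l := by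
  refine (Tendsto.comp hu (FF_shift k)).congr fun q => ?_
  simp only [av, Function.comp]
  congr 1; refine Finset.sum_congr rfl fun i _ => ?_
  congr 1; omega

lemma UC.conj {u : ℕ → ℂ} {l : ℂ} (hu : UC u l) :
    UC (fun n => (starRingEnd ℂ) (u n)) ((starRingEnd ℂ) l) := by
  refine ((Complex.continuous_conj.tendsto l).comp hu).congr fun q => ?_
  simp [av]

lemma av_shift_sub {u : ℕ → ℂ} (hu : ∀ n, ‖u n‖ = 1) (h : ℕ) :
    Tendsto (fun q : ℕ × ℕ => av u (q.2 + h) q.1 - av u q.2 q.1) FF (nhds 0) := by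
  have h1 : Tendsto (fun q : ℕ × ℕ => (q.1 : ℝ)⁻¹ * (h * 2)) FF (nhds 0) := by
    have : Tendsto (fun n : ℕ => (n : ℝ)⁻¹ * (h * 2)) atTop (nhds (0 * (h * 2))) :=
      (tendsto_inv_atTop_nhds_zero_nat (𝕜 := ℝ)).mul_const _
    rw [zero_mul] at this
    exact this.comp FF_tendsto_fst
  refine squeeze_zero_norm (fun q => ?_) h1
  obtain ⟨L, N⟩ := q
  simp only [av]
  rw [← mul_sub, norm_mul, norm_inv, Complex.norm_natCast]
  refine mul_le_mul_of_nonneg_left ?_ (by positivity)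
  have e1 := Finset.sum_range_add (fun i => u (N + i)) L h
  have e2 := Finset.sum_range_add (fun i => u (N + i)) h L
  rw [add_comm h L] at e2
  have e3 : ∑ i ∈ Finset.range L, u (N + h + i) - ∑ i ∈ Finset.range L, u (N + i)
      = ∑ i ∈ Finset.range h, (u (N + (L + i)) - u (N + i)) := by
    rw [Finset.sum_sub_distrib]
    simp_rw [add_assoc]
    linear_combination e1 - e2
  rw [e3]
  refine (norm_sum_le _ _).trans ?_
  calc _ ≤ ∑ i ∈ Finset.range h, (2 : ℝ) := Finset.sum_le_sum fun i _ => by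
        refine (norm_sub_le _ _).trans ?_
        rw [hu, hu]; norm_num
    _ = _ := by simp

lemma vdc {u : ℕ → ℂ} (hu : ∀ n, ‖u n‖ = 1)
    (hd : ∀ h ≥ 1, UC (fun n => u (n + h) * (starRingEnd ℂ) (u n)) 0) : UC u 0 := by
  have hcorr : ∀ h k : ℕ, UC (fun n => u (n + h) * (starRingEnd ℂ) (u (n + k)))
      (if h = k then 1 else 0) := by
    intro h k
    rcases lt_trichotomy h k with hlt | rfl | hgt
    · rw [if_neg hlt.ne]
      have := ((hd (k - h) (by omega)).shift h).conj
      simp only [map_mul, map_zero, Complex.conj_conj] at this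
      refine this.congr fun q => ?_
      congr 1; ext n
      rw [show n + h + (k - h) = n + k by omega]; ring
    · rw [if_pos rfl]
      refine (UC_const 1).congr fun q => ?_
      congr 1; ext n
      rw [Complex.mul_conj, Complex.normSq_eq_norm_sq, hu]; simp
    · rw [if_neg hgt.ne']
      refine ((hd (h - k) (by omega)).shift k).congr fun q => ?_
      congr 1; ext n
      rw [show n + k + (h - k) = n + h by omega]
  have main : ∀ H : ℕ, 1 ≤ H → Tendsto (fun q : ℕ × ℕ => (((H : ℂ) ^ 2)⁻¹ *
      ∑ h ∈ Finset.range H, ∑ k ∈ Finset.range H,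
        av (fun n => u (n + h) * (starRingEnd ℂ) (u (n + k))) q.2 q.1).re) FF
      (nhds ((H : ℝ)⁻¹)) := by
    intro H hH
    have h1 := Tendsto.const_mul (((H : ℂ) ^ 2)⁻¹) (tendsto_finsetSum (Finset.range H)
      fun h _ => tendsto_finsetSum (Finset.range H) fun k _ => hcorr h k)
    have h2 := (Complex.continuous_re.tendsto _).comp h1
    have : ∑ i ∈ Finset.range H, ∑ k ∈ Finset.range H, (if i = k then (1 : ℂ) else 0) = H := by
      rw [Finset.sum_congr rfl (g := fun _ => (1 : ℂ))]
      · simp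
      · intro i hi; rw [Finset.sum_ite_eq]; simp only [hi, if_true]
    rw [this] at h2
    have hH' : (H : ℂ) ≠ 0 := by exact_mod_cast (by omega : H ≠ 0)
    have : ((H : ℂ) ^ 2)⁻¹ * H = (((H : ℝ)⁻¹ : ℝ) : ℂ) := by
      push_cast; field_simp
    rw [this, Complex.ofReal_re] at h2
    exact h2
  have cs : ∀ (H : ℕ) (q : ℕ × ℕ), ‖(H : ℂ)⁻¹ * ∑ h ∈ Finset.range H, av u (q.2 + h) q.1‖ ^ 2 ≤
      (((H : ℂ) ^ 2)⁻¹ * ∑ h ∈ Finset.range H, ∑ k ∈ Finset.range H,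
        av (fun n => u (n + h) * (starRingEnd ℂ) (u (n + k))) q.2 q.1).re := by
    rintro H ⟨L, N⟩
    simp only
    set W : ℕ → ℂ := fun i => ∑ h ∈ Finset.range H, u (N + i + h) with hW
    have e1 : ∑ h ∈ Finset.range H, av u (N + h) L = (L : ℂ)⁻¹ * ∑ i ∈ Finset.range L, W i := by
      simp only [av, hW]
      rw [← Finset.mul_sum, Finset.sum_comm]
      congr 1
      refine Finset.sum_congr rfl fun i _ => Finset.sum_congr rfl fun h _ => ?_
      congr 1; omega
    have e2 : ∑ h ∈ Finset.range H, ∑ k ∈ Finset.range H,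
        av (fun n => u (n + h) * (starRingEnd ℂ) (u (n + k))) N L =
        (((L : ℝ)⁻¹ * ∑ i ∈ Finset.range L, ‖W i‖ ^ 2 : ℝ) : ℂ) := by
      push_cast
      have : ∀ i, ((‖W i‖ : ℂ) ^ 2) = W i * (starRingEnd ℂ) (W i) := by
        intro i; rw [Complex.mul_conj, Complex.normSq_eq_norm_sq]; push_cast; rfl
      simp_rw [this, hW, map_sum, Finset.sum_mul_sum, av]
      simp_rw [← Finset.mul_sum]
      congr 1
      rw [Finset.sum_comm]
      simp_rw [Finset.sum_comm (s := Finset.range H) (t := Finset.range L)]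
      refine Finset.sum_congr rfl fun i _ => ?_
      simp_rw [Finset.mul_sum]
      exact Finset.sum_comm
    rw [e1, e2]
    have e3 : ((H : ℂ) ^ 2)⁻¹ = ((((H : ℝ) ^ 2)⁻¹ : ℝ) : ℂ) := by push_cast; rfl
    rw [e3, ← Complex.ofReal_mul, Complex.ofReal_re, norm_mul, norm_mul, norm_inv, norm_inv,
      Complex.norm_natCast, Complex.norm_natCast, mul_pow, inv_pow]
    refine mul_le_mul_of_nonneg_left ?_ (by positivity)
    rw [mul_pow]
    have h1 : ‖∑ i ∈ Finset.range L, W i‖ ^ 2 ≤ L * ∑ i ∈ Finset.range L, ‖W i‖ ^ 2 := by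
      calc _ ≤ (∑ i ∈ Finset.range L, ‖W i‖) ^ 2 := by
            gcongr; exact norm_sum_le _ _
        _ ≤ _ := by
            have := sq_sum_le_card_mul_sum_sq (s := Finset.range L) (f := fun i => ‖W i‖)
            simpa using this
    rcases Nat.eq_zero_or_pos L with rfl | hL
    · simp
    have hL' : (0 : ℝ) < L := by exact_mod_cast hL
    calc ((L : ℝ)⁻¹) ^ 2 * ‖∑ i ∈ Finset.range L, W i‖ ^ 2
        ≤ ((L : ℝ)⁻¹) ^ 2 * (L * ∑ i ∈ Finset.range L, ‖W i‖ ^ 2) := by gcongr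
      _ = _ := by field_simp
  unfold UC
  rw [Metric.tendsto_nhds]
  intro ε hε
  obtain ⟨H, hH⟩ := exists_nat_gt ((ε / 2) ^ 2)⁻¹
  have hHpos : (0 : ℝ) < H := lt_trans (by positivity) hH
  have hH1 : 1 ≤ H := by exact_mod_cast hHpos
  have hHlt : (H : ℝ)⁻¹ < (ε / 2) ^ 2 := inv_lt_of_inv_lt₀ (by positivity) hH
  have ev1 := (main H hH1).eventually_lt_const hHlt
  have hdiff : Tendsto (fun q : ℕ × ℕ => (H : ℂ)⁻¹ * ∑ h ∈ Finset.range H,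
      (av u (q.2 + h) q.1 - av u q.2 q.1)) FF (nhds 0) := by
    have := Tendsto.const_mul ((H : ℂ)⁻¹) (tendsto_finsetSum (Finset.range H)
      fun h _ => av_shift_sub hu h)
    simpa using this
  have ev2 := Metric.tendsto_nhds.1 hdiff (ε / 2) (by positivity)
  filter_upwards [ev1, ev2] with q h1 h2
  have h3 := lt_of_le_of_lt (cs H q) h1
  have h4 : ‖(H : ℂ)⁻¹ * ∑ h ∈ Finset.range H, av u (q.2 + h) q.1‖ < ε / 2 :=
    lt_of_pow_lt_pow_left₀ 2 (by positivity) h3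
  rw [dist_zero_right] at h2 ⊢
  have hHc : (H : ℂ) ≠ 0 := by exact_mod_cast (by omega : H ≠ 0)
  have h5 : av u q.2 q.1 = (H : ℂ)⁻¹ * ∑ h ∈ Finset.range H, av u (q.2 + h) q.1 -
      (H : ℂ)⁻¹ * ∑ h ∈ Finset.range H, (av u (q.2 + h) q.1 - av u q.2 q.1) := by
    rw [Finset.sum_sub_distrib]; simp; field_simp; ring
  rw [h5]
  refine (norm_sub_le _ _).trans_lt ?_
  linarith

end

noncomputable section

lemma diff_natDegree (p : ℤ[X]) (hp : 2 ≤ p.natDegree) (h : ℕ) (hh : 1 ≤ h) :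
    1 ≤ (taylor (h : ℤ) p - p).natDegree ∧ (taylor (h : ℤ) p - p).natDegree < p.natDegree := by
  have hp0 : p ≠ 0 := by rintro rfl; simp at hp
  have hpt : taylor (h : ℤ) p ≠ 0 := by
    intro h0
    have := natDegree_taylor p (h : ℤ)
    rw [h0] at this; simp at this; omega
  have h1 : 1 ≤ (taylor (h : ℤ) p - p).natDegree := by
    by_contra hcon
    have h0 : (taylor (h : ℤ) p - p).natDegree = 0 := by omega
    obtain ⟨k, hk⟩ := natDegree_eq_zero.1 h0
    have hstep : ∀ n : ℤ, p.eval (n + h) = p.eval n + k := by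
      intro n
      have := congrArg (eval n) hk
      simp only [eval_C, eval_sub, taylor_eval] at this
      linarith
    have hm : ∀ m : ℕ, p.eval ((h : ℤ) * m) = p.eval 0 + k * m := by
      intro m
      induction m with
      | zero => simp
      | succ m ih =>
        rw [show (h : ℤ) * ((m + 1 : ℕ) : ℤ) = h * m + h by push_cast; ring, hstep, ih]
        push_cast; ring
    have heq : p.comp (C (h : ℤ) * X) = C (p.eval 0) + C k * X := by
      apply Polynomial.eq_of_infinite_eval_eq
      refine Set.Infinite.mono ?_ (Set.infinite_range_of_injective
        (f := fun m : ℕ => (m : ℤ)) Nat.cast_injective)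
      rintro _ ⟨m, rfl⟩
      simp only [Set.mem_ofPred_eq, eval_comp, eval_mul, eval_C, eval_X, eval_add]
      exact hm m
    have hd := congrArg natDegree heq
    rw [natDegree_comp, natDegree_C_mul_X _ (by exact_mod_cast (by omega : h ≠ 0)), mul_one] at hd
    have : (C (p.eval 0) + C k * X : ℤ[X]).natDegree ≤ 1 := by
      rw [add_comm]; exact natDegree_linear_le
    omega
  refine ⟨h1, ?_⟩
  have hne : taylor (h : ℤ) p - p ≠ 0 := by
    intro h0; rw [h0] at h1; simp at h1
  have := degree_sub_lt_left (degree_taylor p (h : ℤ)) hpt (leadingCoeff_taylor (h : ℤ) p)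
  rw [degree_taylor] at this
  exact natDegree_lt_natDegree hne this

lemma weyl (d : ℕ) : ∀ (p : ℤ[X]), p.natDegree = d → 1 ≤ d → ∀ β : ℝ, Irrational β →
    UC (fun n : ℕ => ee (β * (p.eval (n : ℤ) : ℤ))) 0 := by
  induction d using Nat.strong_induction_on with
  | _ d ih =>
  intro p hpd hd β hβ
  rcases eq_or_lt_of_le hd with h1 | h2
  · obtain ⟨a, ha, b, hab⟩ := natDegree_eq_one.1 (hpd.trans h1.symm)
    have hne : ee (β * a) ≠ 1 := by
      intro h
      obtain ⟨n, hn⟩ := ee_eq_one h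
      exact (hβ.mul_intCast ha) ⟨n, by rw [hn]; simp⟩
    have := (UC_geom hne).const_mul (ee (β * b))
    rw [mul_zero] at this
    refine this.congr fun q => ?_
    congr 1; ext n
    rw [← ee_add, ← hab]
    congr 1
    simp; ring
  · refine vdc (fun n => ee_norm _) fun h hh => ?_
    obtain ⟨g1, g2⟩ := diff_natDegree p (by omega) h hh
    refine (ih _ (by omega) _ rfl g1 β hβ).congr fun q => ?_
    congr 1; ext n
    rw [ee_conj, ← ee_add]
    congr 1
    simp only [eval_sub, taylor_eval]
    push_cast; ring

lemma UC_poly (p : ℤ[X]) (hp : 1 ≤ p.natDegree) (β : ℝ) :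
    ∃ l, UC (fun n : ℕ => ee (β * (p.eval (n : ℤ) : ℤ))) l := by
  by_cases hβ : Irrational β
  · exact ⟨0, weyl _ p rfl hp β hβ⟩
  · unfold Irrational at hβ
    push Not at hβ
    obtain ⟨r, rfl⟩ := hβ
    refine UC_periodic (q := r.den) r.den_pos fun n => ?_
    have hdvd : (r.den : ℤ) ∣ p.eval ((n + r.den : ℕ) : ℤ) - p.eval (n : ℤ) := by
      have := sub_dvd_eval_sub ((n + r.den : ℕ) : ℤ) (n : ℤ) p
      simpa using this
    obtain ⟨k, hk⟩ := hdvd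
    have : (r : ℝ) * (p.eval ((n + r.den : ℕ) : ℤ) : ℤ) =
        (r : ℝ) * (p.eval (n : ℤ) : ℤ) + ((r.num * k : ℤ) : ℝ) := by
      have h1 : p.eval ((n + r.den : ℕ) : ℤ) = p.eval (n : ℤ) + r.den * k := by linarith
      rw [h1]
      push_cast
      rw [mul_add, ← mul_assoc]
      congr 2
      exact_mod_cast Rat.mul_den_eq_num r
    rw [this, ee_add, ee_int, mul_one]

/-- cutoff vanishing near the integers -/
def ph (y : ℝ) : ℝ := max 0 (1 / 2 - Real.cos (2 * Real.pi * y))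

lemma ph_nonneg (y : ℝ) : 0 ≤ ph y := le_max_left _ _

lemma ph_le (y : ℝ) : ph y ≤ 2 := by
  unfold ph
  refine max_le (by norm_num) ?_
  linarith [Real.neg_one_le_cos (2 * Real.pi * y)]

lemma ph_add_half (y : ℝ) : 1 ≤ ph y + ph (y + 1 / 2) := by
  have h1 : 1 / 2 - Real.cos (2 * Real.pi * y) ≤ ph y := le_max_right _ _
  have h2 : 1 / 2 - Real.cos (2 * Real.pi * (y + 1 / 2)) ≤ ph (y + 1 / 2) := le_max_right _ _
  rw [show 2 * Real.pi * (y + 1 / 2) = 2 * Real.pi * y + Real.pi by ring, Real.cos_add_pi] at h2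
  linarith

lemma ph_fract (y : ℝ) : ph (Int.fract y) = ph y := by
  unfold ph
  congr 2
  rw [Int.fract, show 2 * Real.pi * (y - ⌊y⌋) = 2 * Real.pi * y - ⌊y⌋ * (2 * Real.pi) by ring,
    Real.cos_sub_int_mul_two_pi]

lemma ph_zero_of {y : ℝ} (h : 5 / 6 ≤ Int.fract y) : ph y = 0 := by
  rw [← ph_fract]
  unfold ph
  refine max_eq_left ?_
  have hlt := Int.fract_lt_one y
  set f := Int.fract y
  have : Real.cos (2 * Real.pi * f) = Real.cos (2 * Real.pi * (1 - f)) := by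
    rw [show 2 * Real.pi * (1 - f) = 2 * Real.pi - 2 * Real.pi * f by ring, Real.cos_two_pi_sub]
  rw [this]
  have h3 : Real.cos (Real.pi / 3) ≤ Real.cos (2 * Real.pi * (1 - f)) := by
    have := Real.pi_pos
    apply Real.cos_le_cos_of_nonneg_of_le_pi <;> nlinarith
  rw [Real.cos_pi_div_three] at h3
  linarith

lemma ph_continuous : Continuous ph := by unfold ph; fun_prop
lemma ee_continuous : Continuous ee := by unfold ee; fun_prop

lemma exists_g (α : ℝ) : ∃ g : C(AddCircle (1 : ℝ), ℂ), ∀ y : ℝ,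
    g (y : AddCircle (1 : ℝ)) = ph y * ee (-(α * Int.fract y)) := by
  let f : ℝ → ℂ := fun y => ph y * ee (-(α * y))
  have h0 : ph 0 = 0 := by unfold ph; norm_num
  have h1 : ph 1 = 0 := by unfold ph; norm_num
  have hf : f 0 = f 1 := by simp [f, h0, h1]
  have hc : Continuous f := by
    have := ph_continuous
    have := ee_continuous
    fun_prop
  have : Fact ((0 : ℝ) < 1) := ⟨one_pos⟩
  refine ⟨⟨AddCircle.liftIco 1 0 f, AddCircle.liftIco_zero_continuous hf hc.continuousOn⟩, ?_⟩
  intro y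
  have h1 : (y : AddCircle (1 : ℝ)) = (Int.fract y : ℝ) := by
    rw [← sub_eq_zero, ← AddCircle.coe_sub, AddCircle.coe_eq_zero_iff]
    exact ⟨⌊y⌋, by rw [Int.fract]; simp⟩
  change AddCircle.liftIco 1 0 f (y : AddCircle (1 : ℝ)) = _
  rw [h1, AddCircle.liftIco_zero_coe_apply ⟨Int.fract_nonneg y, Int.fract_lt_one y⟩]
  simp only [f, ph_fract]

lemma UC_main (p : ℤ[X]) (hp : 1 ≤ p.natDegree) (c τ α : ℝ) :
    ∃ l, UC (fun n : ℕ => (ph (c * (p.eval (n : ℤ) : ℤ) + τ) : ℂ) *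
      ee (α * ⌊c * (p.eval (n : ℤ) : ℤ) + τ⌋)) l := by
  set y : ℕ → ℝ := fun n => c * (p.eval (n : ℤ) : ℤ) + τ with hy
  have : Fact ((0 : ℝ) < 1) := ⟨one_pos⟩
  have key : ∀ g : C(AddCircle (1 : ℝ), ℂ),
      ∃ l, UC (fun n => ee (α * y n) * g (y n : AddCircle (1 : ℝ))) l := by
    have hspan : ∀ g ∈ Submodule.span ℂ (Set.range (fourier (T := (1 : ℝ)))),
        ∃ l, UC (fun n => ee (α * y n) * g (y n : AddCircle (1 : ℝ))) l := by
      intro g hg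
      induction hg using Submodule.span_induction with
      | mem x hx =>
        obtain ⟨k, rfl⟩ := hx
        obtain ⟨l, hl⟩ := UC_poly p hp ((α + k) * c)
        refine ⟨_, (hl.const_mul (ee ((α + k) * τ))).congr fun q => ?_⟩
        congr 1; ext n
        rw [fourier_coe_apply]
        have : Complex.exp (2 * Real.pi * Complex.I * k * (y n : ℝ) / (1 : ℝ)) = ee (k * y n) := by
          unfold ee; congr 1; push_cast; ring
        rw [this, ← ee_add, ← ee_add]
        congr 1
        simp only [hy]; ring
      | zero => exact ⟨0, by simpa using UC_const 0⟩
      | add x z _ _ hx hz =>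
        obtain ⟨l, hl⟩ := hx
        obtain ⟨m, hm⟩ := hz
        exact ⟨_, (hl.add hm).congr fun q => by congr 1; ext n; simp; ring⟩
      | smul a x _ hx =>
        obtain ⟨l, hl⟩ := hx
        exact ⟨_, (hl.const_mul a).congr fun q => by congr 1; ext n; simp; ring⟩
    intro g
    refine UC_of_approx fun ε hε => ?_
    have hmem : g ∈ (Submodule.span ℂ (Set.range (fourier (T := (1 : ℝ))))).topologicalClosure := by
      rw [span_fourier_closure_eq_top]; trivial
    have hmem' : g ∈ closure (Submodule.span ℂ (Set.range (fourier (T := (1 : ℝ)))) :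
        Set C(AddCircle (1 : ℝ), ℂ)) := hmem
    rw [Metric.mem_closure_iff] at hmem'
    obtain ⟨g', hg', hd⟩ := hmem' ε hε
    obtain ⟨l, hl⟩ := hspan g' hg'
    refine ⟨_, l, hl, fun n => ?_⟩
    rw [← mul_sub, norm_mul, ee_norm, one_mul, ← dist_eq_norm]
    exact (ContinuousMap.dist_apply_le_dist _).trans hd.le
  obtain ⟨g, hg⟩ := exists_g α
  obtain ⟨l, hl⟩ := key g
  refine ⟨l, hl.congr fun q => ?_⟩
  congr 1; ext n
  rw [hg, mul_left_comm, ← ee_add]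
  congr 2
  rw [Int.fract]; ring

end

noncomputable section

instance fact01 : Fact ((0 : ℝ) < 1) := ⟨one_pos⟩

lemma int_fourier (n : ℤ) :
    ∫ x, fourier (T := (1 : ℝ)) n x ∂AddCircle.haarAddCircle = if n = 0 then 1 else 0 := by
  split_ifs with h
  · simp [h]
  · exact integral_eq_zero_of_add_right_eq_neg (μ := AddCircle.haarAddCircle)
      (fourier_add_half_inv_index h one_pos)

lemma count_tendsto (k : ℤ) :
    Tendsto (fun N : ℕ => ((N + 1 : ℕ) : ℂ)⁻¹ * ∑ i ∈ Finset.range (N + 1),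
      ∑ j ∈ Finset.range (N + 1), if (k + ((j : ℤ) - i) = 0) then (1 : ℂ) else 0)
      atTop (nhds 1) := by
  have hsum : ∀ N : ℕ, ∑ i ∈ Finset.range N, ∑ j ∈ Finset.range N,
      (if (k + ((j : ℤ) - i) = 0) then (1 : ℂ) else 0) = ((N - k.natAbs : ℕ) : ℂ) := by
    intro N
    rcases Int.natAbs_eq k with hk | hk
    · rw [Finset.sum_comm]
      have : ∀ j ∈ Finset.range N, ∑ i ∈ Finset.range N,
          (if (k + ((j : ℤ) - i) = 0) then (1 : ℂ) else 0) =
          if j ∈ Finset.range (N - k.natAbs) then 1 else 0 := by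
        intro j hj
        rw [Finset.sum_congr rfl (g := fun i => if i = j + k.natAbs then (1 : ℂ) else 0)
          (fun i hi => by congr 1; apply propext; omega)]
        rw [Finset.sum_ite_eq']
        congr 1; simp only [Finset.mem_range] at hj ⊢; apply propext; omega
      rw [Finset.sum_congr rfl this, Finset.sum_ite_mem,
        Finset.inter_eq_right.2 (Finset.range_mono (by omega))]
      simp
    · have : ∀ j ∈ Finset.range N, ∑ i ∈ Finset.range N,
          (if (k + ((i : ℤ) - j) = 0) then (1 : ℂ) else 0) =
          if j ∈ Finset.range (N - k.natAbs) then 1 else 0 := by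
        intro j hj
        rw [Finset.sum_congr rfl (g := fun i => if i = j + k.natAbs then (1 : ℂ) else 0)
          (fun i hi => by congr 1; apply propext; omega)]
        rw [Finset.sum_ite_eq']
        congr 1; simp only [Finset.mem_range] at hj ⊢; apply propext; omega
      rw [Finset.sum_congr rfl this, Finset.sum_ite_mem,
        Finset.inter_eq_right.2 (Finset.range_mono (by omega))]
      simp
  have h1 : Tendsto (fun N : ℕ => (1 : ℂ) - k.natAbs * ((N + 1 : ℕ) : ℂ)⁻¹) atTop (nhds 1) := by
    have h0 : Tendsto (fun N : ℕ => ((N + 1 : ℕ) : ℂ)⁻¹) atTop (nhds 0) :=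
      (tendsto_inv_atTop_nhds_zero_nat (𝕜 := ℂ)).comp (tendsto_add_atTop_nat 1)
    have := (h0.const_mul (k.natAbs : ℂ)).const_sub 1
    simpa using this
  refine h1.congr' ?_
  filter_upwards [eventually_ge_atTop k.natAbs] with N hN
  rw [hsum, Nat.cast_sub (by omega)]
  have : ((N + 1 : ℕ) : ℂ) ≠ 0 := by exact_mod_cast (by omega : N + 1 ≠ 0)
  field_simp

/-- Fejer-type sums -/
def SS (r : ℤ → ℝ) (N : ℕ) (x : AddCircle (1 : ℝ)) : ℂ :=
  ∑ i ∈ Finset.range N, ∑ j ∈ Finset.range N, (r ((i : ℤ) - j) : ℂ) * fourier ((j : ℤ) - i) x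

lemma SS_cont (r : ℤ → ℝ) (N : ℕ) : Continuous (SS r N) := by
  unfold SS
  fun_prop

lemma herglotz (r : ℤ → ℝ) (hr : ∀ N x, ∃ t : ℝ, 0 ≤ t ∧ SS r N x = t) :
    ∃ (ν : ProbabilityMeasure (AddCircle (1 : ℝ))) (C : ℝ), 0 < C ∧ ∀ k : ℤ, k ≠ 0 →
      (C : ℂ) * ∫ x, fourier k x ∂(ν : Measure (AddCircle (1 : ℝ))) = r k := by
  have hr0 : 0 ≤ r 0 := by
    obtain ⟨t, ht, h⟩ := hr 1 0
    simp [SS] at h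
    rw [h]; exact ht
  set C : ℝ := 1 + r 0 with hC
  have hCpos : 0 < C := by linarith
  set m : Measure (AddCircle (1 : ℝ)) := AddCircle.haarAddCircle with hm
  let dc : ℕ → AddCircle (1 : ℝ) → ℂ := fun N x =>
    (C : ℂ)⁻¹ * (1 + ((N + 1 : ℕ) : ℂ)⁻¹ * SS r (N + 1) x)
  let d : ℕ → AddCircle (1 : ℝ) → ℝ := fun N x => (dc N x).re
  have dc_cont : ∀ N, Continuous (dc N) := fun N => by
    have := SS_cont r (N + 1)
    fun_prop
  have d_cont : ∀ N, Continuous (d N) := fun N => Complex.continuous_re.comp (dc_cont N)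
  have d_eq : ∀ N x, 0 ≤ d N x ∧ ((d N x : ℝ) : ℂ) = dc N x := by
    intro N x
    obtain ⟨t, ht, h⟩ := hr (N + 1) x
    have : dc N x = ((C⁻¹ * (1 + ((N + 1 : ℕ) : ℝ)⁻¹ * t) : ℝ) : ℂ) := by
      simp only [dc, h]; push_cast; rfl
    simp only [d, this, Complex.ofReal_re]
    refine ⟨by positivity, trivial⟩
  have hIntg : ∀ (g : AddCircle (1 : ℝ) → ℂ), Continuous g → Integrable g m := by
    intro g hg
    exact hg.integrable_of_hasCompactSupport (HasCompactSupport.of_compactSpace g)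
  have hcomp : ∀ N k, ∫ x, dc N x * fourier k x ∂m = (C : ℂ)⁻¹ * ((if k = 0 then 1 else 0) +
      r k * (((N + 1 : ℕ) : ℂ)⁻¹ * ∑ i ∈ Finset.range (N + 1),
      ∑ j ∈ Finset.range (N + 1), if (k + ((j : ℤ) - i) = 0) then (1 : ℂ) else 0)) := by
    intro N k
    have e1 : ∀ x, dc N x * fourier k x = (C : ℂ)⁻¹ * (fourier k x + ((N + 1 : ℕ) : ℂ)⁻¹ *
        ∑ i ∈ Finset.range (N + 1), ∑ j ∈ Finset.range (N + 1),
          (r ((i : ℤ) - j) : ℂ) * fourier (k + ((j : ℤ) - i)) x) := by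
      intro x
      simp only [dc, SS, fourier_add]
      rw [mul_assoc, add_mul, one_mul, mul_assoc, Finset.sum_mul]
      simp_rw [Finset.sum_mul]
      congr 3
      refine Finset.sum_congr rfl fun i _ => Finset.sum_congr rfl fun j _ => by ring
    simp_rw [e1]
    rw [integral_const_mul, integral_add (hIntg _ (by fun_prop)) (hIntg _ (by fun_prop)),
      int_fourier, integral_const_mul, integral_finsetSum _ (fun i _ => hIntg _ (by fun_prop))]
    congr 2
    rw [mul_left_comm (r k : ℂ)]
    congr 1
    rw [Finset.mul_sum]
    refine Finset.sum_congr rfl fun i _ => ?_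
    rw [integral_finsetSum _ (fun i _ => hIntg _ (by fun_prop)), Finset.mul_sum]
    refine Finset.sum_congr rfl fun j _ => ?_
    rw [integral_const_mul, int_fourier]
    split_ifs with h
    · rw [show (i : ℤ) - j = k by linarith]
    · simp
  have hmass : ∀ N, ∫ x, d N x ∂m = 1 := by
    intro N
    have h1 := hcomp N 0
    have h2 : (((∫ x, d N x ∂m : ℝ)) : ℂ) = 1 := by
      rw [← integral_complex_ofReal]
      simp_rw [fourier_zero, mul_one] at h1
      rw [integral_congr_ae (Eventually.of_forall fun x => (d_eq N x).2)]
      rw [h1]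
      have : ∑ i ∈ Finset.range (N + 1), ∑ j ∈ Finset.range (N + 1),
          (if ((0 : ℤ) + ((j : ℤ) - i) = 0) then (1 : ℂ) else 0) = (N + 1 : ℕ) := by
        rw [Finset.sum_congr rfl (g := fun _ => (1 : ℂ))]
        · simp
        · intro i hi
          rw [Finset.sum_congr rfl (g := fun j => if j = i then (1 : ℂ) else 0)
            (fun j _ => by congr 1; apply propext; omega), Finset.sum_ite_eq']
          simp only [hi, if_true]
      rw [this]
      have hN : ((N + 1 : ℕ) : ℂ) ≠ 0 := by exact_mod_cast (by omega : N + 1 ≠ 0)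
      have hC0 : (C : ℂ) ≠ 0 := by exact_mod_cast hCpos.ne'
      rw [inv_mul_cancel₀ hN, mul_one, if_pos trivial, inv_mul_eq_one₀ hC0, hC]
      push_cast; rfl
    exact_mod_cast h2
  have hdmeas : ∀ N, Measurable (fun x => ENNReal.ofReal (d N x)) := fun N =>
    (d_cont N).measurable.ennreal_ofReal
  let νm : ℕ → Measure (AddCircle (1 : ℝ)) := fun N => m.withDensity fun x => ENNReal.ofReal (d N x)
  have hprob : ∀ N, IsProbabilityMeasure (νm N) := by
    intro N
    constructor
    simp only [νm]
    rw [withDensity_apply _ MeasurableSet.univ, Measure.restrict_univ,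
      ← ofReal_integral_eq_lintegral_ofReal _ (Eventually.of_forall fun x => (d_eq N x).1),
      hmass, ENNReal.ofReal_one]
    exact (d_cont N).integrable_of_hasCompactSupport (HasCompactSupport.of_compactSpace _)
  let ν' : ℕ → ProbabilityMeasure (AddCircle (1 : ℝ)) := fun N => ⟨νm N, hprob N⟩
  have hν' : ∀ N k, ∫ x, fourier k x ∂(ν' N : Measure (AddCircle (1 : ℝ))) =
      ∫ x, dc N x * fourier k x ∂m := by
    intro N k
    change ∫ x, fourier k x ∂(m.withDensity fun x => ENNReal.ofReal (d N x)) = _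
    rw [integral_withDensity_eq_integral_toReal_smul (hdmeas N)
      (Eventually.of_forall fun x => ENNReal.ofReal_lt_top)]
    refine integral_congr_ae (Eventually.of_forall fun x => ?_)
    simp only
    rw [ENNReal.toReal_ofReal (d_eq N x).1, ← (d_eq N x).2]
    simp
  obtain ⟨ν, -, hν⟩ := isCompact_univ.ultrafilter_le_nhds
    ((hyperfilter ℕ).map ν') (by simp)
  have hlim : Tendsto ν' (hyperfilter ℕ) (nhds ν) := hν
  rw [ProbabilityMeasure.tendsto_iff_forall_integral_rclike_tendsto ℂ] at hlim
  refine ⟨ν, C, hCpos, fun k hk => ?_⟩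
  have h1 := hlim (BoundedContinuousFunction.mkOfCompact (fourier k))
  simp only [BoundedContinuousFunction.mkOfCompact_apply] at h1
  simp_rw [hν', hcomp, if_neg hk, zero_add] at h1
  have h2 := (((count_tendsto k).const_mul (r k : ℂ)).const_mul ((C : ℂ)⁻¹)).mono_left
    (Nat.hyperfilter_le_atTop)
  have h3 := tendsto_nhds_unique h1 h2
  rw [h3]
  have hC0 : (C : ℂ) ≠ 0 := by exact_mod_cast hCpos.ne'
  field_simp

end

noncomputable section

lemma zpow_mp {X : Type} [MeasurableSpace X] {μ : Measure X} (T : Equiv.Perm X)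
    (hT : Measurable T) (hTinv : Measurable T.symm) (hTmp : MeasurePreserving T μ μ) (k : ℤ) :
    MeasurePreserving (T ^ k : Equiv.Perm X) μ μ := by
  have hinv : MeasurePreserving (T⁻¹ : Equiv.Perm X) μ μ := by
    let e : X ≃ᵐ X := ⟨T, hT, hTinv⟩
    have he : MeasurePreserving e μ μ := hTmp
    exact he.symm e
  have hnat : ∀ (S : Equiv.Perm X), MeasurePreserving S μ μ → ∀ n : ℕ,
      MeasurePreserving (S ^ n : Equiv.Perm X) μ μ := by
    intro S hS n
    induction n with
    | zero => exact MeasurePreserving.id μ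
    | succ n ih => rw [pow_succ]; exact ih.comp hS
  rcases Int.eq_nat_or_neg k with ⟨n, rfl | rfl⟩
  · simpa using hnat T hTmp n
  · have := hnat _ hinv n
    rwa [inv_pow, ← zpow_natCast, ← zpow_neg] at this

lemma spectral {X : Type} [MeasurableSpace X] (μ : Measure X) [IsProbabilityMeasure μ]
    (T : Equiv.Perm X) (hT : Measurable T) (hTinv : Measurable T.symm)
    (hTmp : MeasurePreserving T μ μ) (f : X → ℝ) (hf : Measurable f) (K : ℝ)
    (hK : ∀ x, |f x| ≤ K) :
    ∃ (ν : ProbabilityMeasure (AddCircle (1 : ℝ))) (C : ℝ), 0 < C ∧ ∀ k : ℤ, k ≠ 0 →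
      (C : ℂ) * ∫ x, fourier k x ∂(ν : Measure (AddCircle (1 : ℝ))) =
        ((∫ x, f ((T ^ k : Equiv.Perm X) x) * f x ∂μ : ℝ) : ℂ) := by
  apply herglotz (fun k => ∫ x, f ((T ^ k : Equiv.Perm X) x) * f x ∂μ)
  intro N x
  have hmp := zpow_mp T hT hTinv hTmp
  have hfm : ∀ k : ℤ, Measurable fun ω => f ((T ^ k : Equiv.Perm X) ω) := fun k =>
    hf.comp (hmp k).measurable
  have hstat : ∀ i j : ℤ, ∫ ω, f ((T ^ (i - j) : Equiv.Perm X) ω) * f ω ∂μ =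
      ∫ ω, f ((T ^ i : Equiv.Perm X) ω) * f ((T ^ j : Equiv.Perm X) ω) ∂μ := by
    intro i j
    have h1 : AEStronglyMeasurable (fun ω => f ((T ^ (i - j) : Equiv.Perm X) ω) * f ω)
        (Measure.map (T ^ j : Equiv.Perm X) μ) :=
      ((hfm _).mul hf).aestronglyMeasurable
    have h2 := integral_map (hmp j).measurable.aemeasurable h1
    rw [(hmp j).map_eq] at h2
    rw [h2]
    refine integral_congr_ae (Eventually.of_forall fun ω => ?_)
    simp only
    rw [← Equiv.Perm.mul_apply, ← zpow_add, sub_add_cancel]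
  have hIntg : ∀ i j : ℤ, Integrable
      (fun ω => f ((T ^ i : Equiv.Perm X) ω) * f ((T ^ j : Equiv.Perm X) ω)) μ := by
    intro i j
    refine Integrable.of_bound ((hfm i).mul (hfm j)).aestronglyMeasurable (K * K)
      (Eventually.of_forall fun ω => ?_)
    rw [norm_mul, Real.norm_eq_abs, Real.norm_eq_abs]
    exact mul_le_mul (hK _) (hK _) (abs_nonneg _) ((abs_nonneg _).trans (hK ω))
  let W : X → ℂ := fun ω => ∑ i ∈ Finset.range N,
    (f ((T ^ (i : ℤ) : Equiv.Perm X) ω) : ℂ) * fourier (-(i : ℤ)) x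
  refine ⟨∫ ω, ‖W ω‖ ^ 2 ∂μ, integral_nonneg fun ω => by positivity, ?_⟩
  rw [← integral_complex_ofReal]
  have e1 : ∀ ω, ((‖W ω‖ ^ 2 : ℝ) : ℂ) = ∑ i ∈ Finset.range N, ∑ j ∈ Finset.range N,
      ((f ((T ^ (i : ℤ) : Equiv.Perm X) ω) * f ((T ^ (j : ℤ) : Equiv.Perm X) ω) : ℝ) : ℂ) *
        fourier ((j : ℤ) - i) x := by
    intro ω
    have : ((‖W ω‖ ^ 2 : ℝ) : ℂ) = W ω * (starRingEnd ℂ) (W ω) := by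
      rw [Complex.mul_conj, Complex.normSq_eq_norm_sq]
    rw [this]
    simp only [W]
    rw [map_sum, Finset.sum_mul_sum]
    refine Finset.sum_congr rfl fun i _ => Finset.sum_congr rfl fun j _ => ?_
    rw [map_mul, Complex.conj_ofReal, ← fourier_neg, neg_neg, sub_eq_add_neg, fourier_add]
    push_cast; ring
  simp_rw [e1]
  have hIntg' : ∀ i j : ℤ, Integrable (fun ω => ((f ((T ^ (i : ℤ) : Equiv.Perm X) ω) *
      f ((T ^ (j : ℤ) : Equiv.Perm X) ω) : ℝ) : ℂ) * fourier ((j : ℤ) - i) x) μ :=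
    fun i j => (hIntg i j).ofReal.mul_const _
  rw [integral_finsetSum _ (fun (i : ℕ) _ => integrable_finsetSum _ fun (j : ℕ) _ => hIntg' i j)]
  unfold SS
  refine Finset.sum_congr rfl fun i _ => ?_
  rw [integral_finsetSum _ (fun (j : ℕ) _ => hIntg' i j)]
  refine Finset.sum_congr rfl fun j _ => ?_
  rw [integral_mul_const, integral_complex_ofReal, ← hstat]

/-- windows on which `b` is almost constant -/
lemma windows (b : ℕ → ℝ)
    (hmono : ∃ n₀ : ℕ, ∀ m n : ℕ, n₀ ≤ m → m ≤ n → b m ≤ b n)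
    (hbinf : Tendsto b atTop atTop)
    (hbdiff : Tendsto (fun n => b (n + 1) - b n) atTop (nhds 0)) (M L : ℕ) :
    ∃ B0 : ℕ, ∀ B ≥ B0, ∃ N ≥ M, ∀ i < L, (B : ℝ) ≤ b (N + i) ∧ b (N + i) ≤ B + 1 / 6 := by
  obtain ⟨n₀, hn₀⟩ := hmono
  rcases Nat.eq_zero_or_pos L with rfl | hL
  · exact ⟨0, fun B _ => ⟨M, le_rfl, fun i hi => absurd hi (by omega)⟩⟩
  have hL' : (0 : ℝ) < L := by exact_mod_cast hL
  have hpos : (0 : ℝ) < 1 / (6 * L) := by positivity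
  obtain ⟨n₁, hn₁⟩ := eventually_atTop.1 (hbdiff.eventually_lt_const hpos)
  set n₂ := max n₀ (max n₁ M) with hn₂
  obtain ⟨B0, hB0⟩ := exists_nat_gt (b n₂)
  refine ⟨B0, fun B hB => ?_⟩
  have hBr : b n₂ < B := hB0.trans_le (by exact_mod_cast hB)
  have hex : ∃ n, n₂ ≤ n ∧ (B : ℝ) ≤ b n := by
    obtain ⟨n, h1, h2⟩ := ((eventually_ge_atTop n₂).and (hbinf.eventually_ge_atTop (B : ℝ))).exists
    exact ⟨n, h1, h2⟩
  classical
  set N := Nat.find hex with hN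
  obtain ⟨hN1, hN2⟩ := Nat.find_spec hex
  rw [← hN] at hN1 hN2
  have hNne : N ≠ n₂ := by intro h; rw [h] at hN2; linarith
  have hprev : b (N - 1) < B := by
    have := Nat.find_min hex (m := N - 1) (by omega)
    by_contra hcon
    exact this ⟨by omega, by linarith⟩
  have hup : ∀ i, b (N + i) ≤ B + (i + 1) * (1 / (6 * L)) := by
    intro i
    induction i with
    | zero =>
      have := hn₁ (N - 1) (by omega)
      rw [show N - 1 + 1 = N by omega] at this
      simp only [add_zero, Nat.cast_zero, zero_add, one_mul]
      linarith
    | succ i ih =>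
      have := hn₁ (N + i) (by omega)
      rw [← add_assoc]
      push_cast
      linarith
  refine ⟨N, by omega, fun i hi => ⟨hN2.trans (hn₀ _ _ (by omega) (by omega)), ?_⟩⟩
  refine (hup i).trans ?_
  have hi' : (i : ℝ) + 1 ≤ L := by exact_mod_cast hi
  have : ((i : ℝ) + 1) * (1 / (6 * L)) ≤ L * (1 / (6 * L)) := by gcongr
  have e : (L : ℝ) * (1 / (6 * L)) = 1 / 6 := by field_simp
  linarith

lemma eventually_ne (p : ℤ[X]) (hp : 1 ≤ p.natDegree) (c : ℝ) (hc : c ≠ 0) (b : ℕ → ℝ)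
    (hbdiff : Tendsto (fun n => b (n + 1) - b n) atTop (nhds 0)) :
    ∃ M : ℕ, ∀ n ≥ M, ⌊c * ((p.eval (n : ℤ) : ℤ) : ℝ) + b n⌋ ≠ 0 := by
  have hb : Tendsto (fun n : ℕ => (n : ℝ)⁻¹ * (b n - b 0)) atTop (nhds 0) := by
    refine hbdiff.cesaro.congr fun n => ?_
    rw [Finset.sum_range_sub]
  set P : ℝ[X] := p.map (Int.castRingHom ℝ) with hP
  have hdeg : (X : ℝ[X]).degree ≤ P.degree := by
    rw [hP, degree_map_eq_of_injective (RingHom.injective_int _), degree_X]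
    have : p ≠ 0 := by rintro rfl; simp at hp
    rw [degree_eq_natDegree this]
    exact_mod_cast hp
  have hO := Polynomial.isBigO_atTop_of_degree_le _ _ hdeg
  obtain ⟨K, hKpos, hK⟩ := hO.exists_pos
  rw [Asymptotics.IsBigOWith] at hK
  have hK' := tendsto_natCast_atTop_atTop (R := ℝ) |>.eventually hK
  have hcpos := abs_pos.2 hc
  have hε : 0 < |c| / (2 * K) := by positivity
  have h1 := (Metric.tendsto_nhds.1 hb) _ hε
  have h2 := tendsto_natCast_atTop_atTop (R := ℝ) |>.eventually_gt_atTop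
    ((1 + |b 0|) / (|c| / (2 * K)))
  obtain ⟨M, hM⟩ := eventually_atTop.1 (hK'.and (h1.and (h2.and (eventually_ge_atTop 1))))
  refine ⟨M, fun n hn h0 => ?_⟩
  obtain ⟨g1, g2, g3, g4⟩ := hM n hn
  have hn0 : (0 : ℝ) < n := by exact_mod_cast g4
  have hev : P.eval (n : ℝ) = ((p.eval (n : ℤ) : ℤ) : ℝ) := by
    rw [hP]
    have := eval_map_apply (f := Int.castRingHom ℝ) (p := p) (n : ℤ)
    simpa using this
  rw [eval_X, hev, Real.norm_eq_abs, Real.norm_eq_abs, abs_of_pos hn0] at g1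
  rw [dist_zero_right, norm_mul, norm_inv, Real.norm_eq_abs, Real.norm_eq_abs, abs_of_pos hn0,
    inv_mul_lt_iff₀ hn0] at g2
  rw [div_lt_iff₀ hε] at g3
  rw [Int.floor_eq_zero_iff] at h0
  set y := ((p.eval (n : ℤ) : ℤ) : ℝ)
  have hy : |c * y + b n| ≤ 1 := by rw [abs_le]; exact ⟨by linarith [h0.1], h0.2.le⟩
  have h5 : |c * y| ≤ |c * y + b n| + |b n - b 0| + |b 0| := by
    have : c * y = (c * y + b n) - (b n - b 0) - b 0 := by ring
    calc |c * y| = |(c * y + b n) - (b n - b 0) - b 0| := by rw [← this]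
      _ ≤ |(c * y + b n) - (b n - b 0)| + |b 0| := abs_sub _ _
      _ ≤ _ := by gcongr; exact abs_sub _ _
  rw [abs_mul] at h5
  have h6 : |c| * n ≤ |c| * (K * |y|) := by gcongr
  have h7 : n * (|c| / (2 * K)) * (2 * K) = |c| * n := by field_simp
  have h8 : |c| * |y| < 2 * (n * (|c| / (2 * K))) := by linarith
  have h9 : |c| * |y| * K < 2 * (n * (|c| / (2 * K))) * K := by gcongr
  nlinarith

end

noncomputable section

lemma double_limit {u : ℕ → ℂ} {l g : ℂ} {α : ℝ} (hu : UC u l)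
    (hg : UC (fun n : ℕ => ee (α * n)) g) (B0 : ℕ → ℕ) (Nf : ℕ → ℕ → ℕ) :
    Tendsto (fun j : ℕ => ((j + 1 : ℕ) : ℂ)⁻¹ * ∑ B ∈ Finset.range (j + 1),
      ee (α * ((B0 j + B : ℕ) : ℝ)) * av u (Nf j B) (j + 1)) atTop (nhds (g * l)) := by
  have h1 : Tendsto (fun j : ℕ => av (fun n : ℕ => ee (α * n)) (B0 j) (j + 1) * l) atTop
      (nhds (g * l)) := by
    refine Tendsto.mul_const l ?_
    have : Tendsto (fun j : ℕ => ((j + 1, B0 j) : ℕ × ℕ)) atTop FF := by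
      intro s hs
      obtain ⟨L0, h0⟩ := FF_eventually.1 hs
      exact mem_map.2 (eventually_atTop.2 ⟨L0, fun j hj => h0 _ (by omega) _⟩)
    have h5 := Tendsto.comp (f := fun j : ℕ => ((j + 1, B0 j) : ℕ × ℕ)) hg this
    exact h5.congr fun j => rfl
  have h2 : Tendsto (fun j : ℕ => ((j + 1 : ℕ) : ℂ)⁻¹ * ∑ B ∈ Finset.range (j + 1),
      ee (α * ((B0 j + B : ℕ) : ℝ)) * (av u (Nf j B) (j + 1) - l)) atTop (nhds 0) := by
    rw [Metric.tendsto_nhds]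
    intro ε hε
    obtain ⟨L0, hL0⟩ := FF_eventually.1 (Metric.tendsto_nhds.1 hu (ε / 2) (by positivity))
    filter_upwards [eventually_ge_atTop L0] with j hj
    rw [dist_zero_right, norm_mul, norm_inv, Complex.norm_natCast]
    have hpos : (0 : ℝ) < ((j + 1 : ℕ) : ℝ) := by positivity
    rw [inv_mul_lt_iff₀ hpos]
    refine (norm_sum_le _ _).trans_lt ?_
    calc _ ≤ ∑ B ∈ Finset.range (j + 1), ε / 2 := Finset.sum_le_sum fun B _ => by
          rw [norm_mul, ee_norm, one_mul, ← dist_eq_norm]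
          exact (hL0 (j + 1) (by omega) _).le
      _ = ((j + 1 : ℕ) : ℝ) * (ε / 2) := by simp
      _ < _ := by nlinarith
  have h3 := h2.add h1
  rw [zero_add] at h3
  refine h3.congr fun j => ?_
  simp only [av]
  rw [mul_assoc, ← mul_add, Finset.sum_mul, ← Finset.sum_add_distrib]
  congr 1
  refine Finset.sum_congr rfl fun B _ => ?_
  ring

lemma floor_add_of {y t : ℝ} {B : ℕ} (hy : ph y ≠ 0) (h1 : (B : ℝ) ≤ t) (h2 : t ≤ B + 1 / 6) :
    ⌊y + t⌋ = ⌊y⌋ + B := by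
  have h3 : Int.fract y < 5 / 6 := by
    by_contra hcon
    exact hy (ph_zero_of (not_lt.1 hcon))
  have h4 := Int.fract_nonneg y
  have h5 := Int.floor_add_fract y
  rw [Int.floor_eq_iff]
  push_cast
  constructor <;> linarith

lemma fourier_ee (k : ℤ) (α : ℝ) : fourier k (α : AddCircle (1 : ℝ)) = ee (α * k) := by
  rw [fourier_coe_apply]
  unfold ee; congr 1; push_cast; ring

/-- The main contradiction: the correlations with a spectral measure cannot all equal a
negative constant along the sequence. -/
lemma core (p : ℤ[X]) (hp : 1 ≤ p.natDegree) (c τ : ℝ) (b : ℕ → ℝ)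
    (hmono : ∃ n₀ : ℕ, ∀ m n : ℕ, n₀ ≤ m → m ≤ n → b m ≤ b n)
    (hbinf : Tendsto b atTop atTop)
    (hbdiff : Tendsto (fun n => b (n + 1) - b n) atTop (nhds 0))
    (κ : ℂ) (hκ : κ ≠ 0)
    (hκ' : UC (fun n : ℕ => (ph (c * (p.eval (n : ℤ) : ℤ) + τ) : ℂ)) κ)
    (ν : ProbabilityMeasure (AddCircle (1 : ℝ))) (M : ℕ) (δ : ℝ) (hδ : 0 < δ)
    (hν : ∀ n ≥ M, ∫ x, fourier ⌊c * ((p.eval (n : ℤ) : ℤ) : ℝ) + b n⌋ x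
      ∂(ν : Measure (AddCircle (1 : ℝ))) = ((-δ : ℝ) : ℂ)) : False := by
  set y : ℕ → ℝ := fun n => c * (p.eval (n : ℤ) : ℤ) + τ with hy
  set s : ℕ → ℤ := fun n => ⌊c * ((p.eval (n : ℤ) : ℤ) : ℝ) + b n⌋ with hs
  have hs' : ∀ n, s n = ⌊y n + (b n - τ)⌋ := by
    intro n; simp only [hs, hy]; congr 1; ring
  have hwin := windows (fun n => b n - τ)
    (by obtain ⟨n₀, h⟩ := hmono
        exact ⟨n₀, fun m n h1 h2 => by simpa using h m n h1 h2⟩)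
    (by simpa [sub_eq_add_neg] using tendsto_atTop_add_const_right atTop (-τ) hbinf)
    (by simpa using hbdiff) M
  choose B0 hB0 using fun j : ℕ => hwin (j + 1)
  choose! Nf hNM hNf using hB0
  let nn : ℕ → ℕ → ℕ → ℕ := fun j B i => Nf j (B0 j + B) + i
  have hnM : ∀ j B i, M ≤ nn j B i := fun j B i => by
    have := hNM j (B0 j + B) (by omega)
    simp only [nn]; omega
  have hsn : ∀ j B i, i < j + 1 → ph (y (nn j B i)) ≠ 0 →
      s (nn j B i) = ⌊y (nn j B i)⌋ + ((B0 j + B : ℕ) : ℤ) := by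
    intro j B i hi h0
    obtain ⟨h1, h2⟩ := hNf j (B0 j + B) (by omega) i hi
    rw [hs']
    exact floor_add_of h0 h1 h2
  let D : ℕ → AddCircle (1 : ℝ) → ℂ := fun j x => ((j + 1 : ℕ) : ℂ)⁻¹ *
    ∑ B ∈ Finset.range (j + 1), ((j + 1 : ℕ) : ℂ)⁻¹ * ∑ i ∈ Finset.range (j + 1),
      (ph (y (nn j B i)) : ℂ) * fourier (s (nn j B i)) x
  have hDcont : ∀ j, Continuous (D j) := fun j => by simp only [D]; fun_prop
  -- pointwise formula
  have hDform : ∀ j (α : ℝ), D j (α : AddCircle (1 : ℝ)) = ((j + 1 : ℕ) : ℂ)⁻¹ *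
      ∑ B ∈ Finset.range (j + 1), ee (α * ((B0 j + B : ℕ) : ℝ)) *
        av (fun n => (ph (y n) : ℂ) * ee (α * ⌊y n⌋)) (Nf j (B0 j + B)) (j + 1) := by
    intro j α
    simp only [D, av]
    congr 1
    refine Finset.sum_congr rfl fun B _ => ?_
    rw [mul_left_comm]
    congr 1
    rw [Finset.mul_sum]
    refine Finset.sum_congr rfl fun i hi => ?_
    by_cases h0 : ph (y (nn j B i)) = 0
    · have h0' : ph (y (Nf j (B0 j + B) + i)) = 0 := h0
      simp only [h0, h0']; simp
    · rw [hsn j B i (Finset.mem_range.1 hi) h0, fourier_ee, mul_left_comm, ← ee_add]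
      congr 2
      push_cast; ring
  have hlim0 : Tendsto (fun j => D j 0) atTop (nhds κ) := by
    have hg : UC (fun n : ℕ => ee (0 * n)) 1 := by simpa [ee_zero] using UC_const 1
    have hu : UC (fun n => (ph (y n) : ℂ) * ee (0 * ⌊y n⌋)) κ := by simpa [ee_zero] using hκ'
    have := double_limit hu hg B0 (fun j B => Nf j (B0 j + B))
    rw [one_mul] at this
    refine this.congr fun j => ?_
    rw [← hDform j 0]; simp
  have hlimne : ∀ x : AddCircle (1 : ℝ), x ≠ 0 → Tendsto (fun j => D j x) atTop (nhds 0) := by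
    intro x hx
    obtain ⟨α, rfl⟩ := QuotientAddGroup.mk_surjective x
    have hne : ee α ≠ 1 := by
      intro h
      obtain ⟨n, hn⟩ := ee_eq_one h
      exact hx ((AddCircle.coe_eq_zero_iff (1 : ℝ)).2 ⟨n, by rw [hn]; simp⟩)
    obtain ⟨l, hl⟩ := UC_main p hp c τ α
    have := double_limit hl (UC_geom hne) B0 (fun j B => Nf j (B0 j + B))
    rw [zero_mul] at this
    refine this.congr fun j => ?_
    exact (hDform j α).symm
  have hDbd : ∀ j x, ‖D j x‖ ≤ 2 := by
    intro j x
    have hpos : (0 : ℝ) < ((j + 1 : ℕ) : ℝ) := by positivity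
    have hgen : ∀ w : ℕ → ℂ, (∀ i, ‖w i‖ ≤ 2) →
        ‖((j + 1 : ℕ) : ℂ)⁻¹ * ∑ i ∈ Finset.range (j + 1), w i‖ ≤ 2 := by
      intro w hw
      have := av_norm_le (u := w) (C := 2) (by norm_num) hw 0 (j + 1)
      simpa [av] using this
    refine hgen _ fun B => hgen _ fun i => ?_
    rw [norm_mul, Complex.norm_real, Real.norm_eq_abs, abs_of_nonneg (ph_nonneg _), fourier_apply,
      Circle.norm_coe, mul_one]
    exact ph_le _
  classical
  have hDCT : Tendsto (fun j => ∫ x, D j x ∂(ν : Measure (AddCircle (1 : ℝ)))) atTop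
      (nhds (∫ x, ({0} : Set (AddCircle (1 : ℝ))).indicator (fun _ => κ) x
        ∂(ν : Measure (AddCircle (1 : ℝ))))) := by
    refine tendsto_integral_of_dominated_convergence (fun _ => (2 : ℝ))
      (fun j => (hDcont j).aestronglyMeasurable) (integrable_const _)
      (fun j => Eventually.of_forall fun x => hDbd j x) (Eventually.of_forall fun x => ?_)
    by_cases hx : x = 0
    · subst hx; simpa using hlim0
    · simpa [hx] using hlimne x hx
  rw [integral_indicator (measurableSet_singleton _), setIntegral_const] at hDCT
  have hDint : ∀ j, ∫ x, D j x ∂(ν : Measure (AddCircle (1 : ℝ))) = D j 0 * ((-δ : ℝ) : ℂ) := by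
    intro j
    have hIntg : ∀ (g : AddCircle (1 : ℝ) → ℂ), Continuous g →
        Integrable g (ν : Measure (AddCircle (1 : ℝ))) := fun g hg =>
      hg.integrable_of_hasCompactSupport (HasCompactSupport.of_compactSpace g)
    simp only [D]
    rw [integral_const_mul, integral_finsetSum _ (fun i _ => hIntg _ (by fun_prop)), mul_assoc,
      Finset.sum_mul]
    congr 1
    refine Finset.sum_congr rfl fun B _ => ?_
    rw [integral_const_mul, integral_finsetSum _ (fun i _ => hIntg _ (by fun_prop)), mul_assoc,
      Finset.sum_mul]
    congr 1
    refine Finset.sum_congr rfl fun i _ => ?_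
    rw [integral_const_mul, fourier_eval_zero, mul_one]
    congr 1
    exact hν _ (hnM j B i)
  simp_rw [hDint] at hDCT
  have heq := tendsto_nhds_unique hDCT (hlim0.mul_const (((-δ : ℝ) : ℂ)))
  rw [Complex.real_smul, mul_comm] at heq
  have h2 := mul_left_cancel₀ hκ heq
  have h3 : (ν : Measure (AddCircle (1 : ℝ))).real {0} = -δ := by exact_mod_cast h2
  have h4 : 0 ≤ (ν : Measure (AddCircle (1 : ℝ))).real {0} := measureReal_nonneg
  linarith

lemma exists_tau (p : ℤ[X]) (hp : 1 ≤ p.natDegree) (c : ℝ) : ∃ (τ : ℝ) (κ : ℂ), κ ≠ 0 ∧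
    UC (fun n : ℕ => (ph (c * (p.eval (n : ℤ) : ℤ) + τ) : ℂ)) κ := by
  obtain ⟨l0, h0⟩ := UC_main p hp c 0 0
  obtain ⟨l1, h1⟩ := UC_main p hp c (1 / 2) 0
  simp only [zero_mul, ee_zero, mul_one] at h0 h1
  by_cases hl0 : l0 = 0
  · by_cases hl1 : l1 = 0
    · exfalso
      have h2 := h0.add h1
      rw [hl0, hl1, add_zero] at h2
      have h3 := (Complex.continuous_re.tendsto _).comp h2
      have h4 : (1 : ℝ) ≤ (0 : ℂ).re := by
        refine ge_of_tendsto h3 (FF_eventually.2 ⟨1, fun L hL N => ?_⟩)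
        simp only [Function.comp, av]
        have hLpos : (0 : ℝ) < L := by exact_mod_cast hL
        have e : (L : ℂ)⁻¹ * ∑ i ∈ Finset.range L,
            ((ph (c * (p.eval ((N + i : ℕ) : ℤ) : ℤ) + 0) : ℂ) +
              (ph (c * (p.eval ((N + i : ℕ) : ℤ) : ℤ) + 1 / 2) : ℂ)) =
            (((L : ℝ)⁻¹ * ∑ i ∈ Finset.range L,
            (ph (c * (p.eval ((N + i : ℕ) : ℤ) : ℤ)) +
              ph (c * (p.eval ((N + i : ℕ) : ℤ) : ℤ) + 1 / 2)) : ℝ) : ℂ) := by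
          push_cast; simp
        rw [e, Complex.ofReal_re, le_inv_mul_iff₀ hLpos]
        calc (L : ℝ) * 1 = ∑ i ∈ Finset.range L, (1 : ℝ) := by simp
          _ ≤ _ := Finset.sum_le_sum fun i _ => ph_add_half _
      simp at h4
      linarith
    · exact ⟨1 / 2, l1, hl1, h1⟩
  · exact ⟨0, l0, hl0, h0⟩

end

theorem stmt_7 (p : Polynomial ℤ) (hp : 0 < p.degree)
    (c : ℝ) (hc : c ≠ 0)
    (b : ℕ → ℝ)
    (hmono : ∃ n₀ : ℕ, ∀ m n : ℕ, n₀ ≤ m → m ≤ n → b m ≤ b n)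
    (hbinf : Tendsto b atTop atTop)
    (hbdiff : Tendsto (fun n => b (n + 1) - b n) atTop (nhds 0))
    (X : Type) [MeasurableSpace X] (μ : Measure X) [IsProbabilityMeasure μ]
    (T : Equiv.Perm X) (hT : Measurable T) (hTinv : Measurable T.symm)
    (hTmp : MeasurePreserving T μ μ)
    (A : Set X) (hA : MeasurableSet A) (hApos : 0 < μ A) :
    ∃ n : ℕ, 1 ≤ n ∧ ⌊c * ((p.eval (n : ℤ) : ℤ) : ℝ) + b n⌋ ≠ 0 ∧
      0 < μ (A ∩ (T ^ ⌊c * ((p.eval (n : ℤ) : ℤ) : ℝ) + b n⌋) ⁻¹' A) := by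
  have hp1 : 1 ≤ p.natDegree := natDegree_pos_iff_degree_pos.2 hp
  by_contra hcon
  push Not at hcon
  obtain ⟨M0, hM0⟩ := eventually_ne p hp1 c hc b hbdiff
  obtain ⟨τ, κ, hκ, hκ'⟩ := exists_tau p hp1 c
  set a0 : ℝ := μ.real A with ha0
  have ha0pos : 0 < a0 := ENNReal.toReal_pos hApos.ne' (measure_ne_top _ _)
  classical
  let f : X → ℝ := fun x => A.indicator (fun _ => (1 : ℝ)) x - a0
  have hf : Measurable f := (measurable_const.indicator hA).sub_const _
  have hfb : ∀ x, |f x| ≤ 1 + a0 := by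
    intro x
    refine (abs_sub _ _).trans ?_
    rw [abs_of_pos ha0pos]
    gcongr
    by_cases hx : x ∈ A <;> simp [hx]
  obtain ⟨ν, C, hC, hν⟩ := spectral μ T hT hTinv hTmp f hf (1 + a0) hfb
  have hcorr : ∀ k : ℤ, μ (A ∩ (T ^ k : Equiv.Perm X) ⁻¹' A) = 0 →
      ∫ x, f ((T ^ k : Equiv.Perm X) x) * f x ∂μ = -a0 ^ 2 := by
    intro k hk
    have hmp := zpow_mp T hT hTinv hTmp k
    have hA' : MeasurableSet ((T ^ k : Equiv.Perm X) ⁻¹' A) := hmp.measurable hA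
    have e1 : ∀ x, f ((T ^ k : Equiv.Perm X) x) * f x =
        (A ∩ (T ^ k : Equiv.Perm X) ⁻¹' A).indicator (fun _ => (1 : ℝ)) x
        - a0 * A.indicator (fun _ => (1 : ℝ)) x
        - a0 * ((T ^ k : Equiv.Perm X) ⁻¹' A).indicator (fun _ => (1 : ℝ)) x + a0 ^ 2 := by
      intro x
      by_cases h1 : x ∈ A <;> by_cases h2 : (T ^ k : Equiv.Perm X) x ∈ A <;>
        simp [f, h1, h2] <;> ring
    have i1 : ∀ S : Set X, MeasurableSet S → Integrable (S.indicator (fun _ => (1 : ℝ))) μ :=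
      fun S hS => (integrable_const _).indicator hS
    have i2 : ∀ S : Set X, MeasurableSet S → ∫ x, S.indicator (fun _ => (1 : ℝ)) x ∂μ = μ.real S := by
      intro S hS
      rw [integral_indicator hS]; simp
    simp_rw [e1]
    rw [integral_add, integral_sub, integral_sub, integral_const_mul, integral_const_mul,
      i2 _ (hA.inter hA'), i2 _ hA, i2 _ hA', integral_const]
    · have e3 : μ.real ((T ^ k : Equiv.Perm X) ⁻¹' A) = a0 := by
        rw [measureReal_def, hmp.measure_preimage hA.nullMeasurableSet]; rfl
      have e4 : μ.real (A ∩ (T ^ k : Equiv.Perm X) ⁻¹' A) = 0 := by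
        rw [measureReal_def, hk]; rfl
      rw [e3, e4, ← ha0]
      simp; ring
    · exact i1 _ (hA.inter hA')
    · exact (i1 _ hA).const_mul _
    · exact (i1 _ (hA.inter hA')).sub ((i1 _ hA).const_mul _)
    · exact (i1 _ hA').const_mul _
    · exact ((i1 _ (hA.inter hA')).sub ((i1 _ hA).const_mul _)).sub ((i1 _ hA').const_mul _)
    · exact integrable_const _
  refine core p hp1 c τ b hmono hbinf hbdiff κ hκ hκ' ν (max M0 1) (a0 ^ 2 / C) (by positivity) ?_
  intro n hn
  have hne := hM0 n (le_trans (le_max_left _ _) hn)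
  have hz := hcon n (le_trans (le_max_right _ _) hn) hne
  have h1 := hν _ hne
  rw [hcorr _ (le_antisymm hz bot_le)] at h1
  have hC0 : (C : ℂ) ≠ 0 := by exact_mod_cast hC.ne'
  apply mul_left_cancel₀ hC0
  rw [h1]
  push_cast; field_simp
end

section
/- Let Λ ⊆ ℤ. Then there exist a system (X, ℬ, μ, T) and a set A ∈ ℬ with μ(A) = d̄(Λ), such that for every ℓ ∈ ℕ and all n_1, …, n_ℓ ∈ ℤ one has d̄(Λ ∩ (Λ − n_1) ∩ … ∩ (Λ − n_ℓ)) ≥ μ(A ∩ T^{−n_1}A ∩ … ∩ T^{−n_ℓ}A). -/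
open Filter MeasureTheory

open Topology

/-- The finite density. -/
noncomputable def finDens (N : ℕ) (S : Set ℤ) : ℝ :=
  (Nat.card ↥(S ∩ Set.Icc (-(N : ℤ)) (N : ℤ)) : ℝ) / (2 * N + 1)

lemma finDens_nonneg (N : ℕ) (S : Set ℤ) : 0 ≤ finDens N S := by
  unfold finDens; positivity

lemma fin_inter (N : ℕ) (S : Set ℤ) : (S ∩ Set.Icc (-(N : ℤ)) (N : ℤ)).Finite :=
  (Set.finite_Icc _ _).subset Set.inter_subset_right

lemma ncard_Icc (N : ℕ) : (Set.Icc (-(N : ℤ)) (N : ℤ)).ncard = 2 * N + 1 := by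
  rw [← Finset.coe_Icc, Set.ncard_coe_finset, Int.card_Icc]
  omega

lemma finDens_le_one (N : ℕ) (S : Set ℤ) : finDens N S ≤ 1 := by
  unfold finDens
  rw [div_le_one (by positivity)]
  have h : (S ∩ Set.Icc (-(N : ℤ)) (N : ℤ)).ncard ≤ 2 * N + 1 := by
    rw [← ncard_Icc]
    exact Set.ncard_le_ncard Set.inter_subset_right (Set.finite_Icc _ _)
  change ((S ∩ Set.Icc (-(N : ℤ)) (N : ℤ)).ncard : ℝ) ≤ _
  exact_mod_cast h

lemma finDens_shift1 (N : ℕ) (S : Set ℤ) :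
    finDens N {k | k + 1 ∈ S} ≤ finDens N S + 1 / (2 * N + 1) := by
  unfold finDens
  rw [← add_div]
  gcongr
  change (({k | k + 1 ∈ S} ∩ Set.Icc (-(N : ℤ)) (N : ℤ)).ncard : ℝ) ≤
    ((S ∩ Set.Icc (-(N : ℤ)) (N : ℤ)).ncard : ℝ) + 1
  have h1 : ({k | k + 1 ∈ S} ∩ Set.Icc (-(N : ℤ)) (N : ℤ)).ncard =
      ((fun k => k + 1) '' ({k | k + 1 ∈ S} ∩ Set.Icc (-(N : ℤ)) (N : ℤ))).ncard :=
    (Set.ncard_image_of_injective _ (add_left_injective (1 : ℤ))).symm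
  have h2 : ((fun k => k + 1) '' ({k | k + 1 ∈ S} ∩ Set.Icc (-(N : ℤ)) (N : ℤ))).ncard ≤
      (insert ((N : ℤ) + 1) (S ∩ Set.Icc (-(N : ℤ)) (N : ℤ))).ncard := by
    apply Set.ncard_le_ncard _ ((fin_inter N S).insert _)
    rintro _ ⟨k, ⟨hk, hk1, hk2⟩, rfl⟩
    simp only [Set.mem_insert_iff, Set.mem_inter_iff, Set.mem_Icc]
    simp only [Set.mem_ofPred_eq] at hk
    by_cases h : k = N
    · left; omega
    · right; exact ⟨hk, by omega, by omega⟩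
  have h3 := Set.ncard_insert_le ((N : ℤ) + 1) (S ∩ Set.Icc (-(N : ℤ)) (N : ℤ))
  exact_mod_cast h1.le.trans (h2.trans h3)

lemma finDens_shift2 (N : ℕ) (S : Set ℤ) :
    finDens N S ≤ finDens N {k | k + 1 ∈ S} + 1 / (2 * N + 1) := by
  unfold finDens
  rw [← add_div]
  gcongr
  change ((S ∩ Set.Icc (-(N : ℤ)) (N : ℤ)).ncard : ℝ) ≤
    (({k | k + 1 ∈ S} ∩ Set.Icc (-(N : ℤ)) (N : ℤ)).ncard : ℝ) + 1
  have h1 : (S ∩ Set.Icc (-(N : ℤ)) (N : ℤ)).ncard =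
      ((fun k => k + (-1)) '' (S ∩ Set.Icc (-(N : ℤ)) (N : ℤ))).ncard :=
    (Set.ncard_image_of_injective _ (add_left_injective (-1 : ℤ))).symm
  have h2 : ((fun k => k + (-1)) '' (S ∩ Set.Icc (-(N : ℤ)) (N : ℤ))).ncard ≤
      (insert (-(N : ℤ) - 1) ({k | k + 1 ∈ S} ∩ Set.Icc (-(N : ℤ)) (N : ℤ))).ncard := by
    apply Set.ncard_le_ncard _ ((fin_inter N _).insert _)
    rintro _ ⟨k, ⟨hk, hk1, hk2⟩, rfl⟩
    simp only [Set.mem_insert_iff, Set.mem_inter_iff, Set.mem_Icc, Set.mem_ofPred_eq]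
    by_cases h : k = -N
    · left; omega
    · right; exact ⟨by simpa using hk, by omega, by omega⟩
  have h3 := Set.ncard_insert_le (-(N : ℤ) - 1) ({k | k + 1 ∈ S} ∩ Set.Icc (-(N : ℤ)) (N : ℤ))
  exact_mod_cast h1.le.trans (h2.trans h3)

lemma finDens_shift_tendsto (S : Set ℤ) :
    Tendsto (fun N => finDens N {k | k + 1 ∈ S} - finDens N S) atTop (𝓝 0) := by
  have h : Tendsto (fun N : ℕ => 1 / (2 * (N : ℝ) + 1)) atTop (𝓝 0) := by
    refine squeeze_zero (fun N => by positivity) (fun N => ?_)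
      (tendsto_one_div_add_atTop_nhds_zero_nat (𝕜 := ℝ))
    apply one_div_le_one_div_of_le (by positivity)
    have : (0 : ℝ) ≤ N := by positivity
    linarith
  refine squeeze_zero_norm (fun N => ?_) h
  rw [Real.norm_eq_abs, abs_le]
  constructor <;> linarith [finDens_shift1 N S, finDens_shift2 N S]

lemma finDens_bdd_le (S : Set ℤ) (F : Filter ℕ) :
    F.IsBoundedUnder (· ≤ ·) (fun N => finDens N S) :=
  isBoundedUnder_of ⟨1, fun N => finDens_le_one N S⟩

lemma finDens_bdd_ge (S : Set ℤ) (F : Filter ℕ) :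
    F.IsBoundedUnder (· ≥ ·) (fun N => finDens N S) :=
  isBoundedUnder_of ⟨0, fun N => finDens_nonneg N S⟩

lemma exists_ultra (S : Set ℤ) :
    ∃ U : Ultrafilter ℕ, (U : Filter ℕ) ≤ atTop ∧
      Tendsto (fun N => finDens N S) U (𝓝 (upperDensity S)) := by
  rw [← mapClusterPt_iff_ultrafilter]
  exact MapClusterPt.limsup (finDens_bdd_ge S _).isCoboundedUnder_le (finDens_bdd_le S _)

lemma le_upperDensity (S : Set ℤ) (U : Ultrafilter ℕ) (hU : (U : Filter ℕ) ≤ atTop) (a : ℝ)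
    (h : Tendsto (fun N => finDens N S) U (𝓝 a)) : a ≤ upperDensity S := by
  rw [← h.limsup_eq]
  exact limsup_le_limsup_of_le hU (finDens_bdd_ge S _).isCoboundedUnder_le (finDens_bdd_le S _)

/-- Uniform probability on `[-N, N]`. -/
noncomputable def unif (N : ℕ) : Measure ℤ :=
  ENNReal.ofReal (1 / (2 * N + 1)) • Measure.count.restrict (Set.Icc (-(N : ℤ)) (N : ℤ))

lemma unif_apply (N : ℕ) (S : Set ℤ) : unif N S = ENNReal.ofReal (finDens N S) := by
  unfold unif finDens
  rw [Measure.smul_apply, Measure.restrict_apply (MeasurableSet.of_discrete),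
    Measure.count_apply MeasurableSet.of_discrete,
    ← (fin_inter N S).cast_ncard_eq, smul_eq_mul]
  change _ = ENNReal.ofReal (((S ∩ Set.Icc (-(N : ℤ)) (N : ℤ)).ncard : ℝ) / _)
  rw [div_eq_mul_one_div (((S ∩ Set.Icc (-(N : ℤ)) (N : ℤ)).ncard : ℝ)), mul_comm, ENNReal.ofReal_mul (by positivity), ENNReal.ofReal_natCast, ENat.toENNReal_coe]

instance (N : ℕ) : IsProbabilityMeasure (unif N) := by
  constructor
  rw [unif_apply]
  unfold finDens
  rw [Set.univ_inter]
  change ENNReal.ofReal (((Set.Icc (-(N : ℤ)) (N : ℤ)).ncard : ℝ) / _) = 1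
  rw [ncard_Icc]
  push_cast
  rw [div_self (by positivity)]
  simp

/-- The shift. -/
def shiftT : Equiv.Perm (ℤ → Bool) where
  toFun x j := x (j + 1)
  invFun x j := x (j - 1)
  left_inv x := by ext j; simp
  right_inv x := by ext j; simp

lemma shiftT_pow (n : ℕ) (x : ℤ → Bool) (j : ℤ) : (shiftT ^ n) x j = x (j + n) := by
  induction n generalizing x with
  | zero => simp
  | succ n ih =>
    rw [pow_succ, Equiv.Perm.mul_apply, ih]
    change x (j + n + 1) = _
    push_cast; rw [add_assoc]

lemma shiftT_zpow (n : ℤ) (x : ℤ → Bool) (j : ℤ) : (shiftT ^ n) x j = x (j + n) := by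
  obtain ⟨m, rfl | rfl⟩ := n.eq_nat_or_neg
  · rw [zpow_natCast, shiftT_pow]
  · rw [zpow_neg, zpow_natCast]
    obtain ⟨y, rfl⟩ := (shiftT ^ m).surjective x
    have h : (shiftT ^ m)⁻¹ ((shiftT ^ m) y) = y := Equiv.symm_apply_apply _ _
    rw [h, shiftT_pow]
    simp

open Classical in
/-- The orbit of the indicator of `Λ`. -/
noncomputable def orb (Λ : Set ℤ) (k : ℤ) : ℤ → Bool := fun j => decide (j + k ∈ Λ)

/-- Furstenberg's correspondence principle. -/
theorem stmt_8 (Λ : Set ℤ) :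
    ∃ (X : Type) (_ : MeasurableSpace X) (μ : Measure X) (T : Equiv.Perm X) (A : Set X),
      IsProbabilityMeasure μ ∧ Measurable T ∧ Measurable T.symm ∧
      MeasurePreserving T μ μ ∧ MeasurableSet A ∧
      μ A = ENNReal.ofReal (upperDensity Λ) ∧
      ∀ (ℓ : ℕ), 1 ≤ ℓ → ∀ n : Fin ℓ → ℤ,
        μ (A ∩ ⋂ i, (T ^ (n i)) ⁻¹' A) ≤
          ENNReal.ofReal (upperDensity (Λ ∩ ⋂ i, {x : ℤ | x + n i ∈ Λ})) := by
  obtain ⟨U, hU, hUd⟩ := exists_ultra Λ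
  have horb : Measurable (orb Λ) := measurable_from_top
  let ν : ℕ → ProbabilityMeasure (ℤ → Bool) := fun N =>
    ⟨(unif N).map (orb Λ), Measure.isProbabilityMeasure_map horb.aemeasurable⟩
  obtain ⟨μ, -, hμ⟩ := isCompact_univ.ultrafilter_le_nhds (U.map ν) (by simp)
  have hlim : Tendsto ν U (𝓝 μ) := hμ
  have hclopen : ∀ C : Set (ℤ → Bool), IsClopen C →
      Tendsto (fun N => finDens N (orb Λ ⁻¹' C)) U (𝓝 ((μ : Measure (ℤ → Bool)) C).toReal) := by
    intro C hC
    have h := ProbabilityMeasure.tendsto_measure_of_null_frontier_of_tendsto' hlim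
      (E := C) (by simp [hC.frontier_eq])
    have h2 := (ENNReal.tendsto_toReal (measure_ne_top (μ : Measure (ℤ → Bool)) C)).comp h
    refine h2.congr fun N => ?_
    change ((unif N).map (orb Λ) C).toReal = _
    rw [Measure.map_apply horb hC.isOpen.measurableSet, unif_apply,
      ENNReal.toReal_ofReal (finDens_nonneg _ _)]
  have hTc : Continuous shiftT := continuous_pi fun j => continuous_apply (j + 1)
  have hTsc : Continuous shiftT.symm := continuous_pi fun j => continuous_apply (j - 1)
  have hTn : ∀ n : ℤ, Continuous (shiftT ^ n : Equiv.Perm (ℤ → Bool)) := fun n =>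
    continuous_pi fun j => by
      simp only [shiftT_zpow]
      exact continuous_apply (j + n)
  have hA : IsClopen {x : ℤ → Bool | x 0 = true} :=
    (isClopen_discrete {true}).preimage (continuous_apply (0 : ℤ))
  refine ⟨ℤ → Bool, inferInstance, μ, shiftT, {x | x 0 = true}, inferInstance, hTc.measurable,
    hTsc.measurable, ⟨hTc.measurable, ?_⟩, hA.isOpen.measurableSet, ?_, ?_⟩
  · have : IsProbabilityMeasure ((μ : Measure (ℤ → Bool)).map shiftT) :=
      Measure.isProbabilityMeasure_map hTc.measurable.aemeasurable
    have hb : TopologicalSpace.IsTopologicalBasis {s : Set (ℤ → Bool) | IsClopen s} := isTopologicalBasis_isClopen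
    refine ext_of_generate_finite {s : Set (ℤ → Bool) | IsClopen s}
      ((BorelSpace.measurable_eq).trans hb.borel_eq_generateFrom)
      (fun s hs t ht _ => hs.inter ht) (fun C hC => ?_) (by simp)
    rw [Measure.map_apply hTc.measurable hC.isOpen.measurableSet]
    have h1 := hclopen C hC
    have h2 := hclopen _ (hC.preimage hTc)
    have h3 := (finDens_shift_tendsto (orb Λ ⁻¹' C)).mono_left hU
    have h4 : ∀ k, shiftT (orb Λ k) = orb Λ (k + 1) := by
      intro k; funext j
      change orb Λ k (j + 1) = _
      have e : j + 1 + k = j + (k + 1) := by ring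
      unfold orb; rw [decide_eq_decide, e]
    have h5 : orb Λ ⁻¹' (shiftT ⁻¹' C) = {k | k + 1 ∈ orb Λ ⁻¹' C} := by
      ext k; simp [h4]
    rw [h5] at h2
    have h6 := tendsto_nhds_unique (h2.sub h1) h3
    exact (ENNReal.toReal_eq_toReal_iff' (measure_ne_top _ _) (measure_ne_top _ _)).1
      (sub_eq_zero.1 h6)
  · have h := hclopen _ hA
    have h5 : orb Λ ⁻¹' {x | x 0 = true} = Λ := by ext k; simp [orb]
    rw [h5] at h
    rw [← tendsto_nhds_unique h hUd, ENNReal.ofReal_toReal (measure_ne_top _ _)]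
  · intro ℓ _ n
    have hC : IsClopen ({x : ℤ → Bool | x 0 = true} ∩
        ⋂ i, (shiftT ^ (n i)) ⁻¹' {x : ℤ → Bool | x 0 = true}) :=
      hA.inter (isClopen_iInter_of_finite fun i => hA.preimage (hTn (n i)))
    have h := le_upperDensity _ U hU _ (hclopen _ hC)
    have h5 : orb Λ ⁻¹' ({x : ℤ → Bool | x 0 = true} ∩
        ⋂ i, (shiftT ^ (n i)) ⁻¹' {x : ℤ → Bool | x 0 = true}) =
        Λ ∩ ⋂ i, {x : ℤ | x + n i ∈ Λ} := by
      ext k; simp [orb, shiftT_zpow, add_comm]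
    rw [h5] at h
    rw [← ENNReal.ofReal_toReal (measure_ne_top (μ : Measure (ℤ → Bool)) _)]
    exact ENNReal.ofReal_le_ofReal h
end

section
/- Let k ≥ 1 be an integer and let δ ∈ (k, k+1) be real. Then for every r ∈ ℕ there exist a threshold M_r ∈ ℕ, positive integers N_{r,m} for m ≥ M_r with N_{r,m} → ∞ as m → ∞, and polynomials p_{r,m} with integer coefficients of degree at most k−1, such that for every m ≥ M_r and every integer 1 ≤ n ≤ N_{r,m} one has r·(m·n^k + p_{r,m}(n)) ∈ {[j^δ] : j ∈ ℕ}. -/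
open Filter Polynomial

namespace Stmt14

/-- Iterated forward differences of a real function. -/
noncomputable def D : ℕ → (ℝ → ℝ) → ℝ → ℝ
  | 0, f, x => f x
  | i + 1, f, x => D i f (x + 1) - D i f x

lemma D_hasDeriv (i : ℕ) (s : ℝ) (x : ℝ) (hx : 0 < x) :
    HasDerivAt (D i (fun y => y ^ s)) (s * D i (fun y => y ^ (s - 1)) x) x := by
  induction i generalizing x with
  | zero =>
    simpa [D] using Real.hasDerivAt_rpow_const (x := x) (p := s) (Or.inl hx.ne')
  | succ i ih =>
    have h1 := (ih (x + 1) (by linarith)).comp_add_const x 1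
    have h2 := h1.sub (ih x hx)
    have h3 : s * D (i + 1) (fun y => y ^ (s - 1)) x =
      s * D i (fun y => y ^ (s - 1)) (x + 1) - s * D i (fun y => y ^ (s - 1)) x := by
      simp only [D]; ring
    rw [h3]
    exact h2

lemma D_mvt (i : ℕ) (s : ℝ) (x : ℝ) (hx : 0 < x) :
    ∃ ξ, x ≤ ξ ∧ ξ ≤ x + i ∧
      D i (fun y => y ^ s) x = (∏ j ∈ Finset.range i, (s - j)) * ξ ^ (s - i) := by
  induction i generalizing x s with
  | zero => exact ⟨x, le_rfl, by simp, by simp [D]⟩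
  | succ i ih =>
    obtain ⟨c, ⟨hc1, hc2⟩, hc⟩ := exists_hasDerivAt_eq_slope (D i (fun y => y ^ s))
      (fun x => s * D i (fun y => y ^ (s - 1)) x) (show x < x + 1 by linarith)
      (fun y hy => (D_hasDeriv i s y (by linarith [hy.1])).continuousAt.continuousWithinAt)
      (fun y hy => D_hasDeriv i s y (by linarith [hy.1]))
    obtain ⟨ξ, h1, h2, h3⟩ := ih (s - 1) c (by linarith)
    refine ⟨ξ, by linarith, by push_cast; linarith, ?_⟩
    have h4 : D (i + 1) (fun y => y ^ s) x = s * D i (fun y => y ^ (s - 1)) c := by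
      rw [hc]; simp [D]
    rw [h4, h3, Finset.prod_range_succ']
    have : ∀ j ∈ Finset.range i, s - 1 - (j : ℝ) = s - ((j + 1 : ℕ) : ℝ) := by
      intro j _; push_cast; ring
    rw [Finset.prod_congr rfl this]
    have e : s - 1 - (i : ℝ) = s - ((i + 1 : ℕ) : ℝ) := by push_cast; ring
    rw [e]; push_cast; ring

lemma steps (q : ℕ) (hq : 1 ≤ q) (k : ℕ) : ∀ ε : ℝ, 0 < ε → ∃ η : ℝ, 0 < η ∧ 2 * η ≤ ε ∧ ∃ T : ℕ,
    ∀ d : ℕ → ℕ → ℝ, (∀ i t, d i (t + 1) = d i t + d (i + 1) t) →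
      (∀ t ≤ T, ∃ a : ℤ, q * a + η ≤ d k t ∧ d k t ≤ q * a + 2 * η) →
      ∃ t ≤ T, ∀ i < k, ∃ a : ℤ, (q : ℝ) * a ≤ d i t ∧ d i t ≤ q * a + ε := by
  induction k with
  | zero =>
    intro ε hε
    exact ⟨ε / 2, by linarith, by linarith, 0, fun d _ _ => ⟨0, le_rfl, fun i hi => by omega⟩⟩
  | succ k ih =>
    intro ε hε
    obtain ⟨η', hη', hηε, T', hT'⟩ := ih ε hε
    have hT0 : (0 : ℝ) < T' + 1 := by positivity
    have hqR : (0 : ℝ) < q := by exact_mod_cast hq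
    set η : ℝ := η' / (2 * (T' + 1)) with hη
    have hηpos : 0 < η := by positivity
    have hηT : 2 * η * (T' + 1) = η' := by rw [hη]; field_simp
    have hη2 : 2 * η ≤ η' := by
      have : (0 : ℝ) ≤ T' := by positivity
      nlinarith
    set S : ℕ := ⌈(q : ℝ) / η⌉₊ with hS
    have hSq : (q : ℝ) ≤ η * S := by
      have := Nat.le_ceil ((q : ℝ) / η)
      rw [div_le_iff₀ hηpos] at this
      linarith
    refine ⟨η, hηpos, by linarith, T' + S, ?_⟩
    intro d hd hyp
    have hyp' : ∀ t, ∃ a : ℤ, t ≤ T' + S → q * a + η ≤ d (k + 1) t ∧ d (k + 1) t ≤ q * a + 2 * η := by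
      intro t
      by_cases h : t ≤ T' + S
      · obtain ⟨a, ha⟩ := hyp t h
        exact ⟨a, fun _ => ha⟩
      · exact ⟨0, fun h' => absurd h' h⟩
    choose a ha using hyp'
    set A : ℕ → ℤ := fun t => ∑ s ∈ Finset.range t, a s with hA
    set w : ℕ → ℝ := fun t => d k t - q * A t with hw
    have hws : ∀ t ≤ T' + S, w t + η ≤ w (t + 1) ∧ w (t + 1) ≤ w t + 2 * η := by
      intro t ht
      have h1 := ha t ht
      have h2 : w (t + 1) = w t + (d (k + 1) t - q * a t) := by
        simp only [hw, hA, Finset.sum_range_succ, hd k t]; push_cast; ring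
      rw [h2]
      constructor <;> linarith [h1.1, h1.2]
    have hwlin : ∀ t s, t + s ≤ T' + S → w t + η * s ≤ w (t + s) ∧ w (t + s) ≤ w t + 2 * η * s := by
      intro t s
      induction s with
      | zero => intro _; simp
      | succ s ihs =>
        intro h
        have h1 := ihs (by omega)
        have h2 := hws (t + s) (by omega)
        rw [← add_assoc]
        push_cast
        constructor <;> nlinarith [h1.1, h1.2, h2.1, h2.2]
    set b : ℤ := ⌈(w 0 - η') / q⌉ with hb
    have hb1 : w 0 ≤ q * b + η' := by
      have := Int.le_ceil ((w 0 - η') / q)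
      rw [div_le_iff₀ hqR] at this
      linarith
    have hb2 : q * b + η' ≤ w 0 + q := by
      have := (Int.ceil_lt_add_one ((w 0 - η') / q)).le
      rw [← sub_le_iff_le_add, le_div_iff₀ hqR] at this
      linarith
    have hex : ∃ t, q * b + η' ≤ w t := by
      refine ⟨S, ?_⟩
      have := (hwlin 0 S (by omega)).1
      rw [zero_add] at this
      linarith
    classical
    set t0 := Nat.find hex with ht0
    have ht0S : t0 ≤ S := by
      apply Nat.find_min'
      have := (hwlin 0 S (by omega)).1
      rw [zero_add] at this
      linarith
    have ht0a : q * b + η' ≤ w t0 := Nat.find_spec hex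
    have ht0b : w t0 ≤ q * b + η' + 2 * η := by
      rcases Nat.eq_zero_or_pos t0 with h | h
      · rw [h]; linarith
      · have h1 := Nat.find_min hex (m := t0 - 1) (by omega)
        have h2 := (hws (t0 - 1) (by omega)).2
        rw [Nat.sub_add_cancel h] at h2
        linarith
    have key : ∀ t ≤ T', ∃ c : ℤ, q * c + η' ≤ d k (t0 + t) ∧ d k (t0 + t) ≤ q * c + 2 * η' := by
      intro t ht
      refine ⟨b + A (t0 + t), ?_⟩
      have h1 := hwlin t0 t (by omega)
      have h2 : d k (t0 + t) = w (t0 + t) + q * A (t0 + t) := by simp [hw]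
      have h3 : (t : ℝ) ≤ T' := by exact_mod_cast ht
      have h4 : 0 ≤ η * t := by positivity
      have h5 : 2 * η * t ≤ 2 * η * T' := by gcongr
      rw [h2]
      push_cast
      constructor
      · linarith [h1.1]
      · linarith [h1.2]
    obtain ⟨t1, ht1, h⟩ := hT' (fun i t => d i (t0 + t)) (fun i t => hd i (t0 + t)) key
    refine ⟨t0 + t1, by omega, ?_⟩
    intro i hi
    rcases Nat.lt_succ_iff_lt_or_eq.1 hi with h' | h'
    · exact h i h'
    · obtain ⟨c, hc⟩ := key t1 ht1
      subst h'
      exact ⟨c, by linarith [hc.1], by linarith [hc.2]⟩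

lemma newton (ε : ℝ) (hε : 0 ≤ ε) (q : ℝ) (k : ℕ) : ∀ (d : ℕ → ℕ → ℝ) (a : ℕ → ℤ),
    (∀ i t, d i (t + 1) = d i t + d (i + 1) t) →
    (∀ i < k, q * a i ≤ d i 0 ∧ d i 0 ≤ q * a i + ε) →
    (∀ t, 0 ≤ d k t ∧ d k t ≤ ε) → ∀ n : ℕ,
    0 ≤ d 0 n - q * ∑ i ∈ Finset.range k, (n.choose i : ℝ) * a i ∧
    d 0 n - q * ∑ i ∈ Finset.range k, (n.choose i : ℝ) * a i ≤ ε * (1 + n) ^ k := by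
  induction k with
  | zero => intro d a hd h1 h2 n; simpa using h2 n
  | succ k ih =>
    intro d a hd h1 h2 n
    have IH := ih (fun i t => d (i + 1) t) (fun i => a (i + 1)) (fun i t => hd (i + 1) t)
      (fun i hi => h1 (i + 1) (by omega)) h2
    have main : 0 ≤ d 0 n - q * ∑ i ∈ Finset.range (k + 1), (n.choose i : ℝ) * a i ∧
      d 0 n - q * ∑ i ∈ Finset.range (k + 1), (n.choose i : ℝ) * a i ≤ ε + ε * n * (1 + n) ^ k := by
      induction n with
      | zero =>
        have h0 := h1 0 (by omega)
        rw [Finset.sum_range_succ']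
        simp
        constructor <;> linarith [h0.1, h0.2]
      | succ n ihn =>
        have e : ∑ i ∈ Finset.range (k + 1), ((n + 1).choose i : ℝ) * a i =
          ∑ i ∈ Finset.range (k + 1), (n.choose i : ℝ) * a i +
          ∑ i ∈ Finset.range k, (n.choose i : ℝ) * a (i + 1) := by
          rw [Finset.sum_range_succ', Finset.sum_range_succ' (fun i => (n.choose i : ℝ) * a i)]
          simp only [Nat.choose_succ_succ, Nat.choose_zero_right]
          push_cast
          simp only [add_mul, Finset.sum_add_distrib]
          ring
        have h3 := IH n
        simp only [zero_add] at h3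
        rw [e, hd 0 n]
        simp only [zero_add]
        rw [mul_add]
        have h5 : ε * (n + 1) * (1 + (n : ℝ)) ^ k ≤ ε * (n + 1) * (1 + ((n : ℝ) + 1)) ^ k := by
          gcongr; linarith
        push_cast
        constructor
        · linarith [h3.1, ihn.1]
        · linarith [h3.2, ihn.2]
    refine ⟨main.1, main.2.trans ?_⟩
    have h6 : (1 : ℝ) ≤ (1 + n) ^ k := one_le_pow₀ (by linarith [Nat.cast_nonneg (α := ℝ) n])
    rw [pow_succ]
    nlinarith

lemma poly (r k m : ℕ) (hk : 1 ≤ k) (a : ℕ → ℤ) (ham : a k = m) : ∃ p : ℤ[X],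
    p.degree ≤ (k - 1 : ℕ) ∧ ∀ n : ℕ,
      (r : ℤ) * ((m : ℤ) * (n : ℤ) ^ k + p.eval (n : ℤ)) =
      ((r * k.factorial : ℕ) : ℤ) * ∑ i ∈ Finset.range (k + 1), (n.choose i : ℤ) * a i := by
  have hdeg : ∀ i, (descPochhammer ℤ i).degree = i := by
    intro i
    rw [degree_eq_natDegree (monic_descPochhammer ℤ i).ne_zero, descPochhammer_natDegree]
  refine ⟨∑ i ∈ Finset.range k, C (a i * (k.factorial / i.factorial : ℕ)) * descPochhammer ℤ i
    + C (m : ℤ) * (descPochhammer ℤ k - X ^ k), ?_, ?_⟩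
  · refine (degree_add_le _ _).trans (max_le ?_ ?_)
    · refine (degree_sum_le _ _).trans (Finset.sup_le ?_)
      intro i hi
      have := Finset.mem_range.1 hi
      rw [← smul_eq_C_mul]
      refine (degree_smul_le _ _).trans ?_
      rw [hdeg]
      exact_mod_cast (by omega : i ≤ k - 1)
    · rw [← smul_eq_C_mul]
      refine (degree_smul_le _ _).trans ?_
      have h : (descPochhammer ℤ k - X ^ k).degree < (descPochhammer ℤ k).degree := by
        apply degree_sub_lt
        · rw [hdeg, degree_X_pow]
        · exact (monic_descPochhammer ℤ k).ne_zero
        · rw [(monic_descPochhammer ℤ k).leadingCoeff, (monic_X_pow k).leadingCoeff]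
      rw [hdeg] at h
      have hk' : k = (k - 1) + 1 := by omega
      exact degree_le_of_natDegree_le (by
        by_cases h0 : descPochhammer ℤ k - X ^ k = 0
        · rw [h0]; simp
        · have := (natDegree_lt_iff_degree_lt h0).2 h
          omega)
  · intro n
    have hev : ∀ i, (descPochhammer ℤ i).eval (n : ℤ) = i.factorial * n.choose i := by
      intro i
      rw [descPochhammer_eval_eq_descFactorial, Nat.descFactorial_eq_factorial_mul_choose]
      push_cast; rfl
    simp only [eval_add, eval_finsetSum, eval_mul, eval_C, eval_sub, eval_pow, eval_X, hev]
    rw [Finset.sum_range_succ, ham]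
    have : ∀ i ∈ Finset.range k, a i * ((k.factorial / i.factorial : ℕ) : ℤ) *
        ((i.factorial : ℤ) * n.choose i) = k.factorial * ((n.choose i : ℤ) * a i) := by
      intro i hi
      have h1 : (k.factorial / i.factorial) * i.factorial = k.factorial :=
        Nat.div_mul_cancel (Nat.factorial_dvd_factorial (Finset.mem_range.1 hi).le)
      have h2 : ((k.factorial / i.factorial : ℕ) : ℤ) * i.factorial = k.factorial := by
        exact_mod_cast h1
      rw [← h2]; ring
    rw [Finset.sum_congr rfl this, ← Finset.mul_sum]
    push_cast
    ring

/-- The pattern of length `N` exists at `m`. -/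
def Good (k : ℕ) (δ : ℝ) (r N m : ℕ) : Prop :=
  ∃ p : ℤ[X], p.degree ≤ (k - 1 : ℕ) ∧ ∀ n : ℕ, 1 ≤ n → n ≤ N →
    ∃ j : ℕ, 1 ≤ j ∧ (r : ℤ) * ((m : ℤ) * (n : ℤ) ^ k + p.eval (n : ℤ)) = ⌊(j : ℝ) ^ δ⌋

lemma good (k : ℕ) (hk : 1 ≤ k) (δ : ℝ) (hδ1 : (k : ℝ) < δ) (hδ2 : δ < (k : ℝ) + 1)
    (r : ℕ) (hr : 1 ≤ r) (N : ℕ) : ∃ M, ∀ m, M ≤ m → Good k δ r N m := by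
  set q : ℕ := r * k.factorial with hq
  have hq1 : 1 ≤ q := Nat.mul_pos hr k.factorial_pos
  have hqR : (1 : ℝ) ≤ q := by exact_mod_cast hq1
  set ε : ℝ := 1 / (2 * (1 + N) ^ (k + 1)) with hε
  have hεpos : 0 < ε := by positivity
  have hεN : ε * (1 + N) ^ (k + 1) < 1 := by
    have : ε * (1 + N) ^ (k + 1) = 1 / 2 := by rw [hε]; field_simp
    rw [this]; norm_num
  obtain ⟨η, hη, hηε, T, hT⟩ := steps q hq1 k ε hεpos
  set d : ℕ → ℕ → ℝ := fun i t => D i (fun y => y ^ δ) t with hd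
  have hdrec : ∀ i t, d i (t + 1) = d i t + d (i + 1) t := by
    intro i t; simp [hd, D]
  have hprod : ∀ i ≤ k + 1, 0 < ∏ j ∈ Finset.range i, (δ - j) := by
    intro i hi
    apply Finset.prod_pos
    intro j hj
    have : j ≤ k := by have := Finset.mem_range.1 hj; omega
    have : (j : ℝ) ≤ k := by exact_mod_cast this
    linarith
  -- top differences tend to infinity
  have htop : Tendsto (d k) atTop atTop := by
    have h1 : Tendsto (fun t : ℕ => (∏ j ∈ Finset.range k, (δ - j)) * (t : ℝ) ^ (δ - k)) atTop atTop :=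
      ((tendsto_rpow_atTop (by linarith : 0 < δ - k)).comp tendsto_natCast_atTop_atTop).const_mul_atTop
        (hprod k (by omega))
    refine tendsto_atTop_mono' _ ?_ h1
    filter_upwards [eventually_ge_atTop 1] with t ht
    have ht' : (0 : ℝ) < t := by exact_mod_cast ht
    obtain ⟨ξ, h2, h3, h4⟩ := D_mvt k δ t ht'
    simp only [hd]
    rw [h4]
    have := (hprod k (by omega)).le
    have h5 : 0 ≤ δ - k := by linarith
    gcongr
  have hpos : ∀ t, 1 ≤ t → 0 ≤ d (k + 1) t := by
    intro t ht
    have ht' : (0 : ℝ) < t := by exact_mod_cast ht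
    obtain ⟨ξ, h2, h3, h4⟩ := D_mvt (k + 1) δ t ht'
    simp only [hd]
    rw [h4]
    exact mul_nonneg (hprod _ le_rfl).le (Real.rpow_nonneg (by linarith) _)
  have hzero : Tendsto (d (k + 1)) atTop (nhds 0) := by
    have h1 : Tendsto (fun t : ℕ => (∏ j ∈ Finset.range (k + 1), (δ - j)) *
        (t : ℝ) ^ (-((k + 1 : ℝ) - δ))) atTop (nhds 0) := by
      have := ((tendsto_rpow_neg_atTop (by linarith : 0 < (k + 1 : ℝ) - δ)).comp
        tendsto_natCast_atTop_atTop).const_mul (∏ j ∈ Finset.range (k + 1), (δ - j))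
      simpa using this
    refine tendsto_of_tendsto_of_tendsto_of_le_of_le' tendsto_const_nhds h1 ?_ ?_
    · filter_upwards [eventually_ge_atTop 1] with t ht using hpos t ht
    · filter_upwards [eventually_ge_atTop 1] with t ht
      have ht' : (0 : ℝ) < t := by exact_mod_cast ht
      obtain ⟨ξ, h2, h3, h4⟩ := D_mvt (k + 1) δ t ht'
      simp only [hd]
      rw [h4]
      have e : δ - ((k + 1 : ℕ) : ℝ) = -((k + 1 : ℝ) - δ) := by push_cast; ring
      rw [e]
      have := (hprod (k + 1) le_rfl).le
      refine mul_le_mul_of_nonneg_left ?_ this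
      exact Real.rpow_le_rpow_of_nonpos ht' h2 (by linarith)
  have hT1 : (0 : ℝ) < T + 1 := by positivity
  set κ : ℝ := min ε (η / (T + 1)) with hκ
  have hκpos : 0 < κ := lt_min hεpos (by positivity)
  have hκT : κ * (T + 1) ≤ η := by
    have := min_le_right ε (η / (T + 1))
    rwa [← hκ, le_div_iff₀ hT1] at this
  obtain ⟨x0, hx0⟩ := eventually_atTop.1
    ((hzero.eventually (gt_mem_nhds hκpos)).and (eventually_ge_atTop 1))
  obtain ⟨M, hM⟩ := exists_nat_gt (d k x0)
  refine ⟨M, fun m hm => ?_⟩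
  have hmM : (M : ℝ) ≤ m := by exact_mod_cast hm
  have hx0m : d k x0 < q * m + η := by nlinarith [Nat.cast_nonneg (α := ℝ) m]
  have hex : ∃ s, q * m + η ≤ d k (x0 + s) := by
    obtain ⟨y, hy⟩ := eventually_atTop.1 (htop.eventually_ge_atTop (q * m + η))
    exact ⟨y, hy _ (by omega)⟩
  classical
  set s := Nat.find hex with hs
  have hs1 : q * m + η ≤ d k (x0 + s) := Nat.find_spec hex
  have hs0 : 0 < s := by
    rcases Nat.eq_zero_or_pos s with h | h
    · rw [h] at hs1; simp at hs1; linarith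
    · exact h
  have hs2 : d k (x0 + s) ≤ q * m + η + κ := by
    have h1 := Nat.find_min hex (m := s - 1) (by omega)
    have h2 := hdrec k (x0 + (s - 1))
    have h3 := (hx0 (x0 + (s - 1)) (by omega)).1
    have e : x0 + (s - 1) + 1 = x0 + s := by omega
    rw [e] at h2
    linarith
  set x := x0 + s with hx
  have hlin : ∀ t : ℕ, d k x ≤ d k (x + t) ∧ d k (x + t) ≤ d k x + κ * t := by
    intro t
    induction t with
    | zero => simp
    | succ t iht =>
      have h1 := hx0 (x + t) (by omega)
      have h2 := hpos (x + t) h1.2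
      rw [← add_assoc, hdrec]
      push_cast
      constructor <;> linarith [iht.1, iht.2, h1.1]
  have hwin : ∀ t ≤ T, q * m + η ≤ d k (x + t) ∧ d k (x + t) ≤ q * m + 2 * η := by
    intro t ht
    have h1 := hlin t
    have h2 : (t : ℝ) ≤ T := by exact_mod_cast ht
    have h3 : κ * t ≤ κ * T := by gcongr
    constructor <;> linarith [h1.1, h1.2]
  obtain ⟨t, ht, h⟩ := hT (fun i t => d i (x + t)) (fun i t => hdrec i (x + t))
    (fun t ht => ⟨m, by exact_mod_cast hwin t ht⟩)
  have h' : ∀ i, ∃ a : ℤ, i < k → (q : ℝ) * a ≤ d i (x + t) ∧ d i (x + t) ≤ q * a + ε := by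
    intro i
    by_cases hi : i < k
    · obtain ⟨a, ha⟩ := h i hi
      exact ⟨a, fun _ => ha⟩
    · exact ⟨0, fun h => absurd h hi⟩
  choose a0 ha0 using h'
  set a : ℕ → ℤ := fun i => if i < k then a0 i else m with ha
  have ham : a k = m := by simp [ha]
  have hN := newton ε hεpos.le q (k + 1) (fun i n => d i (x + t + n)) a
    (fun i n => hdrec i (x + t + n)) (by
      intro i hi
      rcases Nat.lt_succ_iff_lt_or_eq.1 hi with h1 | h1
      · simpa [ha, h1] using ha0 i h1
      · subst h1
        rw [ham]
        have := hwin t ht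
        simp only [add_zero, Int.cast_natCast]
        constructor <;> linarith [this.1, this.2])
    (by
      intro n
      have h1 := hx0 (x + t + n) (by omega)
      exact ⟨hpos _ h1.2, h1.1.le.trans (min_le_left _ _)⟩)
  obtain ⟨p, hp1, hp2⟩ := poly r k m hk a ham
  refine ⟨p, hp1, fun n hn1 hnN => ⟨x + t + n, by omega, ?_⟩⟩
  rw [hp2 n, eq_comm, Int.floor_eq_iff]
  have h1 := hN n
  have h2 : d 0 (x + t + n) = ((x + t + n : ℕ) : ℝ) ^ δ := by simp [hd, D]
  simp only [h2] at h1
  have h3 : ε * (1 + n) ^ (k + 1) ≤ ε * (1 + (N : ℝ)) ^ (k + 1) := by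
    have : (n : ℝ) ≤ N := by exact_mod_cast hnN
    gcongr
  have e : (((q : ℤ) * ∑ i ∈ Finset.range (k + 1), (n.choose i : ℤ) * a i : ℤ) : ℝ) =
    (q : ℝ) * ∑ i ∈ Finset.range (k + 1), (n.choose i : ℝ) * a i := by push_cast; rfl
  rw [e]
  constructor <;> linarith [h1.1, h1.2]

end Stmt14

/-- The instance `a(x) = x^δ` of Proposition 5.3 of the paper: the range of `⌊n^δ⌋`
contains suitable polynomial patterns. -/
theorem stmt_14 (k : ℕ) (hk : 1 ≤ k) (δ : ℝ) (hδ1 : (k : ℝ) < δ) (hδ2 : δ < (k : ℝ) + 1) :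
    ∀ r : ℕ, 1 ≤ r →
      ∃ (M : ℕ) (N : ℕ → ℕ) (p : ℕ → Polynomial ℤ),
        (∀ m : ℕ, M ≤ m → 1 ≤ N m) ∧ Tendsto N atTop atTop ∧
        (∀ m : ℕ, (p m).degree ≤ (k - 1 : ℕ)) ∧
        ∀ m : ℕ, M ≤ m → ∀ n : ℕ, 1 ≤ n → n ≤ N m →
          ∃ j : ℕ, 1 ≤ j ∧
            (r : ℤ) * ((m : ℤ) * (n : ℤ) ^ k + (p m).eval (n : ℤ)) = ⌊(j : ℝ) ^ δ⌋ := by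
  intro r hr
  classical
  choose Mf hMf using Stmt14.good k hk δ hδ1 hδ2 r hr
  set N : ℕ → ℕ := fun m => Nat.findGreatest (fun N => Stmt14.Good k δ r N m) m with hN
  have hge : ∀ b m, b ≤ m → Mf b ≤ m → b ≤ N m := fun b m h1 h2 =>
    Nat.le_findGreatest h1 (hMf b m h2)
  have hp : ∀ m, ∃ p : ℤ[X], p.degree ≤ (k - 1 : ℕ) ∧ (max 1 (Mf 1) ≤ m →
      ∀ n : ℕ, 1 ≤ n → n ≤ N m → ∃ j : ℕ, 1 ≤ j ∧
        (r : ℤ) * ((m : ℤ) * (n : ℤ) ^ k + p.eval (n : ℤ)) = ⌊(j : ℝ) ^ δ⌋) := by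
    intro m
    by_cases hm : max 1 (Mf 1) ≤ m
    · have hg : Stmt14.Good k δ r (N m) m :=
        Nat.findGreatest_spec (P := fun N => Stmt14.Good k δ r N m)
          ((le_max_left _ _).trans hm) (hMf 1 m ((le_max_right _ _).trans hm))
      obtain ⟨p, h1, h2⟩ := hg
      exact ⟨p, h1, fun _ => h2⟩
    · exact ⟨0, by simp, fun h => absurd h hm⟩
  choose p hp1 hp2 using hp
  refine ⟨max 1 (Mf 1), N, p, fun m hm => hge 1 m ((le_max_left _ _).trans hm)
    ((le_max_right _ _).trans hm), ?_, hp1, hp2⟩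
  refine tendsto_atTop.2 fun b => ?_
  filter_upwards [eventually_ge_atTop b, eventually_ge_atTop (Mf b)] with m h1 h2 using hge b m h1 h2
end

section
/- Let 1 < δ < 2. Then for every ε > 0 there exist natural numbers k_m ≤ l_m with l_m − k_m → ∞ as m → ∞ such that: (i) for all sufficiently large m, every integer n with k_m ≤ n ≤ l_m satisfies m ≤ δ·n^{δ−1} ≤ m + ε; and (ii) for every nonzero integer s, (1/(l_m − k_m + 1))·Σ_{n=k_m}^{l_m} e(s·n^δ) → 0 as m → ∞. -/
open Filter Finset

lemma aux_mvt (p x y : ℝ) (hx : 0 < x) (hxy : x ≤ y) :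
    ∃ z, x ≤ z ∧ z ≤ y ∧ y ^ p - x ^ p = (y - x) * (p * z ^ (p - 1)) := by
  rcases hxy.eq_or_lt with h | h
  · exact ⟨x, le_refl _, hxy, by subst h; simp⟩
  · obtain ⟨z, hz, hz'⟩ := exists_hasDerivAt_eq_slope (fun u : ℝ => u ^ p)
      (fun u => p * u ^ (p - 1)) h
      (by
        intro u hu
        have : u ≠ 0 := (hx.trans_le hu.1).ne'
        exact (Real.continuousAt_rpow_const u p (Or.inl this)).continuousWithinAt)
      (by
        intro u hu
        have : u ≠ 0 := (hx.trans hu.1).ne'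
        exact Real.hasDerivAt_rpow_const (Or.inl this))
    refine ⟨z, hz.1.le, hz.2.le, ?_⟩
    have : y - x ≠ 0 := by linarith
    rw [hz']
    field_simp

lemma aux_expsum (N : ℕ) (f : ℕ → ℝ) (c η E : ℝ) (s : ℤ) (m : ℕ)
    (h : ∀ j < N, |f j - (c + j * (m + η))| ≤ E) (hη : 0 < η) (hs0 : s ≠ 0)
    (hs : |(s : ℝ)| * η ≤ 1 / 2) :
    ‖∑ j ∈ range N, Complex.exp (Complex.I * ((2 * Real.pi * s * f j : ℝ) : ℂ))‖
      ≤ N * (2 * Real.pi * |(s : ℝ)| * E) + 1 / (2 * |(s : ℝ)| * η) := by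
  have hpi := Real.pi_pos
  have hsp : 0 < |(s : ℝ)| := abs_pos.mpr (by exact_mod_cast hs0)
  set w : ℂ := Complex.exp (Complex.I * ((2 * Real.pi * s * c : ℝ) : ℂ)) with hw
  set q : ℂ := Complex.exp (Complex.I * ((2 * Real.pi * s * η : ℝ) : ℂ)) with hq
  have hwn : ‖w‖ = 1 := by rw [hw, mul_comm]; exact Complex.norm_exp_ofReal_mul_I _
  have hqn : ‖q‖ = 1 := by rw [hq, mul_comm]; exact Complex.norm_exp_ofReal_mul_I _
  have hmain : ∀ j : ℕ, w * q ^ j =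
      Complex.exp (Complex.I * ((2 * Real.pi * s * (c + j * (m + η)) : ℝ) : ℂ)) := by
    intro j
    rw [hw, hq, ← Complex.exp_nat_mul, ← Complex.exp_add, Complex.exp_eq_exp_iff_exists_int]
    refine ⟨-(s * j * m), ?_⟩
    push_cast
    ring
  have hterm : ∀ j ∈ range N,
      ‖Complex.exp (Complex.I * ((2 * Real.pi * s * f j : ℝ) : ℂ)) - w * q ^ j‖
        ≤ 2 * Real.pi * |(s : ℝ)| * E := by
    intro j hj
    rw [hmain j]
    set B : ℝ := 2 * Real.pi * s * (c + j * (m + η)) with hB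
    have e1 : Complex.exp (Complex.I * ((2 * Real.pi * s * f j : ℝ) : ℂ)) -
        Complex.exp (Complex.I * (B : ℂ)) =
        Complex.exp (Complex.I * (B : ℂ)) *
          (Complex.exp (Complex.I * ((2 * Real.pi * s * f j - B : ℝ) : ℂ)) - 1) := by
      rw [mul_sub, ← Complex.exp_add, mul_one]
      congr 2
      push_cast
      ring
    have e2 : ‖Complex.exp (Complex.I * (B : ℂ))‖ = 1 := by
      rw [mul_comm]; exact Complex.norm_exp_ofReal_mul_I _
    rw [e1, norm_mul, e2, one_mul]
    refine (Real.norm_exp_I_mul_ofReal_sub_one_le).trans ?_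
    have e3 : 2 * Real.pi * s * f j - B = (2 * Real.pi * s) * (f j - (c + j * (m + η))) := by
      rw [hB]; ring
    rw [e3, Real.norm_eq_abs, abs_mul, abs_mul, abs_of_pos (by positivity : 0 < 2 * Real.pi)]
    exact mul_le_mul_of_nonneg_left (h j (by simpa using hj)) (by positivity)
  have hq1 : 4 * |(s : ℝ)| * η ≤ ‖q - 1‖ := by
    rw [hq, Complex.norm_exp_I_mul_ofReal_sub_one, Real.norm_eq_abs, abs_mul]
    have e : 2 * Real.pi * s * η / 2 = Real.pi * s * η := by ring
    have e' : |Real.pi * s * η| = Real.pi * (|(s : ℝ)| * η) := by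
      rw [abs_mul, abs_mul, abs_of_pos hpi, abs_of_pos hη]; ring
    have := Real.mul_abs_le_abs_sin (x := Real.pi * s * η) (by rw [e']; nlinarith)
    rw [e, abs_two]
    rw [e'] at this
    have e4 : 2 / Real.pi * (Real.pi * (|(s : ℝ)| * η)) = 2 * (|(s : ℝ)| * η) := by
      field_simp
    rw [e4] at this
    linarith
  have hq1p : 0 < ‖q - 1‖ := lt_of_lt_of_le (by positivity) hq1
  have hgeom : ‖∑ j ∈ range N, w * q ^ j‖ ≤ 1 / (2 * |(s : ℝ)| * η) := by
    rw [← mul_sum, norm_mul, hwn, one_mul, geom_sum_eq (by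
      intro hh; rw [hh] at hq1p; simp at hq1p), norm_div]
    have : ‖q ^ N - 1‖ ≤ 2 := by
      refine (norm_sub_le _ _).trans ?_
      rw [norm_pow, hqn]; norm_num
    calc ‖q ^ N - 1‖ / ‖q - 1‖ ≤ 2 / (4 * |(s : ℝ)| * η) := by gcongr
      _ = _ := by field_simp; norm_num
  have hsplit : ∑ j ∈ range N, Complex.exp (Complex.I * ((2 * Real.pi * s * f j : ℝ) : ℂ)) =
      ∑ j ∈ range N, (Complex.exp (Complex.I * ((2 * Real.pi * s * f j : ℝ) : ℂ)) - w * q ^ j)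
        + ∑ j ∈ range N, w * q ^ j := by
    rw [← sum_add_distrib]; simp
  rw [hsplit]
  refine (norm_add_le _ _).trans (add_le_add ?_ hgeom)
  refine (norm_sum_le _ _).trans ((sum_le_sum hterm).trans ?_)
  simp

/-- Bounds on the derivative near `x`. -/
lemma aux_deriv (δ : ℝ) (hδ1 : 1 < δ) (hδ2 : δ < 2) (x y : ℝ) (hx : 0 < x) (hxy : x ≤ y) :
    δ * x ^ (δ - 1) + (y - x) * (δ * (δ - 1) * y ^ (δ - 2)) ≤ δ * y ^ (δ - 1) ∧
    δ * y ^ (δ - 1) ≤ δ * x ^ (δ - 1) + (y - x) * (δ * (δ - 1) * x ^ (δ - 2)) := by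
  obtain ⟨z, h1, h2, h3⟩ := aux_mvt (δ - 1) x y hx hxy
  have e : δ - 1 - 1 = δ - 2 := by ring
  rw [e] at h3
  have hz : 0 < z := hx.trans_le h1
  have hzx : z ^ (δ - 2) ≤ x ^ (δ - 2) := Real.rpow_le_rpow_of_nonpos hx h1 (by linarith)
  have hzy : y ^ (δ - 2) ≤ z ^ (δ - 2) := Real.rpow_le_rpow_of_nonpos hz h2 (by linarith)
  have hd : 0 ≤ (y - x) * (δ * (δ - 1)) :=
    mul_nonneg (by linarith) (mul_nonneg (by linarith) (by linarith))
  have k1 := mul_le_mul_of_nonneg_left hzx hd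
  have k2 := mul_le_mul_of_nonneg_left hzy hd
  have h4 : δ * y ^ (δ - 1) = δ * x ^ (δ - 1) + (y - x) * (δ * (δ - 1)) * z ^ (δ - 2) := by
    linear_combination δ * h3
  constructor <;> rw [h4] <;> linarith

lemma aux_taylor (δ : ℝ) (hδ1 : 1 < δ) (hδ2 : δ < 2) (x y : ℝ) (hx : 0 < x) (hxy : x ≤ y) :
    |y ^ δ - (x ^ δ + (y - x) * (δ * x ^ (δ - 1)))| ≤
      (y - x) ^ 2 * (δ * (δ - 1) * x ^ (δ - 2)) := by
  obtain ⟨z, h1, h2, h3⟩ := aux_mvt δ x y hx hxy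
  have hd := (aux_deriv δ hδ1 hδ2 x z hx h1).2
  have hm : x ^ (δ - 1) ≤ z ^ (δ - 1) := Real.rpow_le_rpow hx.le h1 (by linarith)
  have hC : 0 ≤ δ * (δ - 1) * x ^ (δ - 2) :=
    mul_nonneg (mul_nonneg (by linarith) (by linarith)) (Real.rpow_nonneg hx.le _)
  have e : y ^ δ - (x ^ δ + (y - x) * (δ * x ^ (δ - 1))) =
      (y - x) * (δ * z ^ (δ - 1) - δ * x ^ (δ - 1)) := by linear_combination h3
  have hyx : 0 ≤ y - x := by linarith
  rw [e, abs_of_nonneg (mul_nonneg hyx (by nlinarith)), pow_two, mul_assoc]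
  refine mul_le_mul_of_nonneg_left ?_ hyx
  have := mul_le_mul_of_nonneg_right (by linarith : z - x ≤ y - x) hC
  linarith

/-- Everything at a fixed scale. -/
lemma aux_scale (δ : ℝ) (hδ1 : 1 < δ) (hδ2 : δ < 2) (x t : ℝ) (m : ℕ) (hx : 1 ≤ x)
    (ht : 1 ≤ t) (hm : δ * x ^ (δ - 1) = m) (htx : t ^ 7 ≤ x)
    (ht8 : x ^ (δ - 2) = 1 / t ^ 8) :
    ∀ n : ℕ, ⌈x + t ^ 7⌉₊ ≤ n → n ≤ ⌈x + t ^ 7⌉₊ + ⌊t ^ 2⌋₊ →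
      m + δ * (δ - 1) * (4 : ℝ) ^ (δ - 2) / t ≤ δ * (n : ℝ) ^ (δ - 1) ∧
      δ * (n : ℝ) ^ (δ - 1) ≤ m + 3 * (δ * (δ - 1)) / t := by
  intro n h1 h2
  have hx0 : 0 < x := by linarith
  have ht0 : 0 < t := by linarith
  have hC : 0 < δ * (δ - 1) := mul_pos (by linarith) (by linarith)
  have g1 : x + t ^ 7 ≤ n := (Nat.le_ceil _).trans (by exact_mod_cast h1)
  have g2 : (n : ℝ) ≤ x + 3 * t ^ 7 := by
    have a1 : (n : ℝ) ≤ ⌈x + t ^ 7⌉₊ + ⌊t ^ 2⌋₊ := by exact_mod_cast h2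
    have a2 := Nat.ceil_lt_add_one (by positivity : 0 ≤ x + t ^ 7)
    have a3 := Nat.floor_le (by positivity : 0 ≤ t ^ 2)
    have a4 : t ^ 2 ≤ t ^ 7 := pow_le_pow_right₀ ht (by norm_num)
    have a5 : 1 ≤ t ^ 7 := one_le_pow₀ ht
    linarith
  have ht7 : 0 < t ^ 7 := by positivity
  have hxn : x ≤ n := by linarith
  obtain ⟨d1, d2⟩ := aux_deriv δ hδ1 hδ2 x n hx0 hxn
  rw [hm] at d1 d2
  have hn4 : (4 : ℝ) ^ (δ - 2) * (1 / t ^ 8) ≤ (n : ℝ) ^ (δ - 2) := by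
    rw [← ht8, ← Real.mul_rpow (by norm_num) hx0.le]
    exact Real.rpow_le_rpow_of_nonpos (by linarith) (by linarith) (by linarith)
  have h40 : 0 < (4 : ℝ) ^ (δ - 2) := by positivity
  constructor
  · refine le_trans ?_ d1
    have : t ^ 7 * (δ * (δ - 1) * ((4 : ℝ) ^ (δ - 2) * (1 / t ^ 8))) ≤
        (n - x) * (δ * (δ - 1) * (n : ℝ) ^ (δ - 2)) := by
      apply mul_le_mul (by linarith) _ (by positivity) (by linarith)
      exact mul_le_mul_of_nonneg_left hn4 hC.le
    have e : t ^ 7 * (δ * (δ - 1) * ((4 : ℝ) ^ (δ - 2) * (1 / t ^ 8))) =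
      δ * (δ - 1) * (4 : ℝ) ^ (δ - 2) / t := by field_simp
    linarith
  · refine d2.trans ?_
    rw [ht8]
    have : (n - x) * (δ * (δ - 1) * (1 / t ^ 8)) ≤ (3 * t ^ 7) * (δ * (δ - 1) * (1 / t ^ 8)) :=
      mul_le_mul_of_nonneg_right (by linarith) (by positivity)
    have e : (3 * t ^ 7) * (δ * (δ - 1) * (1 / t ^ 8)) = 3 * (δ * (δ - 1)) / t := by field_simp
    linarith

lemma aux_sum (δ : ℝ) (hδ1 : 1 < δ) (hδ2 : δ < 2) (x t : ℝ) (m : ℕ) (hx : 1 ≤ x)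
    (ht : 1 ≤ t) (hm : δ * x ^ (δ - 1) = m) (htx : t ^ 7 ≤ x)
    (ht8 : x ^ (δ - 2) = 1 / t ^ 8) (s : ℤ) (hs0 : s ≠ 0)
    (hts : |(s : ℝ)| * (3 * (δ * (δ - 1)) / t) ≤ 1 / 2) (k l : ℕ)
    (hk : k = ⌈x + t ^ 7⌉₊) (hl : l = k + ⌊t ^ 2⌋₊) :
    ‖((l : ℂ) - (k : ℂ) + 1)⁻¹ *
              ∑ n ∈ Finset.Icc k l,
                Complex.exp (2 * Real.pi * Complex.I * ((s : ℂ) * ((n : ℝ) ^ δ : ℝ)))‖ ≤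
      2 * Real.pi * |(s : ℝ)| * (δ * (δ - 1)) / t
        + 1 / (2 * |(s : ℝ)| * (δ * (δ - 1) * (4 : ℝ) ^ (δ - 2))) / t := by
  have hx0 : 0 < x := by linarith
  have ht0 : 0 < t := by linarith
  have hC : 0 < δ * (δ - 1) := mul_pos (by linarith) (by linarith)
  have h40 : 0 < (4 : ℝ) ^ (δ - 2) := by positivity
  have hsp : 0 < |(s : ℝ)| := abs_pos.mpr (by exact_mod_cast hs0)
  obtain ⟨b1, b2⟩ := aux_scale δ hδ1 hδ2 x t m hx ht hm htx ht8 k hk.ge (by omega)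
  have hkx : x ≤ k := by
    have := Nat.le_ceil (x + t ^ 7)
    rw [← hk] at this
    have : 0 < t ^ 7 := by positivity
    linarith
  have hk0 : (0 : ℝ) < k := by linarith
  set η : ℝ := δ * (k : ℝ) ^ (δ - 1) - m with hηd
  set N : ℕ := ⌊t ^ 2⌋₊ + 1 with hN
  have hη1 : δ * (δ - 1) * (4 : ℝ) ^ (δ - 2) / t ≤ η := by linarith
  have hη2 : η ≤ 3 * (δ * (δ - 1)) / t := by linarith
  have hη0 : 0 < η := lt_of_lt_of_le (by positivity) hη1
  have hN2 : t ^ 2 ≤ N := by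
    rw [hN]; push_cast; exact (Nat.lt_floor_add_one _).le
  have hN0 : (0 : ℝ) < N := by positivity
  have key := aux_expsum N (fun j => ((k + j : ℕ) : ℝ) ^ δ) ((k : ℝ) ^ δ) η
    (δ * (δ - 1) / t) s m ?_ hη0 hs0
    ((mul_le_mul_of_nonneg_left hη2 hsp.le).trans hts)
  · have e1 : ((l : ℂ) - (k : ℂ) + 1) = (N : ℂ) := by
      rw [hl, hN]; push_cast; ring
    have e2 : ∑ n ∈ Finset.Icc k l,
        Complex.exp (2 * Real.pi * Complex.I * ((s : ℂ) * ((n : ℝ) ^ δ : ℝ))) =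
        ∑ j ∈ range N, Complex.exp (Complex.I *
          ((2 * Real.pi * s * ((k + j : ℕ) : ℝ) ^ δ : ℝ) : ℂ)) := by
      rw [show Finset.Icc k l = Finset.Ico k (l + 1) by ext; simp,
        sum_Ico_eq_sum_range, show l + 1 - k = N by omega]
      refine sum_congr rfl fun j _ => ?_
      congr 1
      push_cast
      ring
    rw [e1, e2, norm_mul, norm_inv, Complex.norm_natCast]
    calc _ ≤ (N : ℝ)⁻¹ * (N * (2 * Real.pi * |(s : ℝ)| * (δ * (δ - 1) / t)) +
          1 / (2 * |(s : ℝ)| * η)) := mul_le_mul_of_nonneg_left key (by positivity)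
      _ = 2 * Real.pi * |(s : ℝ)| * (δ * (δ - 1)) / t + 1 / (2 * |(s : ℝ)| * (η * N)) := by
          field_simp
      _ ≤ _ := by
          have : (δ * (δ - 1) * (4 : ℝ) ^ (δ - 2) / t) * t ^ 2 ≤ η * N :=
            mul_le_mul hη1 hN2 (by positivity) hη0.le
          have e : (δ * (δ - 1) * (4 : ℝ) ^ (δ - 2) / t) * t ^ 2 =
            (δ * (δ - 1) * (4 : ℝ) ^ (δ - 2)) * t := by field_simp
          rw [e] at this
          rw [div_div, mul_assoc (2 * |(s : ℝ)|)]
          gcongr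
  · intro j hj
    have hT := aux_taylor δ hδ1 hδ2 k ((k + j : ℕ) : ℝ) hk0 (by push_cast; linarith [Nat.cast_nonneg (α := ℝ) j])
    have e : (((k + j : ℕ) : ℝ) - k) = j := by push_cast; ring
    rw [e] at hT
    have e' : (m : ℝ) + η = δ * (k : ℝ) ^ (δ - 1) := by rw [hηd]; ring
    rw [e']
    refine hT.trans ?_
    have hj2 : (j : ℝ) ≤ t ^ 2 :=
      (Nat.cast_le.mpr (by omega : j ≤ ⌊t ^ 2⌋₊)).trans (Nat.floor_le (by positivity))
    have hkk : (k : ℝ) ^ (δ - 2) ≤ 1 / t ^ 8 := by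
      rw [← ht8]; exact Real.rpow_le_rpow_of_nonpos hx0 hkx (by linarith)
    calc (j : ℝ) ^ 2 * (δ * (δ - 1) * (k : ℝ) ^ (δ - 2))
        ≤ (t ^ 2) ^ 2 * (δ * (δ - 1) * (1 / t ^ 8)) := by gcongr
      _ = δ * (δ - 1) / t ^ 4 := by field_simp
      _ ≤ δ * (δ - 1) / t := by
          gcongr
          exact le_self_pow₀ ht (by norm_num)


/-- The instance `a(x) = x^δ` (with `1 < δ < 2`, so `a'(x) = δ·x^{δ−1}`) of the
equidistribution Lemma 5.7 of the paper. -/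
theorem stmt_15 (δ : ℝ) (hδ1 : 1 < δ) (hδ2 : δ < 2) :
    ∀ ε : ℝ, 0 < ε →
      ∃ k l : ℕ → ℕ,
        (∀ m, k m ≤ l m) ∧
        Tendsto (fun m => l m - k m) atTop atTop ∧
        (∃ M : ℕ, ∀ m : ℕ, M ≤ m → ∀ n : ℕ, k m ≤ n → n ≤ l m →
          (m : ℝ) ≤ δ * (n : ℝ) ^ (δ - 1) ∧ δ * (n : ℝ) ^ (δ - 1) ≤ (m : ℝ) + ε) ∧
        ∀ s : ℤ, s ≠ 0 →
          Tendsto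
            (fun m : ℕ => ((l m : ℂ) - (k m : ℂ) + 1)⁻¹ *
              ∑ n ∈ Finset.Icc (k m) (l m),
                Complex.exp (2 * Real.pi * Complex.I * ((s : ℂ) * ((n : ℝ) ^ δ : ℝ))))
            atTop (nhds 0) := by
  intro ε hε
  have hC : 0 < δ * (δ - 1) := mul_pos (by linarith) (by linarith)
  set X : ℕ → ℝ := fun m => ((m : ℝ) / δ) ^ (1 / (δ - 1)) with hX
  set T : ℕ → ℝ := fun m => X m ^ ((2 - δ) / 8) with hT
  have hXt : Tendsto X atTop atTop :=
    (tendsto_rpow_atTop (by apply div_pos <;> linarith)).comp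
      (tendsto_natCast_atTop_atTop.atTop_div_const (by linarith))
  have hTt : Tendsto T atTop atTop := (tendsto_rpow_atTop (by linarith)).comp hXt
  have hprop : ∀ᶠ m in atTop, 1 ≤ X m ∧ 1 ≤ T m ∧ δ * X m ^ (δ - 1) = (m : ℝ) ∧
      T m ^ 7 ≤ X m ∧ X m ^ (δ - 2) = 1 / T m ^ 8 := by
    filter_upwards [hXt.eventually_ge_atTop 1, hTt.eventually_ge_atTop 1] with m h1 h2
    have h0 : 0 ≤ X m := by linarith
    refine ⟨h1, h2, ?_, ?_, ?_⟩
    · simp only [hX]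
      rw [← Real.rpow_mul (by positivity), one_div_mul_cancel (by linarith), Real.rpow_one]
      field_simp
    · simp only [hT]
      rw [← Real.rpow_natCast, ← Real.rpow_mul h0]
      calc _ ≤ X m ^ (1 : ℝ) := Real.rpow_le_rpow_of_exponent_le h1 (by push_cast; linarith)
        _ = X m := Real.rpow_one _
    · simp only [hT]
      rw [← Real.rpow_natCast, ← Real.rpow_mul h0, one_div, ← Real.rpow_neg h0]
      congr 1
      push_cast
      ring
  refine ⟨fun m => ⌈X m + T m ^ 7⌉₊, fun m => ⌈X m + T m ^ 7⌉₊ + ⌊T m ^ 2⌋₊,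
    fun m => Nat.le_add_right _ _, ?_, ?_, ?_⟩
  · simp only [Nat.add_sub_cancel_left]
    exact tendsto_nat_floor_atTop.comp ((tendsto_pow_atTop (by norm_num)).comp hTt)
  · have h3 : ∀ᶠ m in atTop, 3 * (δ * (δ - 1)) / T m ≤ ε :=
      (hTt.const_div_atTop _).eventually_le_const hε
    obtain ⟨M, hM⟩ := eventually_atTop.mp (hprop.and h3)
    refine ⟨M, fun m hm n h1 h2 => ?_⟩
    obtain ⟨⟨p1, p2, p3, p4, p5⟩, p6⟩ := hM m hm
    obtain ⟨q1, q2⟩ := aux_scale δ hδ1 hδ2 (X m) (T m) m p1 p2 p3 p4 p5 n h1 h2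
    have : 0 ≤ δ * (δ - 1) * (4 : ℝ) ^ (δ - 2) / T m := by positivity
    constructor <;> linarith
  · intro s hs
    have h3 : ∀ᶠ m in atTop, |(s : ℝ)| * (3 * (δ * (δ - 1)) / T m) ≤ 1 / 2 := by
      have := (hTt.const_div_atTop (3 * (δ * (δ - 1)))).const_mul |(s : ℝ)|
      rw [mul_zero] at this
      exact this.eventually_le_const (by norm_num)
    have hb := (hTt.const_div_atTop (2 * Real.pi * |(s : ℝ)| * (δ * (δ - 1)))).add
      (hTt.const_div_atTop (1 / (2 * |(s : ℝ)| * (δ * (δ - 1) * (4 : ℝ) ^ (δ - 2)))))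
    rw [add_zero] at hb
    refine squeeze_zero_norm' ?_ hb
    filter_upwards [hprop, h3] with m hp h3
    obtain ⟨p1, p2, p3, p4, p5⟩ := hp
    exact aux_sum δ hδ1 hδ2 (X m) (T m) m p1 p2 p3 p4 p5 s hs h3 _ _ rfl rfl
end
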